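/- arXiv:2008.12174 — 3 statements merged into one kernel-verified Lean document; each statement's English description precedes it below -/
import Mathlib

section
/- Let S ⊆ R be a separable Frobenius extension of rings. If every left S-module has a Gorenstein projective precover, then every left R-module has a Gorenstein projective precover. -/
open CategoryTheory Limits

/-- An object `M` of an abelian category is *Gorenstein projective* if it is a syzygy
(the kernel `ker(P⁰ → P¹)`) of an acyclic complex `P` of projective objects such that
`Hom(P, Q)` is acyclic for every projective `Q`. -/
def IsGorensteinProjective {A : Type*} [Category A] [Abelian A] (M : A) : Prop :=
  ∃ P : CochainComplex A ℤ,
    (∀ n : ℤ, Projective (P.X n)) ∧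
    (∀ n : ℤ, P.ExactAt n) ∧
    Nonempty (M ≅ P.cycles 0) ∧
    ∀ (Q : A), Projective Q → ∀ (n : ℤ) (f : P.X n ⟶ Q), P.d (n - 1) n ≫ f = 0 →
      ∃ g : P.X (n + 1) ⟶ Q, P.d n (n + 1) ≫ g = f

/-- `φ : X ⟶ M` is an `𝒳`-precover of `M` if `X ∈ 𝒳` and every morphism from an object
of `𝒳` to `M` factors through `φ`. -/
def IsPrecover {A : Type*} [Category A] (𝒳 : A → Prop) {X M : A} (φ : X ⟶ M) : Prop :=
  𝒳 X ∧ ∀ (X' : A), 𝒳 X' → ∀ f : X' ⟶ M, ∃ g : X' ⟶ X, g ≫ φ = f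

/-- A functor is *separable* if there are natural retraction maps on Hom-sets. -/
def CategoryTheory.Functor.Separable {C D : Type*} [Category C] [Category D]
    (F : C ⥤ D) : Prop :=
  ∃ φ : ∀ M N : C, (F.obj M ⟶ F.obj N) → (M ⟶ N),
    (∀ (M N : C) (θ : M ⟶ N), φ M N (F.map θ) = θ) ∧
    (∀ (M N M' N' : C) (α : M ⟶ M') (β : N ⟶ N')
        (f : F.obj M ⟶ F.obj N) (g : F.obj M' ⟶ F.obj N'),
      f ≫ F.map β = F.map α ≫ g → φ M N f ≫ β = α ≫ φ M' N' g)

section GorensteinProjective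

open CategoryTheory Limits Function

universe u

section

theorem LinearMap.exists_comp_eq_of_ker_le {R A B C : Type*} [Ring R] [AddCommGroup A]
    [AddCommGroup B] [AddCommGroup C] [Module R A] [Module R B] [Module R C]
    {s : A →ₗ[R] B} (hs : Surjective s) (f : A →ₗ[R] C) (h : ∀ a, s a = 0 → f a = 0) :
    ∃ g : B →ₗ[R] C, g ∘ₗ s = f := by
  refine ⟨(LinearMap.ker s).liftQ f (fun a ha ↦ h a ha) ∘ₗ
    (s.quotKerEquivOfSurjective hs).symm, ?_⟩
  ext a
  have : (s.quotKerEquivOfSurjective hs).symm (s a) = (LinearMap.ker s).mkQ a := by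
    rw [LinearEquiv.symm_apply_eq]; rfl
  exact congrArg ((LinearMap.ker s).liftQ f fun a ha ↦ h a ha) this

theorem LinearMap.exists_comp_eq_of_range_le {R A B C : Type*} [Ring R] [AddCommGroup A]
    [AddCommGroup B] [AddCommGroup C] [Module R A] [Module R B] [Module R C]
    {i : A →ₗ[R] B} (hi : Injective i) (f : C →ₗ[R] B) (h : ∀ c, ∃ a, i a = f c) :
    ∃ g : C →ₗ[R] A, i ∘ₗ g = f :=
  ⟨(LinearEquiv.ofInjective i hi).symm ∘ₗ f.codRestrict (LinearMap.range i) h, by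
    ext c
    exact congr(($((LinearEquiv.ofInjective i hi).apply_symm_apply
      (f.codRestrict (LinearMap.range i) h c)) : B))⟩

/-- The sequence `0 → A → B → C → 0` given by `i` and `p` is exact. -/
structure IsShortExact {R A B C : Type*} [Ring R] [AddCommGroup A] [AddCommGroup B]
    [AddCommGroup C] [Module R A] [Module R B] [Module R C] (i : A →ₗ[R] B) (p : B →ₗ[R] C) :
    Prop where
  injective : Injective i
  exact : Exact i p
  surjective : Surjective p

namespace IsShortExact

variable {R A B C D : Type*} [Ring R] [AddCommGroup A] [AddCommGroup B]
    [AddCommGroup C] [AddCommGroup D] [Module R A] [Module R B] [Module R C] [Module R D]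
    {i : A →ₗ[R] B} {p : B →ₗ[R] C}

theorem apply_apply (h : IsShortExact i p) (a : A) : p (i a) = 0 := h.exact.apply_apply_eq_zero a

theorem exists_desc (h : IsShortExact i p) (f : B →ₗ[R] D) (hf : f ∘ₗ i = 0) :
    ∃ g : C →ₗ[R] D, g ∘ₗ p = f :=
  LinearMap.exists_comp_eq_of_ker_le h.surjective f fun b hb ↦ by
    obtain ⟨a, rfl⟩ := (h.exact b).1 hb
    exact congr($hf a)

theorem exists_lift (h : IsShortExact i p) (f : D →ₗ[R] B) (hf : p ∘ₗ f = 0) :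
    ∃ g : D →ₗ[R] A, i ∘ₗ g = f :=
  LinearMap.exists_comp_eq_of_range_le h.injective f fun d ↦ (h.exact (f d)).1 congr($hf d)

theorem of_surjective (hp : Surjective p) : IsShortExact (LinearMap.ker p).subtype p :=
  ⟨Subtype.val_injective, fun b ↦ by simp, hp⟩

theorem of_injective (hi : Injective i) : IsShortExact i (LinearMap.range i).mkQ :=
  ⟨hi, fun b ↦ by simp [Submodule.Quotient.mk_eq_zero], Submodule.mkQ_surjective _⟩

end IsShortExact

variable {R : Type u} [Ring R]

/-- `Ext¹(M, P) = 0`, formulated as an extension property. -/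
def ExtOrthogonal (R : Type u) [Ring R] (M P : Type u) [AddCommGroup M] [Module R M]
    [AddCommGroup P] [Module R P] : Prop :=
  ∀ (X E : Type u) [AddCommGroup X] [Module R X] [AddCommGroup E] [Module R E]
    (i : X →ₗ[R] E) (p : E →ₗ[R] M), IsShortExact i p →
    ∀ f : X →ₗ[R] P, ∃ g : E →ₗ[R] P, g ∘ₗ i = f

section

variable {M M' M'' P Q Y : Type u} [AddCommGroup M] [Module R M] [AddCommGroup P] [Module R P]
  [AddCommGroup Q] [Module R Q] [AddCommGroup Y] [Module R Y] [AddCommGroup M'] [Module R M']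
  [AddCommGroup M''] [Module R M'']

theorem ExtOrthogonal.of_presentation [Module.Projective R Q] {j : Y →ₗ[R] Q} {q : Q →ₗ[R] M}
    (hj : IsShortExact j q) (h : ∀ f : Y →ₗ[R] P, ∃ g : Q →ₗ[R] P, g ∘ₗ j = f) :
    ExtOrthogonal R M P := by
  intro X E _ _ _ _ i p hi f
  obtain ⟨l, hl⟩ := Module.projective_lifting_property p q hi.surjective
  obtain ⟨k, hk⟩ := hi.exists_lift (l ∘ₗ j) (by
    ext y; simpa [hj.apply_apply] using congr($hl (j y)))
  obtain ⟨g₀, hg₀⟩ := h (f ∘ₗ k)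
  have hs : Surjective (i.coprod l) := fun e ↦ by
    obtain ⟨q', hq'⟩ := hj.surjective (p e)
    obtain ⟨x, hx⟩ := (hi.exact (e - l q')).1 (by
      rw [map_sub, sub_eq_zero, ← hq']; exact congr($hl q').symm)
    exact ⟨(x, q'), by simp [hx]⟩
  obtain ⟨g, hg⟩ := LinearMap.exists_comp_eq_of_ker_le hs (f.coprod g₀) (by
    rintro ⟨x, q'⟩ hxq
    simp only [LinearMap.coprod_apply] at hxq ⊢
    obtain ⟨y, rfl⟩ := (hj.exact q').1 (by
      have := congr(p $hxq)
      rw [map_add, hi.apply_apply, zero_add, map_zero] at this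
      rw [← this]; exact congr($hl q').symm)
    have h1 : i (x + k y) = 0 := by
      rw [map_add, ← hxq]; congr 1; exact congr($hk y)
    have h2 := hi.injective (h1.trans (map_zero i).symm)
    have h3 : g₀ (j y) = f (k y) := congr($hg₀ y)
    rw [h3, ← map_add, h2, map_zero])
  exact ⟨g, by ext x; simpa using congr($hg (x, 0))⟩

theorem ExtOrthogonal.of_equiv (e : M ≃ₗ[R] M') (h : ExtOrthogonal R M P) :
    ExtOrthogonal R M' P := fun X E _ _ _ _ i p hi f ↦
  h X E i (e.symm.toLinearMap ∘ₗ p) ⟨hi.injective, fun b ↦ by simpa using hi.exact b,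
    e.symm.surjective.comp hi.surjective⟩ f

theorem ExtOrthogonal.of_projective [Module.Projective R M] : ExtOrthogonal R M P := by
  refine .of_presentation (j := (0 : PUnit.{u+1} →ₗ[R] M)) (q := .id)
    ⟨fun _ _ _ ↦ rfl, fun b ↦ ?_, surjective_id⟩
    fun f ↦ ⟨0, LinearMap.ext fun y ↦ (map_zero f).symm⟩
  exact ⟨fun h ↦ ⟨0, h.symm⟩, fun ⟨_, h⟩ ↦ h.symm⟩

theorem ExtOrthogonal.of_shortExact {i : M' →ₗ[R] M} {p : M →ₗ[R] M''} (hi : IsShortExact i p)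
    (h' : ExtOrthogonal R M' P) (h'' : ExtOrthogonal R M'' P) : ExtOrthogonal R M P := by
  intro X E _ _ _ _ j q hj f
  let W := LinearMap.ker (p ∘ₗ q)
  obtain ⟨k, hk⟩ := (LinearMap.exists_comp_eq_of_range_le hj.injective j fun c ↦ ⟨c, rfl⟩)
  obtain ⟨s, hs⟩ := hi.exists_lift (q ∘ₗ W.subtype) (by ext w; exact w.2)
  have hs' (w : W) : i (s w) = q w := congr($hs w)
  let jW : X →ₗ[R] W := j.codRestrict W fun x ↦ by simp [W, hj.apply_apply]
  obtain ⟨g, hg⟩ := h' X W jW s ⟨fun x y hxy ↦ hj.injective congr(($hxy : E)), fun w ↦ by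
    rw [← hi.injective.eq_iff, hs', map_zero, hj.exact]
    exact ⟨fun ⟨x, hx⟩ ↦ ⟨x, Subtype.ext hx⟩, fun ⟨x, hx⟩ ↦ ⟨x, congr(($hx : E))⟩⟩,
    fun m ↦ by
      obtain ⟨e, he⟩ := hj.surjective (i m)
      exact ⟨⟨e, by simp [W, he, hi.apply_apply]⟩, hi.injective (by rw [hs', he])⟩⟩ f
  obtain ⟨g', hg'⟩ := h'' W E W.subtype (p ∘ₗ q) (.of_surjective
    (hi.surjective.comp hj.surjective)) g
  exact ⟨g', by ext x; exact congr($hg' (jW x)).trans congr($hg x)⟩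

theorem ExtOrthogonal.of_retract {i : M →ₗ[R] M'} {r : M' →ₗ[R] M} (hri : r ∘ₗ i = .id)
    (h : ExtOrthogonal R M' P) : ExtOrthogonal R M P := by
  intro X E _ _ _ _ j q hj f
  let W := LinearMap.ker (q.coprod (-r))
  obtain ⟨g, hg⟩ := h X W ((LinearMap.inl R E M' ∘ₗ j).codRestrict W fun x ↦ by
      simp [W, hj.apply_apply]) (LinearMap.snd R E M' ∘ₗ W.subtype)
    ⟨fun x y hxy ↦ hj.injective congr(($hxy : E × M').1), fun w ↦ by
      obtain ⟨⟨e, m⟩, hw⟩ := w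
      simp only [W, LinearMap.mem_ker, LinearMap.coprod_apply, LinearMap.neg_apply] at hw
      refine ⟨fun h ↦ ?_, fun ⟨x, hx⟩ ↦ congr(($hx : E × M').2).symm⟩
      obtain rfl : m = 0 := h
      obtain ⟨x, rfl⟩ := (hj.exact e).1 (by simpa using hw)
      exact ⟨x, rfl⟩,
    fun m ↦ by
      obtain ⟨e, he⟩ := hj.surjective (r m)
      exact ⟨⟨(e, m), by simp [W, he]⟩, rfl⟩⟩ f
  refine ⟨g ∘ₗ (LinearMap.id.prod (i ∘ₗ q)).codRestrict W fun e ↦ ?_, ?_⟩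
  · simpa [W, sub_eq_zero, ← sub_eq_add_neg] using congr($hri (q e)).symm
  · rw [← hg]
    ext x
    simp only [LinearMap.comp_apply]
    refine congrArg g (Subtype.ext (Prod.ext rfl ?_))
    exact (congrArg i (hj.apply_apply x)).trans (map_zero i)

theorem ExtOrthogonal.retract_right {i : P →ₗ[R] Q} {r : Q →ₗ[R] P} (hri : r ∘ₗ i = .id)
    (h : ExtOrthogonal R M Q) : ExtOrthogonal R M P := by
  intro X E _ _ _ _ j q hj f
  obtain ⟨g, hg⟩ := h X E j q hj (i ∘ₗ f)
  exact ⟨r ∘ₗ g, by rw [LinearMap.comp_assoc, hg, ← LinearMap.comp_assoc, hri,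
    LinearMap.id_comp]⟩

end

/-- A class of modules all of whose members have both a projective syzygy and a projective
cosyzygy in the class, and are left orthogonal to all projective modules. -/
def IsTwoSidedClass (𝒢 : ModuleCat.{u} R → Prop) : Prop :=
  ∀ M, 𝒢 M →
    (∀ P : ModuleCat.{u} R, Module.Projective R P → ExtOrthogonal R M P) ∧
    (∃ (Q M' : ModuleCat.{u} R) (i : M →ₗ[R] Q) (p : Q →ₗ[R] M'),
      Module.Projective R Q ∧ IsShortExact i p ∧ 𝒢 M') ∧
    (∃ (M' Q : ModuleCat.{u} R) (i : M' →ₗ[R] Q) (p : Q →ₗ[R] M),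
      Module.Projective R Q ∧ IsShortExact i p ∧ 𝒢 M')

theorem exists_int_sequence {α : Type*} (r : α → α → Prop) (hr : ∀ x, ∃ y, r x y)
    (hl : ∀ y, ∃ x, r x y) (x : α) : ∃ s : ℤ → α, s 0 = x ∧ ∀ n, r (s n) (s (n + 1)) := by
  choose f hf using hr
  choose g hg using hl
  let s : ℤ → α
    | .ofNat n => f^[n] x
    | .negSucc n => g^[n + 1] x
  refine ⟨s, rfl, ?_⟩
  rintro (n | n | n)
  · change r (f^[n] x) (f^[n + 1] x)
    rw [Function.iterate_succ_apply']
    exact hf _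
  · exact hg x
  · change r (g^[n + 1 + 1] x) (g^[n + 1] x)
    rw [Function.iterate_succ_apply' g (n + 1)]
    exact hg _

theorem IsTwoSidedClass.isGorensteinProjective {𝒢 : ModuleCat.{u} R → Prop}
    (h𝒢 : IsTwoSidedClass 𝒢) {M : ModuleCat.{u} R} (hM : 𝒢 M) : IsGorensteinProjective M := by
  obtain ⟨s, hs0, hs⟩ := exists_int_sequence (α := { M // 𝒢 M })
    (fun A C ↦ ∃ (Q : ModuleCat.{u} R) (i : A.1 →ₗ[R] Q) (p : Q →ₗ[R] C.1),
      Module.Projective R Q ∧ IsShortExact i p)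
    (fun A ↦ by
      obtain ⟨-, ⟨Q, M', i, p, h1, h2, h3⟩, -⟩ := h𝒢 _ A.2
      exact ⟨⟨M', h3⟩, Q, i, p, h1, h2⟩)
    (fun A ↦ by
      obtain ⟨-, -, ⟨M', Q, i, p, h1, h2, h3⟩⟩ := h𝒢 _ A.2
      exact ⟨⟨M', h3⟩, Q, i, p, h1, h2⟩) ⟨M, hM⟩
  choose Q i p hQ hip using hs
  have hd (n : ℤ) : (ModuleCat.ofHom (i (n + 1) ∘ₗ p n)) ≫
      (ModuleCat.ofHom (i (n + 1 + 1) ∘ₗ p (n + 1))) = 0 := by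
    ext x
    simp [(hip (n + 1)).apply_apply]
  let K : CochainComplex (ModuleCat.{u} R) ℤ := CochainComplex.of Q
    (fun n ↦ ModuleCat.ofHom (i (n + 1) ∘ₗ p n)) hd
  have hK (n : ℤ) : K.d n (n + 1) = ModuleCat.ofHom (i (n + 1) ∘ₗ p n) :=
    CochainComplex.of_d Q
    (fun n ↦ ModuleCat.ofHom (i (n + 1) ∘ₗ p n)) n
  have hKer (n : ℤ) (x : Q n) : K.d n (n + 1) x = 0 ↔ ∃ y, i n y = x := by
    rw [hK]
    refine Iff.trans ?_ ((hip n).exact x)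
    exact ⟨fun h ↦ (hip (n + 1)).injective (h.trans (map_zero _).symm),
      fun h ↦ (congrArg (i (n + 1)) h).trans (map_zero _)⟩
  refine ⟨K, fun n ↦ (IsProjective.iff_projective _).1 (hQ n), fun n ↦ ?_, ?_, fun P hP n f hf ↦ ?_⟩
  · obtain ⟨n, rfl⟩ : ∃ m, n = m + 1 := ⟨n - 1, by simp⟩
    rw [K.exactAt_iff' n (n + 1) (n + 1 + 1) (by simp) (by simp),
      ShortComplex.moduleCat_exact_iff]
    intro x hx
    obtain ⟨y, rfl⟩ := (hKer (n + 1) x).1 hx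
    obtain ⟨z, rfl⟩ := (hip n).surjective y
    exact ⟨z, congr($(hK n) z)⟩
  · let T : ShortComplex (ModuleCat.{u} R) := ShortComplex.mk (X₁ := (s 0).1)
      (ModuleCat.ofHom (i 0)) (K.d 0 1) (by
        ext x
        exact (hKer 0 _).2 ⟨x, rfl⟩)
    have hT : T.Exact := (ShortComplex.moduleCat_exact_iff _).2 fun x hx ↦ (hKer 0 x).1 hx
    have : Mono T.f := (ModuleCat.mono_iff_injective _).2 (hip 0).injective
    have e : (s 0).1 ≅ K.cycles 0 :=
      hT.fIsKernel.conePointUniqueUpToIso (K.cyclesIsKernel 0 1 (by simp))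
    rw [hs0] at e
    exact ⟨e⟩
  · obtain ⟨n, rfl⟩ : ∃ m, n = m + 1 := ⟨n - 1, by simp⟩
    obtain ⟨k, hk⟩ := (hip (n + 1)).exists_desc f.hom (by
      ext y
      obtain ⟨z, rfl⟩ := (hip n).surjective y
      have : ∀ m, m = n + 1 - 1 → K.d m (n + 1) ≫ f = 0 := by rintro _ rfl; exact hf
      replace this := this n (by simp)
      rw [hK] at this
      exact congr($this z))
    obtain ⟨g, hg⟩ := (h𝒢 _ (s (n + 1 + 1 + 1)).2).1 P ((IsProjective.iff_projective _).2 hP)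
      _ _ _ _ (hip (n + 1 + 1)) k
    refine ⟨ModuleCat.ofHom g, ?_⟩
    rw [hK]
    ext x
    exact congr($hg (p (n + 1) x)).trans congr($hk x)

theorem isTwoSidedClass_isGorensteinProjective :
    IsTwoSidedClass (IsGorensteinProjective (A := ModuleCat.{u} R)) := by
  let 𝒞 : ModuleCat.{u} R → Prop := fun M ↦ ∃ P : CochainComplex (ModuleCat.{u} R) ℤ,
    (∀ n : ℤ, Projective (P.X n)) ∧ (∀ n : ℤ, P.ExactAt n) ∧
    (∃ n : ℤ, Nonempty (M ≅ P.cycles n)) ∧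
    ∀ Q, Projective Q → ∀ (n : ℤ) (f : P.X n ⟶ Q), P.d (n - 1) n ≫ f = 0 →
      ∃ g : P.X (n + 1) ⟶ Q, P.d n (n + 1) ≫ g = f
  have hses (P : CochainComplex (ModuleCat.{u} R) ℤ) (hP : ∀ n, P.ExactAt n) (n : ℤ) :
      IsShortExact (P.iCycles n).hom (P.toCycles n (n + 1)).hom := by
    have hinj (n : ℤ) : Injective (P.iCycles n) := (ModuleCat.mono_iff_injective _).1 inferInstance
    have hi (n : ℤ) (x : P.X n) : P.iCycles (n + 1) (P.toCycles n (n + 1) x) = P.d n (n + 1) x :=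
      congr($(P.toCycles_i n (n + 1)) x)
    have hker (n : ℤ) (x : P.X n) : P.d n (n + 1) x = 0 ↔ ∃ y, P.iCycles n y = x := by
      refine ⟨fun h ↦ (ShortComplex.moduleCat_exact_iff _).1
        (ShortComplex.exact_of_f_is_kernel (ShortComplex.mk _ _ (P.iCycles_d n (n + 1)))
          (P.cyclesIsKernel n (n + 1) (by simp))) x h, ?_⟩
      rintro ⟨y, rfl⟩
      exact congr($(P.iCycles_d n (n + 1)) y)
    refine ⟨hinj n, fun x ↦ ?_, fun c ↦ ?_⟩
    · refine Iff.trans ⟨fun h ↦ ?_, fun h ↦ hinj (n + 1) ?_⟩ (hker n x)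
      · rw [← hi]; exact (congrArg _ h).trans (map_zero _)
      · rw [map_zero]; exact (hi n x).trans h
    · obtain ⟨x, hx⟩ := (ShortComplex.moduleCat_exact_iff _).1
        ((P.exactAt_iff' n (n + 1) (n + 1 + 1) (by simp) (by simp)).1 (hP (n + 1)))
        (P.iCycles (n + 1) c) ((hker _ _).2 ⟨c, rfl⟩)
      exact ⟨x, hinj (n + 1) ((hi n x).trans hx)⟩
  have h𝒞 : IsTwoSidedClass 𝒞 := by
    rintro M ⟨P, hproj, hex, ⟨n, ⟨e⟩⟩, hhom⟩
    obtain ⟨n, rfl⟩ : ∃ m, n = m + 1 := ⟨n - 1, by simp⟩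
    have hproj' (n) : Module.Projective R (P.X n) := (IsProjective.iff_projective _).2 (hproj n)
    have h1 := hses P hex n
    have h2 := hses P hex (n + 1)
    have h2' : IsShortExact ((P.iCycles (n + 1)).hom ∘ₗ e.toLinearEquiv.toLinearMap)
        (P.toCycles (n + 1) (n + 1 + 1)).hom := ⟨h2.injective.comp e.toLinearEquiv.injective,
        fun x ↦ (h2.exact x).trans ⟨fun ⟨y, hy⟩ ↦ ⟨e.toLinearEquiv.symm y, by simpa using hy⟩,
          fun ⟨y, hy⟩ ↦ ⟨_, hy⟩⟩, h2.surjective⟩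
    have h1' : IsShortExact (P.iCycles n).hom
        (e.toLinearEquiv.symm.toLinearMap ∘ₗ (P.toCycles n (n + 1)).hom) := ⟨h1.injective,
        fun x ↦ (e.toLinearEquiv.symm.map_eq_zero_iff).trans (h1.exact x),
        e.toLinearEquiv.symm.surjective.comp h1.surjective⟩
    refine ⟨fun Q hQ ↦ ?_, ⟨_, _, _, _, hproj' _, h2', P, hproj, hex, ⟨_, ⟨Iso.refl _⟩⟩, hhom⟩,
      ⟨_, _, _, _, hproj' _, h1', P, hproj, hex, ⟨_, ⟨Iso.refl _⟩⟩, hhom⟩⟩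
    refine .of_equiv e.toLinearEquiv.symm (.of_presentation h1 fun f ↦ ?_)
    let f' : P.cycles n ⟶ Q := ModuleCat.ofHom f
    obtain ⟨n, rfl⟩ : ∃ m, n = m + 1 := ⟨n - 1, by simp⟩
    obtain ⟨g, hg⟩ := hhom Q ((IsProjective.iff_projective _).1 hQ) n
      (P.toCycles n (n + 1) ≫ f') (by simp)
    refine ⟨g.hom, ?_⟩
    ext y
    obtain ⟨x, rfl⟩ := (hses P hex n).surjective y
    refine Eq.trans ?_ congr($hg x)
    exact congr(g ($(P.toCycles_i n (n + 1)) x))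
  intro M hM
  obtain ⟨P, h1, h2, h3, h4⟩ := hM
  obtain ⟨ha, ⟨Q, M', i, p, hQ, hip, hM'⟩, ⟨L, Q', i', p', hQ', hip', hL⟩⟩ :=
    h𝒞 M ⟨P, h1, h2, ⟨0, h3⟩, h4⟩
  exact ⟨ha, ⟨Q, M', i, p, hQ, hip, h𝒞.isGorensteinProjective hM'⟩,
    ⟨L, Q', i', p', hQ', hip', h𝒞.isGorensteinProjective hL⟩⟩

end

section

variable {R : Type u} [Ring R]

/-- Gorenstein projectivity for unbundled modules. -/
def IsGorensteinProjectiveModule (R : Type u) [Ring R] (M : Type u) [AddCommGroup M] [Module R M] :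
    Prop := IsGorensteinProjective (ModuleCat.of R M)

namespace IsShortExact

variable {A B C D : Type*} [AddCommGroup A] [AddCommGroup B]
    [AddCommGroup C] [AddCommGroup D] [Module R A] [Module R B] [Module R C] [Module R D]
    {i : A →ₗ[R] B} {p : B →ₗ[R] C}

theorem comp_equiv_left (h : IsShortExact i p) (e : D ≃ₗ[R] A) :
    IsShortExact (i ∘ₗ e.toLinearMap) p :=
  ⟨h.injective.comp e.injective, fun x ↦ (h.exact x).trans
    ⟨fun ⟨y, hy⟩ ↦ ⟨e.symm y, by simpa using hy⟩, fun ⟨y, hy⟩ ↦ ⟨_, hy⟩⟩, h.surjective⟩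

theorem equiv_comp_right (h : IsShortExact i p) (e : C ≃ₗ[R] D) :
    IsShortExact i (e.toLinearMap ∘ₗ p) :=
  ⟨h.injective, fun x ↦ e.map_eq_zero_iff.trans (h.exact x), e.surjective.comp h.surjective⟩

theorem inl_snd : IsShortExact (LinearMap.inl R A B) (LinearMap.snd R A B) :=
  ⟨LinearMap.inl_injective, .inl_snd, LinearMap.snd_surjective⟩

theorem dfinsupp_mapRange {ι : Type*} {A B C : ι → Type*} [∀ i, AddCommGroup (A i)]
    [∀ i, AddCommGroup (B i)] [∀ i, AddCommGroup (C i)] [∀ i, Module R (A i)]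
    [∀ i, Module R (B i)] [∀ i, Module R (C i)] {i : ∀ k, A k →ₗ[R] B k} {p : ∀ k, B k →ₗ[R] C k}
    (h : ∀ k, IsShortExact (i k) (p k)) :
    IsShortExact (DFinsupp.mapRange.linearMap i) (DFinsupp.mapRange.linearMap p) where
  injective := (DFinsupp.mapRange_injective _ fun _ ↦ map_zero _).2 fun k ↦ (h k).injective
  surjective := (DFinsupp.mapRange_surjective _ fun _ ↦ map_zero _).2 fun k ↦ (h k).surjective
  exact := by
    rw [LinearMap.exact_iff, DFinsupp.ker_mapRangeLinearMap, DFinsupp.range_mapRangeLinearMap]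
    exact congrArg (fun K ↦ Submodule.comap _ (Submodule.pi Set.univ K))
      (funext fun k ↦ LinearMap.exact_iff.1 (h k).exact)

/-- The nine lemma for cokernels. -/
theorem cokernel {A₁ A₂ A₃ B₁ B₂ B₃ C₁ C₂ C₃ : Type*} [AddCommGroup A₁] [AddCommGroup A₂]
    [AddCommGroup A₃] [AddCommGroup B₁] [AddCommGroup B₂] [AddCommGroup B₃] [AddCommGroup C₁]
    [AddCommGroup C₂] [AddCommGroup C₃] [Module R A₁] [Module R A₂] [Module R A₃] [Module R B₁]
    [Module R B₂] [Module R B₃] [Module R C₁] [Module R C₂] [Module R C₃]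
    {a₁ : A₁ →ₗ[R] A₂} {a₂ : A₂ →ₗ[R] A₃} {b₁ : B₁ →ₗ[R] B₂} {b₂ : B₂ →ₗ[R] B₃}
    {f₁ : A₁ →ₗ[R] B₁} {f₂ : A₂ →ₗ[R] B₂} {f₃ : A₃ →ₗ[R] B₃}
    {g₁ : B₁ →ₗ[R] C₁} {g₂ : B₂ →ₗ[R] C₂} {g₃ : B₃ →ₗ[R] C₃}
    (ha : IsShortExact a₁ a₂) (hb : IsShortExact b₁ b₂)
    (h₁ : IsShortExact f₁ g₁) (h₂ : IsShortExact f₂ g₂) (h₃ : IsShortExact f₃ g₃)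
    (comm₁ : f₂ ∘ₗ a₁ = b₁ ∘ₗ f₁) (comm₂ : f₃ ∘ₗ a₂ = b₂ ∘ₗ f₂) :
    ∃ (c₁ : C₁ →ₗ[R] C₂) (c₂ : C₂ →ₗ[R] C₃), IsShortExact c₁ c₂ ∧
      c₁ ∘ₗ g₁ = g₂ ∘ₗ b₁ ∧ c₂ ∘ₗ g₂ = g₃ ∘ₗ b₂ := by
  obtain ⟨c₁, hc₁⟩ := h₁.exists_desc (g₂ ∘ₗ b₁) (by
    rw [LinearMap.comp_assoc, ← comm₁]; ext; simp [h₂.apply_apply])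
  obtain ⟨c₂, hc₂⟩ := h₂.exists_desc (g₃ ∘ₗ b₂) (by
    rw [LinearMap.comp_assoc, ← comm₂]; ext; simp [h₃.apply_apply])
  have e₁ (x) : c₁ (g₁ x) = g₂ (b₁ x) := congr($hc₁ x)
  have e₂ (x) : c₂ (g₂ x) = g₃ (b₂ x) := congr($hc₂ x)
  have k₁ (x) : f₂ (a₁ x) = b₁ (f₁ x) := congr($comm₁ x)
  have k₂ (x) : f₃ (a₂ x) = b₂ (f₂ x) := congr($comm₂ x)
  refine ⟨c₁, c₂, ⟨(injective_iff_map_eq_zero _).2 fun x hx ↦ ?_, fun x ↦ ⟨fun hx ↦ ?_, ?_⟩, ?_⟩,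
    hc₁, hc₂⟩
  · obtain ⟨x, rfl⟩ := h₁.surjective x
    rw [e₁] at hx
    obtain ⟨y, hy⟩ := (h₂.exact _).1 hx
    obtain ⟨z, rfl⟩ := (ha.exact y).1 (h₃.injective (by rw [k₂, hy, hb.apply_apply, map_zero]))
    rw [← hb.injective ((k₁ z).symm.trans hy), h₁.apply_apply]
  · obtain ⟨x, rfl⟩ := h₂.surjective x
    rw [e₂] at hx
    obtain ⟨y, hy⟩ := (h₃.exact _).1 hx
    obtain ⟨z, rfl⟩ := ha.surjective y
    obtain ⟨w, hw⟩ := (hb.exact (x - f₂ z)).1 (by rw [map_sub, ← k₂, hy, sub_self])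
    exact ⟨g₁ w, by rw [e₁, hw, map_sub, h₂.apply_apply, sub_zero]⟩
  · rintro ⟨y, rfl⟩
    obtain ⟨y, rfl⟩ := h₁.surjective y
    rw [e₁, e₂, hb.apply_apply, map_zero]
  · intro x
    obtain ⟨x, rfl⟩ := h₃.surjective x
    obtain ⟨x, rfl⟩ := hb.surjective x
    exact ⟨g₂ x, e₂ x⟩

/-- The nine lemma for kernels. -/
theorem kernel {A₁ A₂ A₃ B₁ B₂ B₃ C₁ C₂ C₃ : Type*} [AddCommGroup A₁] [AddCommGroup A₂]
    [AddCommGroup A₃] [AddCommGroup B₁] [AddCommGroup B₂] [AddCommGroup B₃] [AddCommGroup C₁]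
    [AddCommGroup C₂] [AddCommGroup C₃] [Module R A₁] [Module R A₂] [Module R A₃] [Module R B₁]
    [Module R B₂] [Module R B₃] [Module R C₁] [Module R C₂] [Module R C₃]
    {b₁ : B₁ →ₗ[R] B₂} {b₂ : B₂ →ₗ[R] B₃} {c₁ : C₁ →ₗ[R] C₂} {c₂ : C₂ →ₗ[R] C₃}
    {f₁ : A₁ →ₗ[R] B₁} {f₂ : A₂ →ₗ[R] B₂} {f₃ : A₃ →ₗ[R] B₃}
    {g₁ : B₁ →ₗ[R] C₁} {g₂ : B₂ →ₗ[R] C₂} {g₃ : B₃ →ₗ[R] C₃}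
    (hb : IsShortExact b₁ b₂) (hc : IsShortExact c₁ c₂)
    (h₁ : IsShortExact f₁ g₁) (h₂ : IsShortExact f₂ g₂) (h₃ : IsShortExact f₃ g₃)
    (comm₁ : g₂ ∘ₗ b₁ = c₁ ∘ₗ g₁) (comm₂ : g₃ ∘ₗ b₂ = c₂ ∘ₗ g₂) :
    ∃ (a₁ : A₁ →ₗ[R] A₂) (a₂ : A₂ →ₗ[R] A₃), IsShortExact a₁ a₂ := by
  obtain ⟨a₁, ha₁⟩ := h₂.exists_lift (b₁ ∘ₗ f₁) (by
    rw [← LinearMap.comp_assoc, comm₁]; ext; simp [h₁.apply_apply])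
  obtain ⟨a₂, ha₂⟩ := h₃.exists_lift (b₂ ∘ₗ f₂) (by
    rw [← LinearMap.comp_assoc, comm₂]; ext; simp [h₂.apply_apply])
  have e₁ (x) : f₂ (a₁ x) = b₁ (f₁ x) := congr($ha₁ x)
  have e₂ (x) : f₃ (a₂ x) = b₂ (f₂ x) := congr($ha₂ x)
  have k₁ (x) : g₂ (b₁ x) = c₁ (g₁ x) := congr($comm₁ x)
  have k₂ (x) : g₃ (b₂ x) = c₂ (g₂ x) := congr($comm₂ x)
  refine ⟨a₁, a₂, (injective_iff_map_eq_zero _).2 fun x hx ↦ ?_, fun x ↦ ⟨fun hx ↦ ?_, ?_⟩, ?_⟩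
  · apply h₁.injective
    apply hb.injective
    rw [← e₁, hx, map_zero, map_zero, map_zero]
  · obtain ⟨y, hy⟩ := (hb.exact (f₂ x)).1 (by rw [← e₂, hx, map_zero])
    obtain ⟨z, rfl⟩ := (h₁.exact y).1 (hc.injective (by rw [← k₁, hy, h₂.apply_apply, map_zero]))
    exact ⟨z, h₂.injective (by rw [e₁, hy])⟩
  · rintro ⟨y, rfl⟩
    apply h₃.injective
    rw [e₂, e₁, hb.apply_apply, map_zero]
  · intro x
    obtain ⟨y, hy⟩ := hb.surjective (f₃ x)
    obtain ⟨z, hz⟩ := (hc.exact (g₂ y)).1 (by rw [← k₂, hy, h₃.apply_apply])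
    obtain ⟨z, rfl⟩ := h₁.surjective z
    obtain ⟨w, hw⟩ := (h₂.exact (y - b₁ z)).1 (by rw [map_sub, k₁, hz, sub_self])
    exact ⟨w, h₃.injective (by rw [e₂, hw, map_sub, hy, hb.apply_apply, sub_zero])⟩

end IsShortExact

namespace IsGorensteinProjectiveModule

theorem of_isTwoSidedClass {𝒢 : ModuleCat.{u} R → Prop}
    (h𝒢 : IsTwoSidedClass 𝒢) (M : Type u) [AddCommGroup M] [Module R M]
    (hM : 𝒢 (ModuleCat.of R M)) : IsGorensteinProjectiveModule R M :=
  h𝒢.isGorensteinProjective hM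

variable {M M' M'' : Type u} [AddCommGroup M] [Module R M] [AddCommGroup M'] [Module R M']
  [AddCommGroup M''] [Module R M'']

theorem extOrthogonal (h : IsGorensteinProjectiveModule R M) (P : Type u) [AddCommGroup P]
    [Module R P] [hP : Module.Projective R P] : ExtOrthogonal R M P :=
  (isTwoSidedClass_isGorensteinProjective _ h).1 (ModuleCat.of R P) hP

theorem exists_cosyzygy (h : IsGorensteinProjectiveModule R M) :
    ∃ (Q M' : ModuleCat.{u} R) (i : M →ₗ[R] Q) (p : Q →ₗ[R] M'),
      Module.Projective R Q ∧ IsShortExact i p ∧ IsGorensteinProjectiveModule R M' :=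
  (isTwoSidedClass_isGorensteinProjective _ h).2.1

theorem exists_syzygy (h : IsGorensteinProjectiveModule R M) :
    ∃ (M' Q : ModuleCat.{u} R) (i : M' →ₗ[R] Q) (p : Q →ₗ[R] M),
      Module.Projective R Q ∧ IsShortExact i p ∧ IsGorensteinProjectiveModule R M' :=
  (isTwoSidedClass_isGorensteinProjective _ h).2.2

theorem of_equiv (e : M ≃ₗ[R] M') (h : IsGorensteinProjectiveModule R M) :
    IsGorensteinProjectiveModule R M' := by
  obtain ⟨P, h1, h2, ⟨f⟩, h4⟩ := h
  exact ⟨P, h1, h2, ⟨e.symm.toModuleIso ≪≫ f⟩, h4⟩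

theorem of_projective [hM : Module.Projective R M] : IsGorensteinProjectiveModule R M := by
  refine of_isTwoSidedClass (𝒢 := fun M ↦ Module.Projective R M) (fun M hM ↦
    ⟨fun P hP ↦ .of_projective, ⟨M, .of R PUnit, .id, 0, hM, ⟨injective_id, fun x ↦ ?_, ?_⟩,
      .of_free⟩, ⟨.of R PUnit, M, 0, .id, hM, ⟨?_, fun x ↦ ?_, surjective_id⟩, .of_free⟩⟩) M hM
  · simp
  · exact fun x ↦ ⟨0, rfl⟩
  · exact fun _ _ _ ↦ rfl
  · exact ⟨fun h ↦ ⟨0, h.symm⟩, fun ⟨_, h⟩ ↦ h.symm⟩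

theorem of_shortExact {i : M' →ₗ[R] M} {p : M →ₗ[R] M''} (hi : IsShortExact i p)
    (h' : IsGorensteinProjectiveModule R M') (h'' : IsGorensteinProjectiveModule R M'') :
    IsGorensteinProjectiveModule R M := by
  refine of_isTwoSidedClass (𝒢 := fun M ↦ ∃ (M' M'' : ModuleCat.{u} R) (i : M' →ₗ[R] M)
    (p : M →ₗ[R] M''), IsShortExact i p ∧ IsGorensteinProjectiveModule R M' ∧
      IsGorensteinProjectiveModule R M'') ?_ M ⟨.of R M', .of R M'', i, p, hi, h', h''⟩
  rintro M ⟨M', M'', i, p, hi, h', h''⟩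
  refine ⟨fun P hP ↦ .of_shortExact hi (h'.extOrthogonal P) (h''.extOrthogonal P), ?_, ?_⟩
  · obtain ⟨Q', N', i', p', _, hip', hN'⟩ := h'.exists_cosyzygy
    obtain ⟨Q'', N'', i'', p'', _, hip'', hN''⟩ := h''.exists_cosyzygy
    obtain ⟨k, hk⟩ := h''.extOrthogonal Q' _ _ i p hi i'
    have hk' (x) : k (i x) = i' x := congr($hk x)
    have hinj : Injective (k.prod (i'' ∘ₗ p)) := by
      refine (injective_iff_map_eq_zero _).2 fun x hx ↦ ?_
      obtain ⟨y, rfl⟩ := (hi.exact x).1 (hip''.injective (congr($hx.2).trans (map_zero _).symm))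
      rw [(injective_iff_map_eq_zero _).1 hip'.injective y
        ((hk' y).symm.trans congr($hx.1)), map_zero]
    obtain ⟨c₁, c₂, hc, -⟩ := hi.cokernel .inl_snd hip' (.of_injective hinj) hip''
      (by ext x <;> simp [hk', hi.apply_apply]) (by ext; simp)
    exact ⟨.of R (Q' × Q''), .of R _, _, _, inferInstanceAs (Module.Projective R (Q' × Q'')),
      .of_injective hinj, N', N'', c₁, c₂, hc, hN', hN''⟩
  · obtain ⟨N', Q', i', p', _, hip', hN'⟩ := h'.exists_syzygy
    obtain ⟨N'', Q'', i'', p'', _, hip'', hN''⟩ := h''.exists_syzygy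
    obtain ⟨k, hk⟩ := Module.projective_lifting_property p p'' hi.surjective
    have hk' (x) : p (k x) = p'' x := congr($hk x)
    have hsurj : Surjective ((i ∘ₗ p').coprod k) := fun x ↦ by
      obtain ⟨y, hy⟩ := hip''.surjective (p x)
      obtain ⟨z, hz⟩ := (hi.exact (x - k y)).1 (by rw [map_sub, hk', hy, sub_self])
      obtain ⟨z, rfl⟩ := hip'.surjective z
      exact ⟨(z, y), by simp [hz]⟩
    obtain ⟨c₁, c₂, hc⟩ := IsShortExact.kernel .inl_snd hi hip' (.of_surjective hsurj) hip''
      (by ext; simp) (by ext x <;> simp [hk', hi.apply_apply])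
    exact ⟨.of R _, .of R (Q' × Q''), _, _, inferInstanceAs (Module.Projective R (Q' × Q'')),
      .of_surjective hsurj, N', N'', c₁, c₂, hc, hN', hN''⟩

theorem prod (h : IsGorensteinProjectiveModule R M) (h' : IsGorensteinProjectiveModule R M') :
    IsGorensteinProjectiveModule R (M × M') :=
  of_shortExact .inl_snd h h'

theorem of_retract {i : M →ₗ[R] M'} {r : M' →ₗ[R] M} (hri : r ∘ₗ i = .id)
    (h' : IsGorensteinProjectiveModule R M') : IsGorensteinProjectiveModule R M := by
  refine of_isTwoSidedClass (𝒢 := fun M ↦ ∃ (A : ModuleCat.{u} R) (i : M →ₗ[R] A)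
    (r : A →ₗ[R] M), r ∘ₗ i = .id ∧ IsGorensteinProjectiveModule R A) ?_ M ⟨.of R M', i, r, hri, h'⟩
  rintro M ⟨A, i, r, hri, hA⟩
  have hri' (x) : r (i x) = x := congr($hri x)
  refine ⟨fun P hP ↦ .of_retract hri (hA.extOrthogonal P), ?_, ?_⟩
  · obtain ⟨Q, N, j, p, hQ, hjp, hN⟩ := hA.exists_cosyzygy
    have hinj : Injective (j ∘ₗ i) := hjp.injective.comp (LeftInverse.injective hri')
    have hses := IsShortExact.of_injective hinj
    obtain ⟨k, hk⟩ := hses.exists_desc p (by ext; simp [hjp.apply_apply])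
    have hk' (x) : k (Submodule.Quotient.mk x) = p x := congr($hk x)
    have hE : IsShortExact (((LinearMap.range (j ∘ₗ i)).mkQ ∘ₗ j).prod r)
        (k ∘ₗ LinearMap.fst R _ M) := by
      refine ⟨(injective_iff_map_eq_zero _).2 fun a ha ↦ ?_, ?_, ?_⟩
      · obtain ⟨m, hm⟩ := (hses.exact _).1 congr($ha.1)
        obtain rfl := hjp.injective hm
        rw [show m = 0 from (hri' m).symm.trans congr($ha.2), map_zero]
      · rintro ⟨c, m⟩
        obtain ⟨q, rfl⟩ := Submodule.mkQ_surjective _ c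
        constructor
        · intro h
          obtain ⟨a, rfl⟩ := (hjp.exact q).1 ((hk' q).symm.trans h)
          refine ⟨a - i (r a) + i m, Prod.ext ?_ (by simp [hri'])⟩
          have (x : M) : (LinearMap.range (j ∘ₗ i)).mkQ (j (i x)) = 0 := hses.apply_apply x
          change (LinearMap.range (j ∘ₗ i)).mkQ (j (a - i (r a) + i m)) = _
          simp only [map_add, map_sub, this, sub_zero, add_zero]
        · rintro ⟨a, ha⟩
          have h1 : (LinearMap.range (j ∘ₗ i)).mkQ (j a) =
            (LinearMap.range (j ∘ₗ i)).mkQ q := congr($ha.1)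
          change k ((LinearMap.range (j ∘ₗ i)).mkQ q) = 0
          rw [← h1]
          exact (hk' (j a)).trans (hjp.apply_apply a)
      · intro n
        obtain ⟨q, rfl⟩ := hjp.surjective n
        exact ⟨(Submodule.Quotient.mk q, 0), hk' q⟩
    exact ⟨Q, .of R _, _, _, hQ, hses, .of R (_ × _), LinearMap.inl R _ M, LinearMap.fst R _ M,
      rfl, of_shortExact hE hA hN⟩
  · obtain ⟨N, Q, j, p, hQ, hjp, hN⟩ := hA.exists_syzygy
    have hsurj : Surjective (r ∘ₗ p) := (RightInverse.surjective hri').comp hjp.surjective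
    have hE : IsShortExact (LinearMap.inl R (LinearMap.ker (r ∘ₗ p)) M ∘ₗ
        j.codRestrict (LinearMap.ker (r ∘ₗ p)) fun x ↦ by simp [hjp.apply_apply])
        ((p ∘ₗ Submodule.subtype _).coprod i) := by
      refine ⟨fun x y hxy ↦ hjp.injective congr(($hxy.1 : Q)), ?_, fun a ↦ ?_⟩
      · rintro ⟨⟨q, hq⟩, m⟩
        constructor
        · intro h
          have h : p q + i m = 0 := h
          have hq : r (p q) = 0 := hq
          have : m = 0 := by simpa [hq, hri'] using congr(r $h)
          obtain ⟨x, rfl⟩ := (hjp.exact q).1 (by simpa [this] using h)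
          exact ⟨x, by rw [this]; rfl⟩
        · rintro ⟨x, hx⟩
          have h1 : j x = q := congr(($hx.1 : Q))
          have h2 : 0 = m := congr($hx.2)
          simp [← h1, ← h2, hjp.apply_apply]
      · obtain ⟨q, hq⟩ := hjp.surjective (a - i (r a))
        exact ⟨(⟨q, by simp [hq, hri']⟩, r a), by simp [hq]⟩
    exact ⟨.of R _, Q, _, _, hQ, .of_surjective hsurj, .of R (_ × _), LinearMap.inl R _ M,
      LinearMap.fst R _ M, rfl, of_shortExact hE hN hA⟩

/-- A cokernel of a monomorphism from a Gorenstein projective module to a projective module is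
Gorenstein projective, provided that it is left orthogonal to projective modules. -/
theorem cokernel {Q : Type u} [AddCommGroup Q] [Module R Q] [Module.Projective R Q]
    {j : M →ₗ[R] Q} {q : Q →ₗ[R] M'} (hj : IsShortExact j q)
    (hM : IsGorensteinProjectiveModule R M)
    (h : ∀ P : ModuleCat.{u} R, Module.Projective R P → ExtOrthogonal R M' P) :
    IsGorensteinProjectiveModule R M' := by
  obtain ⟨Q₁, M₁, j₁, q₁, hQ₁, hj₁, hM₁⟩ := hM.exists_cosyzygy
  obtain ⟨k, hk⟩ := h Q₁ hQ₁ _ _ j q hj j₁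
  obtain ⟨l, hl⟩ := hM₁.extOrthogonal Q _ _ j₁ q₁ hj₁ j
  have hk' (x) : k (j x) = j₁ x := congr($hk x)
  have hl' (x) : l (j₁ x) = j x := congr($hl x)
  obtain ⟨k₁, hk₁⟩ := hj.exists_desc (q₁ ∘ₗ k) (by ext; simp [hk', hj₁.apply_apply])
  obtain ⟨l₁, hl₁⟩ := hj₁.exists_desc (q ∘ₗ l) (by ext; simp [hl', hj.apply_apply])
  obtain ⟨t, ht⟩ := hj.exists_desc (.id - l ∘ₗ k) (by ext; simp [hl', hk'])
  refine of_retract (M' := M₁ × Q) (i := k₁.prod t) (r := l₁.coprod q) ?_ (hM₁.prod of_projective)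
  ext x
  obtain ⟨x, rfl⟩ := hj.surjective x
  have h1 : k₁ (q x) = q₁ (k x) := congr($hk₁ x)
  have h2 (x) : l₁ (q₁ x) = q (l x) := congr($hl₁ x)
  have h3 : t (q x) = x - l (k x) := congr($ht x)
  simp [h1, h2, h3]

/-- The kernel of an epimorphism from a projective module to a Gorenstein projective module is
Gorenstein projective. -/
theorem kernel {Q : Type u} [AddCommGroup Q] [Module R Q] [Module.Projective R Q]
    {j : M' →ₗ[R] Q} {q : Q →ₗ[R] M} (hj : IsShortExact j q)
    (hM : IsGorensteinProjectiveModule R M) : IsGorensteinProjectiveModule R M' := by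
  obtain ⟨M₁, Q₁, j₁, q₁, hQ₁, hj₁, hM₁⟩ := hM.exists_syzygy
  obtain ⟨k, hk⟩ := Module.projective_lifting_property q₁ q hj₁.surjective
  obtain ⟨l, hl⟩ := Module.projective_lifting_property q q₁ hj.surjective
  have hk' (x) : q₁ (k x) = q x := congr($hk x)
  have hl' (x) : q (l x) = q₁ x := congr($hl x)
  obtain ⟨k₁, hk₁⟩ := hj₁.exists_lift (k ∘ₗ j) (by ext; simp [hk', hj.apply_apply])
  obtain ⟨l₁, hl₁⟩ := hj.exists_lift (l ∘ₗ j₁) (by ext; simp [hl', hj₁.apply_apply])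
  obtain ⟨t, ht⟩ := hj.exists_lift (.id - l ∘ₗ k) (by ext; simp [hl', hk'])
  refine of_retract (M' := M₁ × Q) (i := k₁.prod j) (r := l₁.coprod t) ?_ (hM₁.prod of_projective)
  ext x
  apply hj.injective
  have h1 : j₁ (k₁ x) = k (j x) := congr($hk₁ x)
  have h2 (x) : j (l₁ x) = l (j₁ x) := congr($hl₁ x)
  have h3 (x) : j (t x) = x - l (k x) := congr($ht x)
  simp [h1, h2, h3]

theorem dfinsupp {ι : Type u} {A : ι → Type u} [∀ i, AddCommGroup (A i)]
    [∀ i, Module R (A i)] (h : ∀ i, IsGorensteinProjectiveModule R (A i)) :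
    IsGorensteinProjectiveModule R (Π₀ i, A i) := by
  classical
  refine of_isTwoSidedClass (𝒢 := fun M ↦ ∃ A : ι → ModuleCat.{u} R,
    (∀ i, IsGorensteinProjectiveModule R (A i)) ∧ Nonempty (M ≃ₗ[R] Π₀ i, A i)) ?_ _
    ⟨fun i ↦ .of R (A i), h, ⟨.refl _ _⟩⟩
  rintro M ⟨A, hA, ⟨e⟩⟩
  choose Q N j p hQ hjp hN using fun i ↦ (hA i).exists_cosyzygy
  choose N' Q' j' p' hQ' hjp' hN' using fun i ↦ (hA i).exists_syzygy
  have h1 := IsShortExact.dfinsupp_mapRange hjp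
  have h2 := IsShortExact.dfinsupp_mapRange hjp'
  refine ⟨fun P hP ↦ ?_,
    ⟨.of R (Π₀ i, Q i), .of R (Π₀ i, N i), _, _, inferInstanceAs (Module.Projective R (Π₀ i, Q i)),
      h1.comp_equiv_left e, N, hN, ⟨.refl _ _⟩⟩,
    ⟨.of R (Π₀ i, N' i), .of R (Π₀ i, Q' i), _, _,
      inferInstanceAs (Module.Projective R (Π₀ i, Q' i)),
      h2.equiv_comp_right e.symm, N', hN', ⟨.refl _ _⟩⟩⟩
  refine .of_equiv e.symm (.of_presentation h2 fun f ↦ ?_)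
  choose g hg using fun i ↦ (hA i).extOrthogonal P _ _ _ _ (hjp' i)
    (f ∘ₗ DFinsupp.lsingle (M := fun i ↦ N' i) i)
  refine ⟨DFinsupp.lsum ℕ g, ?_⟩
  ext i x
  simpa using congr($(hg i) x)

end IsGorensteinProjectiveModule

end

section

variable {R : Type u} [Ring R]

/-- A linear map is stably zero if it factors through a projective module. -/
def LinearMap.IsStablyZero {A B : Type u} [AddCommGroup A] [Module R A] [AddCommGroup B]
    [Module R B] (f : A →ₗ[R] B) : Prop :=
  ∃ (Q : ModuleCat.{u} R) (a : A →ₗ[R] Q) (b : Q →ₗ[R] B), Module.Projective R Q ∧ f = b ∘ₗ a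

namespace LinearMap.IsStablyZero

variable {A B C : Type u} [AddCommGroup A] [Module R A] [AddCommGroup B]
    [Module R B] [AddCommGroup C] [Module R C]

theorem of_comp [hB : Module.Projective R B] (f : A →ₗ[R] B) (g : B →ₗ[R] C) :
    IsStablyZero (g ∘ₗ f) := ⟨.of R B, f, g, hB, rfl⟩

theorem comp_right {f : B →ₗ[R] C} (hf : f.IsStablyZero) (g : A →ₗ[R] B) :
    IsStablyZero (f ∘ₗ g) := by
  obtain ⟨Q, a, b, hQ, rfl⟩ := hf
  exact ⟨Q, a ∘ₗ g, b, hQ, rfl⟩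

theorem comp_left {f : A →ₗ[R] B} (hf : f.IsStablyZero) (g : B →ₗ[R] C) :
    IsStablyZero (g ∘ₗ f) := by
  obtain ⟨Q, a, b, hQ, rfl⟩ := hf
  exact ⟨Q, a, g ∘ₗ b, hQ, rfl⟩

theorem add {f g : A →ₗ[R] B} (hf : f.IsStablyZero) (hg : g.IsStablyZero) :
    IsStablyZero (f + g) := by
  obtain ⟨Q, a, b, hQ, rfl⟩ := hf
  obtain ⟨Q', a', b', hQ', rfl⟩ := hg
  exact ⟨.of R (Q × Q'), a.prod a', b.coprod b', inferInstanceAs (Module.Projective R (Q × Q')),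
    by ext; simp⟩

theorem neg {f : A →ₗ[R] B} (hf : f.IsStablyZero) : IsStablyZero (-f) := by
  obtain ⟨Q, a, b, hQ, rfl⟩ := hf
  exact ⟨Q, a, -b, hQ, by ext; simp⟩

theorem sub {f g : A →ₗ[R] B} (hf : f.IsStablyZero) (hg : g.IsStablyZero) :
    IsStablyZero (f - g) := by
  rw [sub_eq_add_neg]; exact hf.add hg.neg

theorem exists_extension {f : A →ₗ[R] B} (hf : f.IsStablyZero) {E M : Type u} [AddCommGroup E]
    [Module R E] [AddCommGroup M] [Module R M] {i : A →ₗ[R] E} {p : E →ₗ[R] M}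
    (hi : IsShortExact i p) (hM : IsGorensteinProjectiveModule R M) :
    ∃ g : E →ₗ[R] B, g ∘ₗ i = f := by
  obtain ⟨Q, a, b, hQ, rfl⟩ := hf
  obtain ⟨g, hg⟩ := hM.extOrthogonal Q _ _ i p hi a
  exact ⟨b ∘ₗ g, by rw [LinearMap.comp_assoc, hg]⟩

end LinearMap.IsStablyZero

/-- `p` is a Gorenstein projective precover, for unbundled modules. -/
def IsGorensteinProjectivePrecover {X N : Type u} [AddCommGroup X] [Module R X] [AddCommGroup N]
    [Module R N] (p : X →ₗ[R] N) : Prop :=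
  IsGorensteinProjectiveModule R X ∧ ∀ Z : ModuleCat.{u} R, IsGorensteinProjectiveModule R Z →
    ∀ f : Z →ₗ[R] N, ∃ g : Z →ₗ[R] X, p ∘ₗ g = f

theorem IsPrecover.isGorensteinProjectivePrecover {X N : ModuleCat.{u} R} {p : X ⟶ N}
    (hp : IsPrecover (IsGorensteinProjective (A := ModuleCat.{u} R)) p) :
    IsGorensteinProjectivePrecover p.hom := by
  refine ⟨hp.1, fun Z hZ f ↦ ?_⟩
  obtain ⟨g, hg⟩ := hp.2 Z hZ (ModuleCat.ofHom f)
  exact ⟨g.hom, congr(($hg).hom)⟩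

theorem IsGorensteinProjectivePrecover.surjective {X N : Type u} [AddCommGroup X] [Module R X]
    [AddCommGroup N] [Module R N] {p : X →ₗ[R] N} (hp : IsGorensteinProjectivePrecover p) :
    Surjective p := by
  obtain ⟨g, hg⟩ := hp.2 (.of R (N →₀ R)) (.of_projective (hM := inferInstanceAs
    (Module.Projective R (N →₀ R)))) (Finsupp.linearCombination R id)
  intro n
  exact ⟨g (Finsupp.single n 1), congr($hg (Finsupp.single n 1)).trans (by simp)⟩

theorem IsShortExact.exists_pushout {Y Q M X : Type u} [AddCommGroup Y] [Module R Y]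
    [AddCommGroup Q] [Module R Q] [AddCommGroup M] [Module R M] [AddCommGroup X] [Module R X]
    {j : Y →ₗ[R] Q} {q : Q →ₗ[R] M} (hj : IsShortExact j q) (t : Y →ₗ[R] X) :
    ∃ (W : ModuleCat.{u} R) (u : X →ₗ[R] W) (w : Q →ₗ[R] W) (v : W →ₗ[R] M), u ∘ₗ t = w ∘ₗ j ∧
      IsShortExact u v ∧ ∀ (D : ModuleCat.{u} R) (f : X →ₗ[R] D) (g : Q →ₗ[R] D), f ∘ₗ t = g ∘ₗ j →
        ∃ h : W →ₗ[R] D, h ∘ₗ u = f ∧ h ∘ₗ w = g := by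
  have hinj : Injective (t.prod (-j)) := fun x y hxy ↦
    hj.injective (neg_injective congr(($hxy).2))
  have hses := IsShortExact.of_injective hinj
  have hex (D : ModuleCat.{u} R) (f : X →ₗ[R] D) (g : Q →ₗ[R] D) (h : f ∘ₗ t = g ∘ₗ j) :
      ∃ h : (_ ⧸ LinearMap.range (t.prod (-j))) →ₗ[R] D,
        h ∘ₗ (Submodule.mkQ _ ∘ₗ LinearMap.inl R X Q) = f ∧
        h ∘ₗ (Submodule.mkQ _ ∘ₗ LinearMap.inr R X Q) = g := by
    obtain ⟨k, hk⟩ := hses.exists_desc (f.coprod g) (by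
      ext y; simpa [← sub_eq_add_neg, sub_eq_zero] using congr($h y))
    exact ⟨k, by rw [← LinearMap.comp_assoc, hk, LinearMap.coprod_inl],
      by rw [← LinearMap.comp_assoc, hk, LinearMap.coprod_inr]⟩
  obtain ⟨v, hv₁, hv₂⟩ := hex (.of R M) 0 q (by ext; simp [hj.apply_apply])
  refine ⟨.of R _, Submodule.mkQ _ ∘ₗ LinearMap.inl R X Q, Submodule.mkQ _ ∘ₗ LinearMap.inr R X Q,
    v, ?_, ⟨?_, ?_, ?_⟩, hex⟩
  · ext y
    have := hses.apply_apply y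
    rw [← sub_eq_zero]
    refine Eq.trans ?_ this
    simp only [LinearMap.comp_apply, ← map_sub]
    congr 1
    simp
  · refine (injective_iff_map_eq_zero _).2 fun x hx ↦ ?_
    obtain ⟨y, hy⟩ := (hses.exact (x, 0)).1 hx
    have h2 : -j y = 0 := congr(($hy).2)
    have h1 : t y = x := congr(($hy).1)
    rw [← h1, (injective_iff_map_eq_zero _).1 hj.injective y (neg_eq_zero.1 h2), map_zero]
  · intro x
    obtain ⟨⟨x, y⟩, rfl⟩ := Submodule.mkQ_surjective _ x
    have e (x y) : v ((LinearMap.range (t.prod (-j))).mkQ (x, y)) = q y := by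
      rw [← zero_add (q y), ← show v _ = 0 from congr($hv₁ x), ← show v _ = q y from congr($hv₂ y),
        ← map_add]
      simp only [LinearMap.comp_apply, ← map_add]
      simp
    rw [e]
    constructor
    · intro h
      obtain ⟨z, rfl⟩ := (hj.exact y).1 h
      refine ⟨x + t z, ?_⟩
      rw [← sub_eq_zero, LinearMap.comp_apply, ← map_sub, ← LinearMap.mem_ker, Submodule.ker_mkQ]
      exact ⟨z, by simp⟩
    · rintro ⟨z, hz⟩
      rw [← e x y, ← hz]
      exact (e z 0).trans (map_zero q)
  · intro m
    obtain ⟨x, rfl⟩ := hj.surjective m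
    exact ⟨_, congr($hv₂ x)⟩

/-- A Gorenstein projective precover has an endomorphism over its target which is stably zero on
all maps from Gorenstein projective modules to the kernel. -/
theorem IsGorensteinProjectivePrecover.exists_endomorphism
    (hR : ∀ N : ModuleCat.{u} R, ∃ (X : ModuleCat.{u} R) (p : X →ₗ[R] N),
      IsGorensteinProjectivePrecover p)
    {X N : Type u} [AddCommGroup X] [Module R X] [AddCommGroup N] [Module R N] {p : X →ₗ[R] N}
    (hp : IsGorensteinProjectivePrecover p) : ∃ e : X →ₗ[R] X, p ∘ₗ e = p ∧
      ∀ Z : ModuleCat.{u} R, IsGorensteinProjectiveModule R Z → ∀ g : Z →ₗ[R] X, p ∘ₗ g = 0 →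
        (e ∘ₗ g).IsStablyZero := by
  obtain ⟨Y, r, hr⟩ := hR (.of R (LinearMap.ker p))
  obtain ⟨Q, Y₁, j, q, hQ, hj, hY₁⟩ := hr.1.exists_cosyzygy
  obtain ⟨X₁, u, w, v, huw, hu, hdesc⟩ := hj.exists_pushout ((LinearMap.ker p).subtype ∘ₗ r)
  obtain ⟨p₁, hp₁, -⟩ := hdesc (.of R N) p 0 (by ext y; exact (r y).2)
  obtain ⟨l, hl⟩ := hp.2 X₁ (.of_shortExact hu hp.1 hY₁) p₁
  refine ⟨l ∘ₗ u, by rw [← LinearMap.comp_assoc, hl, hp₁], fun Z hZ g hg ↦ ?_⟩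
  obtain ⟨s, hs⟩ := hr.2 Z hZ (g.codRestrict _ fun z ↦ congr($hg z))
  have : (l ∘ₗ u) ∘ₗ g = (l ∘ₗ w) ∘ₗ (j ∘ₗ s) := by
    rw [LinearMap.comp_assoc, LinearMap.comp_assoc, ← LinearMap.comp_assoc s j w, ← huw,
      LinearMap.comp_assoc, LinearMap.comp_assoc, hs]
    rfl
  rw [this]
  exact .of_comp _ _

namespace Finsupp

variable {X : Type u} [AddCommGroup X] [Module R X] (e : X →ₗ[R] X)

/-- The map `x_n ↦ ∑_{k < n} x_k`. -/
noncomputable def partialSum (n : ℕ) : X →ₗ[R] (ℕ →₀ X) := ∑ k ∈ Finset.range n, lsingle k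

/-- The map `x_n ↦ x_n - (e x)_{n + 1}` whose cokernel is the telescope of `e`. -/
noncomputable def telescopeMap : (ℕ →₀ X) →ₗ[R] (ℕ →₀ X) :=
  lsum ℕ fun n ↦ lsingle n - lsingle (n + 1) ∘ₗ e

/-- A homotopy inverse of `telescopeMap e` if `e` is idempotent up to homotopy. -/
noncomputable def telescopeInverse : (ℕ →₀ X) →ₗ[R] (ℕ →₀ X) :=
  lsum ℕ fun n ↦ lsingle n ∘ₗ (.id - e) - partialSum n ∘ₗ e

@[simp] theorem partialSum_zero (x : X) : partialSum (R := R) 0 x = 0 := by simp [partialSum]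

@[simp] theorem partialSum_succ (n : ℕ) (x : X) :
    partialSum (R := R) (n + 1) x = partialSum (R := R) n x + single n x := by
  simp [partialSum, Finset.sum_range_succ]

@[simp] theorem telescopeMap_single (n : ℕ) (x : X) :
    telescopeMap e (single n x) = single n x - single (n + 1) (e x) := by
  simp [telescopeMap]

@[simp] theorem telescopeInverse_single (n : ℕ) (x : X) :
    telescopeInverse e (single n x) =
      single n x - single n (e x) - partialSum (R := R) n (e x) := by
  simp [telescopeInverse]

theorem telescopeMap_partialSum (n : ℕ) (x : X) :
    telescopeMap e (partialSum (R := R) n x) =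
      partialSum (R := R) n x - partialSum (R := R) (n + 1) (e x) + single 0 (e x) := by
  induction n with
  | zero => simp
  | succ n ih => rw [partialSum_succ, map_add, ih, partialSum_succ (n + 1)]; simp; abel

theorem telescopeInverse_telescopeMap_single (n : ℕ) (x : X) :
    telescopeInverse e (telescopeMap e (single n x)) =
      single n x + partialSum (R := R) (n + 2) (e (e x) - e x) := by
  simp only [telescopeMap_single, map_sub, telescopeInverse_single, partialSum_succ]
  abel

theorem telescopeMap_telescopeInverse_single (n : ℕ) (x : X) :
    telescopeMap e (telescopeInverse e (single n x)) =
      single n x - single 0 (e x) + (partialSum (R := R) (n + 2) (e (e x) - e x) -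
        single 0 (e (e x) - e x)) := by
  simp only [telescopeInverse_single, map_sub, telescopeMap_single, telescopeMap_partialSum,
    partialSum_succ, single_sub]
  abel

end Finsupp

theorem IsGorensteinProjectiveModule.finsupp_nat {X : Type u} [AddCommGroup X] [Module R X]
    (hX : IsGorensteinProjectiveModule R X) : IsGorensteinProjectiveModule R (ℕ →₀ X) := by
  classical
  exact (dfinsupp (ι := ULift.{u} ℕ) fun _ ↦ hX).of_equiv
    ((finsuppLequivDFinsupp R).symm ≪≫ₗ Finsupp.domLCongr Equiv.ulift)

theorem exists_isGorensteinProjectivePrecover_isStablyZero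
    (hR : ∀ N : ModuleCat.{u} R, ∃ (X : ModuleCat.{u} R) (p : X →ₗ[R] N),
      IsGorensteinProjectivePrecover p) (N : Type u) [AddCommGroup N] [Module R N] :
    ∃ (T : ModuleCat.{u} R) (q : T →ₗ[R] N), IsGorensteinProjectivePrecover q ∧
      ∀ Z : ModuleCat.{u} R, IsGorensteinProjectiveModule R Z → ∀ g : Z →ₗ[R] T, q ∘ₗ g = 0 →
        g.IsStablyZero := by
  obtain ⟨X, p, hp⟩ := hR (.of R N)
  obtain ⟨e, he, hstab⟩ := hp.exists_endomorphism hR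
  obtain ⟨U, α, β, hU, hαβ⟩ := hstab X hp.1 (e - .id) (by
    rw [LinearMap.comp_sub, he, LinearMap.comp_id, sub_self])
  have he' (x) : p (e x) = p x := congr($he x)
  have hαβ' (x) : β (α x) = e (e x) - e x := by
    simpa using congr($hαβ x).symm
  have : Module.Projective R (ℕ →₀ U) := by
    classical exact .of_equiv (finsuppLequivDFinsupp R).symm
  let f := Finsupp.telescopeMap e
  let h := Finsupp.telescopeInverse e
  let a : (ℕ →₀ X) →ₗ[R] (ℕ →₀ U) := Finsupp.mapRange.linearMap α
  let b : (ℕ →₀ U) →ₗ[R] (ℕ →₀ X) := Finsupp.lsum ℕ fun n ↦ Finsupp.partialSum (n + 2) ∘ₗ β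
  let b' : (ℕ →₀ U) →ₗ[R] (ℕ →₀ X) := b - Finsupp.lsum ℕ fun n ↦ Finsupp.lsingle 0 ∘ₗ β
  let s : (ℕ →₀ X) →ₗ[R] X := Finsupp.lsum ℕ fun n ↦ .id
  have hhf : h ∘ₗ f = .id + b ∘ₗ a := by
    ext1 n
    ext1 x
    refine (Finsupp.telescopeInverse_telescopeMap_single e n x).trans ?_
    simp [a, b, hαβ']
  have hfh : .id = Finsupp.lsingle 0 ∘ₗ e ∘ₗ s + f ∘ₗ h - b' ∘ₗ a := by
    ext1 n
    ext1 x
    rw [eq_comm]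
    refine Eq.trans (congrArg₂ (· - ·) (congrArg₂ (· + ·) ?_
      (Finsupp.telescopeMap_telescopeInverse_single e n x)) rfl)
      (?_ : (Finsupp.single 0 (e x) + _ - _) = _)
    · simp [s]
    · simp [a, b, b', hαβ']
      abel
  let f' : (ℕ →₀ X) →ₗ[R] (ℕ →₀ X) × (ℕ →₀ U) := f.prod (-a)
  let h' : (ℕ →₀ X) × (ℕ →₀ U) →ₗ[R] (ℕ →₀ X) := h.coprod b
  have hhf' : h' ∘ₗ f' = .id := by
    refine LinearMap.ext fun x ↦ ?_
    have := congr($hhf x)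
    simp only [LinearMap.comp_apply, LinearMap.add_apply] at this
    simp [h', f', this]
  have hinj : Injective f' := LeftInverse.injective (g := h') fun x ↦ congr($hhf' x)
  have hses := IsShortExact.of_injective hinj
  set π := (LinearMap.range f').mkQ
  obtain ⟨σ, hσ⟩ := hses.exists_desc (.id - f' ∘ₗ h') (by
    rw [LinearMap.sub_comp, LinearMap.comp_assoc, hhf']; simp)
  have hπσ : π ∘ₗ σ = .id := by
    refine LinearMap.ext fun x ↦ ?_
    obtain ⟨x, rfl⟩ := hses.surjective x
    have h1 : σ (π x) = x - f' (h' x) := congr($hσ x)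
    simp [h1, π, -Submodule.mkQ_apply, hses.apply_apply]
  have hT : IsGorensteinProjectiveModule R (((ℕ →₀ X) × (ℕ →₀ U)) ⧸ LinearMap.range f') :=
    .of_retract hπσ (hp.1.finsupp_nat.prod .of_projective)
  obtain ⟨q, hq⟩ := hses.exists_desc (p ∘ₗ s ∘ₗ LinearMap.fst R _ _) (by
    ext n x
    have hs (n : ℕ) (x : X) : s (Finsupp.single n x) = x := by simp [s]
    have : s (f (Finsupp.single n x)) = x - e x := by
      rw [show f _ = _ from Finsupp.telescopeMap_single e n x, map_sub, hs, hs]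
    simp [f', this, he'])
  have hq' (x) : q (π x) = p (s x.1) := congr($hq x)
  refine ⟨.of R _, q, ⟨hT, fun Z hZ g ↦ ?_⟩, fun Z hZ g hg ↦ ?_⟩
  · obtain ⟨k, hk⟩ := hp.2 Z hZ g
    refine ⟨π ∘ₗ LinearMap.inl R _ _ ∘ₗ Finsupp.lsingle 0 ∘ₗ k, ?_⟩
    ext z
    simp only [LinearMap.comp_apply, hq']
    simpa [s] using congr($hk z)
  · have key : π = π ∘ₗ LinearMap.inl R _ _ ∘ₗ Finsupp.lsingle 0 ∘ₗ e ∘ₗ s ∘ₗ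
        LinearMap.fst R _ _ + (π ∘ₗ LinearMap.inr R _ _) ∘ₗ (a ∘ₗ h ∘ₗ LinearMap.fst R _ _) -
        (π ∘ₗ LinearMap.inl R _ _ ∘ₗ b') ∘ₗ (a ∘ₗ LinearMap.fst R _ _) +
        (π ∘ₗ LinearMap.inr R _ _) ∘ₗ LinearMap.snd R _ _ := by
      refine LinearMap.ext fun x ↦ ?_
      have e1 : π (f (h x.1), 0) = π (0, a (h x.1)) := by
        rw [← sub_eq_zero, ← map_sub]
        simpa [f'] using hses.apply_apply (h x.1)
      have e2 := congr($hfh x.1)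
      simp only [LinearMap.comp_apply, LinearMap.add_apply, LinearMap.sub_apply,
        LinearMap.id_apply] at e2
      simp only [LinearMap.comp_apply, LinearMap.add_apply, LinearMap.sub_apply,
        LinearMap.inl_apply, LinearMap.inr_apply, LinearMap.fst_apply, LinearMap.snd_apply, ← e1,
        ← map_add, ← map_sub]
      congr 1
      refine Prod.ext ?_ ?_
      · simpa using e2
      · simp
    have hg' : g = π ∘ₗ σ ∘ₗ g := by rw [← LinearMap.comp_assoc, hπσ, LinearMap.id_comp]
    have hz : p ∘ₗ (s ∘ₗ LinearMap.fst R _ _ ∘ₗ σ ∘ₗ g) = 0 := by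
      ext z
      have h1 : π (σ (g z)) = g z := congr($hπσ (g z))
      simp only [LinearMap.comp_apply, LinearMap.fst_apply]
      rw [← hq', h1]
      exact congr($hg z)
    rw [hg', key]
    simp only [LinearMap.add_comp, LinearMap.sub_comp]
    refine ((LinearMap.IsStablyZero.add ?_ ?_).sub ?_).add ?_
    · exact (hstab Z hZ _ hz).comp_left (π ∘ₗ LinearMap.inl R _ _ ∘ₗ Finsupp.lsingle 0)
    · exact (LinearMap.IsStablyZero.of_comp _ _).comp_right _
    · exact (LinearMap.IsStablyZero.of_comp _ _).comp_right _
    · exact (LinearMap.IsStablyZero.of_comp _ _).comp_right _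

/-- If all modules have Gorenstein projective precovers, then they have special ones, whose
kernel is right orthogonal to the Gorenstein projective modules. -/
theorem exists_special_precover
    (hR : ∀ N : ModuleCat.{u} R, ∃ (X : ModuleCat.{u} R) (p : X →ₗ[R] N),
      IsGorensteinProjectivePrecover p) (N : Type u) [AddCommGroup N] [Module R N] :
    ∃ (K T : ModuleCat.{u} R) (k : K →ₗ[R] T) (q : T →ₗ[R] N), IsShortExact k q ∧
      IsGorensteinProjectivePrecover q ∧
      ∀ Y : ModuleCat.{u} R, IsGorensteinProjectiveModule R Y → ExtOrthogonal R Y K := by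
  obtain ⟨T, q, hq, hstab⟩ := exists_isGorensteinProjectivePrecover_isStablyZero hR N
  have hses := IsShortExact.of_surjective hq.surjective
  refine ⟨.of R (LinearMap.ker q), T, _, q, hses, hq, fun Y hY ↦ ?_⟩
  obtain ⟨Y', Q, j, π, hQ, hj, hY'⟩ := hY.exists_syzygy
  refine .of_presentation hj fun f ↦ ?_
  obtain ⟨κ, hκ⟩ := (hstab Y' hY' ((LinearMap.ker q).subtype ∘ₗ f)
    (by ext y; exact (f y).2)).exists_extension hj hY
  obtain ⟨n, hn⟩ := hj.exists_desc (q ∘ₗ κ) (by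
    rw [LinearMap.comp_assoc, hκ]; ext y; exact (f y).2)
  obtain ⟨n', hn'⟩ := hq.2 Y hY n
  obtain ⟨l, hl⟩ := hses.exists_lift (κ - n' ∘ₗ π) (by
    rw [LinearMap.comp_sub, ← LinearMap.comp_assoc, hn', hn, sub_self])
  refine ⟨l, ?_⟩
  ext y
  have h1 : l (j y) = κ (j y) - n' (π (j y)) := congr($hl (j y))
  have h2 : κ (j y) = f y := congr($hκ y)
  simp [h1, h2, hj.apply_apply]

end

section

variable {R S : Type u} [Ring R] [Ring S]

theorem exists_projective_presentation (M : ModuleCat.{u} R) :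
    ∃ (L P : ModuleCat.{u} R) (j : L ⟶ P) (p : P ⟶ M), Module.Projective R P ∧
      IsShortExact j.hom p.hom := by
  have hp : Surjective (Finsupp.linearCombination R (id : M → M)) :=
    fun m ↦ ⟨Finsupp.single m 1, by simp⟩
  exact ⟨_, _, ModuleCat.ofHom _, ModuleCat.ofHom _,
    inferInstanceAs (Module.Projective R (M →₀ R)), .of_surjective hp⟩

theorem IsShortExact.map {F : ModuleCat.{u} R ⥤ ModuleCat.{u} S} [F.Additive]
    [PreservesFiniteLimits F] [PreservesFiniteColimits F] {A B C : ModuleCat.{u} R} {i : A ⟶ B}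
    {p : B ⟶ C} (h : IsShortExact i.hom p.hom) : IsShortExact (F.map i).hom (F.map p).hom := by
  have hip : i ≫ p = 0 := by ext x; exact h.apply_apply x
  let T : ShortComplex (ModuleCat.{u} R) := .mk i p hip
  have hT : T.ShortExact :=
    { exact := (ShortComplex.ShortExact.moduleCat_exact_iff_function_exact T).2 h.exact
      mono_f := (ModuleCat.mono_iff_injective i).2 h.injective
      epi_g := (ModuleCat.epi_iff_surjective p).2 h.surjective }
  have hT' := hT.map_of_exact F
  exact ⟨(ModuleCat.mono_iff_injective _).1 hT'.mono_f,
    (ShortComplex.ShortExact.moduleCat_exact_iff_function_exact _).1 hT'.exact,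
    (ModuleCat.epi_iff_surjective _).1 hT'.epi_g⟩

/-- In a Frobenius pair `G ⊣ F ⊣ G` of functors between abelian categories, `G` preserves
Gorenstein projective objects. -/
theorem IsGorensteinProjective.map_of_adjunctions {A B : Type*} [Category A] [Category B]
    [Abelian A] [Abelian B] {G : A ⥤ B} {F : B ⥤ A} (adj : G ⊣ F) (adj' : F ⊣ G) {M : A}
    (hM : IsGorensteinProjective M) : IsGorensteinProjective (G.obj M) := by
  have := adj.leftAdjoint_preservesColimits
  have := adj'.rightAdjoint_preservesLimits
  have := adj.rightAdjoint_preservesLimits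
  have := adj'.leftAdjoint_preservesColimits
  have : PreservesFiniteLimits G := PreservesLimits.preservesFiniteLimits G
  have : PreservesFiniteColimits G := PreservesColimits.preservesFiniteColimits G
  have : G.Additive := Functor.additive_of_preserves_binary_products G
  obtain ⟨P, hproj, hexact, ⟨e⟩, hhom⟩ := hM
  refine ⟨(G.mapHomologicalComplex _).obj P, fun n ↦ adj.map_projective _ (hproj n),
    fun n ↦ (ShortComplex.Exact.map (hexact n) G :),
    ⟨G.mapIso e ≪≫ ((P.sc 0).mapCyclesIso G).symm⟩, fun Q hQ n f hf ↦ ?_⟩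
  change G.obj (P.X n) ⟶ Q at f
  change G.map (P.d (n - 1) n) ≫ f = 0 at hf
  obtain ⟨g, hg⟩ := hhom (F.obj Q) (adj'.map_projective Q hQ) n (adj.homEquiv _ _ f) (by
    rw [← adj.homEquiv_naturality_left, hf]
    simp [Adjunction.homEquiv_unit])
  refine ⟨(adj.homEquiv _ _).symm g, ?_⟩
  exact (adj.homEquiv_naturality_left_symm _ _).symm.trans (by rw [hg, Equiv.symm_apply_apply])

/-- A Frobenius pair of functors between module categories: `G ⊣ F ⊣ G` with `F` faithful. -/
structure FrobeniusPair (F : ModuleCat.{u} R ⥤ ModuleCat.{u} S)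
    (G : ModuleCat.{u} S ⥤ ModuleCat.{u} R) where
  adj : G ⊣ F
  adj' : F ⊣ G
  faithful : F.Faithful

namespace FrobeniusPair

variable {F : ModuleCat.{u} R ⥤ ModuleCat.{u} S} {G : ModuleCat.{u} S ⥤ ModuleCat.{u} R}
  (φ : FrobeniusPair F G)

include φ

theorem preservesFiniteLimits_right : PreservesFiniteLimits F := by
  have := φ.adj.rightAdjoint_preservesLimits
  exact PreservesLimits.preservesFiniteLimits F

theorem preservesFiniteColimits_right : PreservesFiniteColimits F := by
  have := φ.adj'.leftAdjoint_preservesColimits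
  exact PreservesColimits.preservesFiniteColimits F

theorem preservesFiniteLimits_left : PreservesFiniteLimits G := by
  have := φ.adj'.rightAdjoint_preservesLimits
  exact PreservesLimits.preservesFiniteLimits G

theorem preservesFiniteColimits_left : PreservesFiniteColimits G := by
  have := φ.adj.leftAdjoint_preservesColimits
  exact PreservesColimits.preservesFiniteColimits G

theorem additive_right : F.Additive := by
  have := φ.preservesFiniteLimits_right
  exact Functor.additive_of_preserves_binary_products F

theorem additive_left : G.Additive := by
  have := φ.preservesFiniteLimits_left
  exact Functor.additive_of_preserves_binary_products G

theorem map_right {A B C : ModuleCat.{u} R} {i : A ⟶ B} {p : B ⟶ C}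
    (h : IsShortExact i.hom p.hom) : IsShortExact (F.map i).hom (F.map p).hom := by
  have := φ.preservesFiniteLimits_right
  have := φ.preservesFiniteColimits_right
  have := φ.additive_right
  exact h.map

theorem map_left {A B C : ModuleCat.{u} S} {i : A ⟶ B} {p : B ⟶ C}
    (h : IsShortExact i.hom p.hom) : IsShortExact (G.map i).hom (G.map p).hom := by
  have := φ.preservesFiniteLimits_left
  have := φ.preservesFiniteColimits_left
  have := φ.additive_left
  exact h.map

theorem projective_right {P : ModuleCat.{u} R} (hP : Module.Projective R P) :
    Module.Projective S (F.obj P) := by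
  have := φ.preservesFiniteColimits_left
  exact (IsProjective.iff_projective _).2 (φ.adj'.map_projective P
    ((IsProjective.iff_projective _).1 hP))

theorem projective_left {P : ModuleCat.{u} S} (hP : Module.Projective S P) :
    Module.Projective R (G.obj P) := by
  have := φ.preservesFiniteColimits_right
  exact (IsProjective.iff_projective _).2 (φ.adj.map_projective P
    ((IsProjective.iff_projective _).1 hP))

theorem isGorensteinProjectiveModule_right {M : ModuleCat.{u} R}
    (hM : IsGorensteinProjectiveModule R M) : IsGorensteinProjectiveModule S (F.obj M) :=
  IsGorensteinProjective.map_of_adjunctions (M := M) φ.adj' φ.adj hM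

theorem isGorensteinProjectiveModule_left {M : ModuleCat.{u} S}
    (hM : IsGorensteinProjectiveModule S M) : IsGorensteinProjectiveModule R (G.obj M) :=
  IsGorensteinProjective.map_of_adjunctions (M := M) φ.adj φ.adj' hM

theorem counit_surjective (M : ModuleCat.{u} R) : Surjective (φ.adj.counit.app M) := by
  have := φ.faithful
  exact (ModuleCat.epi_iff_surjective _).1 inferInstance

theorem extOrthogonal_of_right {M : ModuleCat.{u} R} {A : ModuleCat.{u} S}
    (h : ExtOrthogonal S (F.obj M) A) : ExtOrthogonal R M (G.obj A) := by
  obtain ⟨L, P, j, p, hP, hj⟩ := exists_projective_presentation M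
  refine .of_presentation hj fun f ↦ ?_
  let f' : L ⟶ G.obj A := ModuleCat.ofHom f
  obtain ⟨g, hg⟩ := h _ _ _ _ (φ.map_right hj) ((φ.adj'.homEquiv _ _).symm f').hom
  refine ⟨(φ.adj'.homEquiv P A (ModuleCat.ofHom g)).hom, ?_⟩
  have : j ≫ φ.adj'.homEquiv P A (ModuleCat.ofHom g) = f' := by
    rw [← φ.adj'.homEquiv_naturality_left, ← Equiv.eq_symm_apply]
    exact ModuleCat.hom_ext hg
  exact congr(($this).hom)

/-- `F` reflects Gorenstein projective modules. -/
theorem isGorensteinProjectiveModule_of_right {M : ModuleCat.{u} R}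
    (h : IsGorensteinProjectiveModule S (F.obj M)) : IsGorensteinProjectiveModule R M := by
  refine .of_isTwoSidedClass (𝒢 := fun M ↦ IsGorensteinProjectiveModule S (F.obj M))
    (fun M hM ↦ ⟨fun Q hQ ↦ ?_, ?_, ?_⟩) M h
  · have hFQ := φ.projective_right hQ
    obtain ⟨s, hs⟩ := Module.projective_lifting_property (φ.adj.counit.app Q).hom .id
      (φ.counit_surjective Q)
    exact (φ.extOrthogonal_of_right (hM.extOrthogonal (F.obj Q))).retract_right hs
  · obtain ⟨Q, M', i, p, hQ, hi, hM'⟩ := hM.exists_cosyzygy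
    let i' : F.obj M ⟶ Q := ModuleCat.ofHom i
    let a := φ.adj'.homEquiv M Q i'
    have ha : F.map a ≫ φ.adj'.counit.app Q = i' :=
      (φ.adj'.homEquiv_counit _ _ _).symm.trans (Equiv.symm_apply_apply _ _)
    have ha' : Injective a.hom := by
      have := φ.faithful
      have : Mono i' := (ModuleCat.mono_iff_injective i').2 hi.injective
      have : Mono (F.map a) := mono_of_mono_fac ha
      exact (ModuleCat.mono_iff_injective a).1 (F.mono_of_mono_map this)
    have hses := IsShortExact.of_injective ha'
    have hses' := φ.map_right (p := ModuleCat.ofHom _) hses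
    have hGQ := φ.projective_left hQ
    have hFGQ := φ.projective_right hGQ
    refine ⟨G.obj Q, .of R _, a.hom, _, hGQ, hses, hM.cokernel hses' fun P hP ↦ ?_⟩
    refine .of_presentation hses' fun f ↦ ?_
    obtain ⟨g, hg⟩ := hM'.extOrthogonal P _ _ i p hi f
    refine ⟨g ∘ₗ (φ.adj'.counit.app Q).hom, ?_⟩
    rw [LinearMap.comp_assoc, ← ModuleCat.hom_comp, ha]
    exact hg
  · obtain ⟨L, P, j, p, hP, hj⟩ := exists_projective_presentation M
    have hFP := φ.projective_right hP
    exact ⟨L, P, j.hom, p.hom, hP, hj, hM.kernel (φ.map_right hj)⟩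

end FrobeniusPair

end

section

section Telescope

variable {S : Type u} [Ring S]

/-- Compatible linear maps on an exhaustive chain of submodules glue. -/
theorem LinearMap.exists_glue_of_monotone {B E : Type*} [AddCommGroup B] [Module S B]
    [AddCommGroup E] [Module S E] {A : ℕ → Submodule S B} (hA : Monotone A)
    (hA' : ∀ x, ∃ n, x ∈ A n) (s : ℕ → B →ₗ[S] E)
    (hs : ∀ n, ∀ x ∈ A n, s (n + 1) x = s n x) : ∃ t : B →ₗ[S] E, ∀ n, ∀ x ∈ A n, t x = s n x := by
  have key (n m : ℕ) (x) (hn : x ∈ A n) (hm : x ∈ A m) : s n x = s m x := by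
    have aux (k : ℕ) {n} (h : x ∈ A n) : s (n + k) x = s n x := by
      induction k with
      | zero => rfl
      | succ k ih => rw [← ih, ← add_assoc, hs _ _ (hA (Nat.le_add_right n k) h)]
    rw [← aux m hn, ← aux n hm, add_comm]
  choose N hN using hA'
  refine ⟨⟨⟨fun x ↦ s (N x) x, fun x y ↦ ?_⟩, fun c x ↦ ?_⟩, fun n x hx ↦ key _ _ _ (hN x) hx⟩
  · have hx : x ∈ A (max (N x) (N y)) := hA (le_max_left _ _) (hN x)
    have hy : y ∈ A (max (N x) (N y)) := hA (le_max_right _ _) (hN y)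
    change s _ (x + y) = s _ x + s _ y
    rw [key _ _ _ (hN x) hx, key _ _ _ (hN y) hy, key _ _ _ (hN (x + y)) (add_mem hx hy), map_add]
  · change s _ (c • x) = c • s _ x
    rw [key _ _ _ (hN (c • x)) (Submodule.smul_mem _ _ (hN x)), map_smul]

theorem Module.Projective.of_chain {B : Type*} [AddCommGroup B] [Module S B]
    {A : ℕ → Submodule S B} (hA : Monotone A) (hA' : ∀ x, ∃ n, x ∈ A n)
    {U : ℕ → Type*} [∀ n, AddCommGroup (U n)] [∀ n, Module S (U n)]
    [∀ n, Module.Projective S (U n)] (a : ∀ n, B →ₗ[S] U n) (b : ∀ n, U n →ₗ[S] B)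
    (hb : ∀ n x, b n x ∈ A (n + 1)) (hab : ∀ n, ∀ x ∈ A n, b n (a n x) = x) :
    Module.Projective S B := by
  let p : (B →₀ S) →ₗ[S] B := Finsupp.linearCombination S id
  have hp : Surjective p := fun m ↦ ⟨Finsupp.single m 1, by simp [p]⟩
  choose c hc using fun n ↦ Module.projective_lifting_property p (b n) hp
  have hc' (n x) : p (c n x) = b n x := congr($(hc n) x)
  let d (k : ℕ) : U k →ₗ[S] (B →₀ S) := c (k + 1) ∘ₗ a (k + 1) ∘ₗ b k - c k
  have hd (k x) : p (d k x) = 0 := by simp [d, hc', hab _ _ (hb k x)]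
  let s (n : ℕ) : B →ₗ[S] (B →₀ S) := c n ∘ₗ a n - ∑ k ∈ Finset.range n, d k ∘ₗ a k
  obtain ⟨t, ht⟩ := LinearMap.exists_glue_of_monotone hA hA' s fun n x hx ↦ by
    simp [s, Finset.sum_range_succ, d, hab n x hx]
    abel
  refine .of_split t p (LinearMap.ext fun x ↦ ?_)
  obtain ⟨n, hn⟩ := hA' x
  simp [ht n x hn, s, hd, hc', hab n x hn]

theorem Module.Projective.exists_retract_finsupp {B : Type u} [AddCommGroup B] [Module S B]
    [Module.Projective S B] : ∃ (I : Type u) (i : B →ₗ[S] I →₀ S) (r : (I →₀ S) →ₗ[S] B),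
      r ∘ₗ i = .id := by
  obtain ⟨s, hs⟩ := Module.projective_def'.1 (inferInstance : Module.Projective S B)
  exact ⟨B, s, _, hs⟩

theorem exists_retract_prod_finsupp_of_chain {A T P : Type u} [AddCommGroup A]
    [Module S A] [AddCommGroup T] [Module S T] [AddCommGroup P] [Module S P]
    [Module.Projective S P] {V : ℕ → Submodule S A} (hV : Monotone V) (hV' : ∀ x, ∃ n, x ∈ V n)
    {Q : ℕ → Type u} [∀ n, AddCommGroup (Q n)] [∀ n, Module S (Q n)]
    [∀ n, Module.Projective S (Q n)] (φ : A →ₗ[S] T) (j : ∀ n, A →ₗ[S] Q n)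
    (b : ∀ n, T × Q n →ₗ[S] A) (hb : ∀ n x, b n x ∈ V (n + 1))
    (hbj : ∀ n, ∀ x ∈ V n, b n (φ x, j n x) = x) (α : T →ₗ[S] P) (β : P →ₗ[S] T)
    (hαβ : ∀ t, φ (b 0 (t, 0)) = t + β (α t)) :
    ∃ (I : Type u) (i : A →ₗ[S] T × (I →₀ S)) (r : T × (I →₀ S) →ₗ[S] A), r ∘ₗ i = .id := by
  let φ' : A × P →ₗ[S] T := φ.coprod β
  let ψ : T →ₗ[S] A × P := (b 0 ∘ₗ LinearMap.inl S T (Q 0)).prod (-α)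
  have hφψ (t) : φ' (ψ t) = t := by simp [φ', ψ, hαβ]
  let B := LinearMap.ker φ'
  let ρ : A × P →ₗ[S] B := (LinearMap.id - ψ ∘ₗ φ').codRestrict B fun x ↦ by simp [B, hφψ]
  have hρ (x) : (ρ x : A × P) = x - ψ (φ' x) := rfl
  have hψ (t) : (ψ t).1 ∈ V 1 := hb 0 (t, 0)
  have hB : Module.Projective S B := by
    refine .of_chain (A := fun n ↦ (V (n + 1)).comap (LinearMap.fst S A P ∘ₗ B.subtype))
      (fun n m h x hx ↦ hV (Nat.succ_le_succ h) hx) (fun x ↦ ?_)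
      (fun n ↦ (j (n + 1)).prodMap .id ∘ₗ B.subtype)
      (fun n ↦ ρ ∘ₗ (b (n + 1) ∘ₗ (-β ∘ₗ LinearMap.snd S _ _).prod (LinearMap.fst S _ _)).prod
        (LinearMap.snd S _ _)) (fun n x ↦ ?_) (fun n x hx ↦ ?_)
    · obtain ⟨n, hn⟩ := hV' x.1.1
      exact ⟨n, hV n.le_succ hn⟩
    · change (ρ _ : A × P).1 ∈ V (n + 1 + 1)
      rw [hρ]
      exact sub_mem (hb _ _) (hV (by omega) (hψ _))
    · have h1 : φ x.1.1 + β x.1.2 = 0 := x.2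
      have h2 : b (n + 1) (-β x.1.2, j (n + 1) x.1.1) = x.1.1 := by
        rw [← eq_neg_of_add_eq_zero_left h1]; exact hbj _ _ hx
      have h3 : φ' x = 0 := x.2
      refine Subtype.ext ?_
      refine (hρ (b (n + 1) (-β x.1.2, j (n + 1) x.1.1), x.1.2)).trans ?_
      rw [h2]
      exact (congrArg (fun t ↦ x.1 - ψ t) h3).trans (by simp)
  obtain ⟨I, i, r, hri⟩ := Module.Projective.exists_retract_finsupp (S := S) (B := B)
  have hri' (x) : r (i x) = x := congr($hri x)
  refine ⟨I, (φ'.prod (i ∘ₗ ρ)) ∘ₗ LinearMap.inl S A P,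
    LinearMap.fst S A P ∘ₗ ψ.coprod (B.subtype ∘ₗ r), LinearMap.ext fun x ↦ ?_⟩
  change (ψ (φ' (x, 0)) + (r (i (ρ (x, 0))) : A × P)).1 = x
  rw [hri', hρ, add_sub_cancel]

end Telescope

end

section

theorem IsShortExact.prod_right_of_left {R A T Q Y : Type*} [Ring R] [AddCommGroup A] [Module R A]
    [AddCommGroup T] [Module R T] [AddCommGroup Q] [Module R Q] [AddCommGroup Y] [Module R Y]
    {j : A →ₗ[R] Q} {p : Q →ₗ[R] Y} (hj : IsShortExact j p) (g : A →ₗ[R] T) :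
    ∃ (u : T →ₗ[R] (T × Q) ⧸ LinearMap.range (g.prod j))
      (v : ((T × Q) ⧸ LinearMap.range (g.prod j)) →ₗ[R] Y), IsShortExact u v := by
  refine ⟨Submodule.mkQ _ ∘ₗ LinearMap.inl R T Q, Submodule.liftQ _ (p ∘ₗ LinearMap.snd R T Q) ?_,
    ?_, fun x ↦ ?_, fun y ↦ ?_⟩
  · rintro _ ⟨x, rfl⟩
    simp [hj.apply_apply]
  · refine (injective_iff_map_eq_zero _).2 fun t ht ↦ ?_
    obtain ⟨x, hx⟩ := (Submodule.Quotient.mk_eq_zero _).1 ht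
    have h1 : g x = t := congr(($hx).1)
    have h2 : j x = 0 := congr(($hx).2)
    rw [← h1, (injective_iff_map_eq_zero _).1 hj.injective x h2, map_zero]
  · obtain ⟨⟨t, y⟩, rfl⟩ := Submodule.mkQ_surjective _ x
    refine Iff.trans (hj.exact y) ⟨?_, ?_⟩
    · rintro ⟨x, rfl⟩
      refine ⟨t - g x, (Submodule.Quotient.eq _).2 ⟨-x, ?_⟩⟩
      simp
    · rintro ⟨t', ht'⟩
      obtain ⟨x, hx⟩ := (Submodule.Quotient.eq _).1 ht'
      have h2 : j x = 0 - y := congr(($hx).2)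
      exact ⟨-x, by rw [map_neg, h2]; simp⟩
  · obtain ⟨x, rfl⟩ := hj.surjective y
    exact ⟨Submodule.mkQ _ (0, x), rfl⟩

/-- If maps to `D` extend along a chain, then any map at one place extends to the whole chain. -/
theorem CategoryTheory.Functor.exists_extension_of_nat {C : Type*} [Category C] (X : ℕ ⥤ C) (D : C)
    (hX : ∀ n (f : X.obj n ⟶ D), ∃ g : X.obj (n + 1) ⟶ D, X.map (homOfLE n.le_succ) ≫ g = f) (m : ℕ)
    (f : X.obj m ⟶ D) : ∃ h : ∀ n, X.obj n ⟶ D,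
      (∀ n, X.map (homOfLE n.le_succ) ≫ h (n + 1) = h n) ∧ h m = f := by
  have step (n) (h : { h : X.obj n ⟶ D // ∀ hn : n ≤ m, h = X.map (homOfLE hn) ≫ f }) :
      ∃ h' : { h : X.obj (n + 1) ⟶ D // ∀ hn : n + 1 ≤ m, h = X.map (homOfLE hn) ≫ f },
        X.map (homOfLE n.le_succ) ≫ h'.1 = h.1 := by
    by_cases hn : n + 1 ≤ m
    · refine ⟨⟨X.map (homOfLE hn) ≫ f, fun _ ↦ rfl⟩, ?_⟩
      rw [h.2 (n.le_succ.trans hn), ← Category.assoc, ← X.map_comp]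
      rfl
    · obtain ⟨g, hg⟩ := hX n h.1
      exact ⟨⟨g, fun h ↦ absurd h hn⟩, hg⟩
  choose s hs using step
  let h (n) : { h : X.obj n ⟶ D // ∀ hn : n ≤ m, h = X.map (homOfLE hn) ≫ f } :=
    n.rec ⟨X.map (homOfLE m.zero_le) ≫ f, fun _ ↦ rfl⟩ s
  refine ⟨fun n ↦ (h n).1, fun n ↦ hs n (h n), ?_⟩
  exact ((h m).2 le_rfl).trans <| (congrArg (· ≫ f) (X.map_id m)).trans (Category.id_comp f)

theorem CategoryTheory.exists_extension_of_nat {C : Type*} [Category C] (A : ℕ → C)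
    (z : ∀ n, A n ⟶ A (n + 1)) (D : C) (hA : ∀ n (f : A n ⟶ D), ∃ g : A (n + 1) ⟶ D, z n ≫ g = f)
    (m : ℕ) (f : A m ⟶ D) :
    ∃ h : ∀ n, A n ⟶ D, (∀ n, z n ≫ h (n + 1) = h n) ∧ h m = f := by
  have hz (n) : (Functor.ofSequence z).map (homOfLE n.le_succ) = z n :=
    Functor.ofSequence_map_homOfLE_succ z n
  obtain ⟨h, h1, h2⟩ := (Functor.ofSequence z).exists_extension_of_nat D
    (fun n f ↦ by rw [hz]; exact hA n f) m f
  exact ⟨h, fun n ↦ by rw [← hz]; exact h1 n, h2⟩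

variable {R S : Type u} [Ring R] [Ring S]

namespace FrobeniusPair

variable {F : ModuleCat.{u} R ⥤ ModuleCat.{u} S} {G : ModuleCat.{u} S ⥤ ModuleCat.{u} R}
  (φ : FrobeniusPair F G)

include φ

theorem exists_colimit (A : ℕ → ModuleCat.{u} R) (z : ∀ n, A n ⟶ A (n + 1)) :
    ∃ (C : ModuleCat.{u} R) (c : ∀ n, A n ⟶ C),
      (∀ n, z n ≫ c (n + 1) = c n) ∧
      (∀ (D : ModuleCat.{u} R) (f : ∀ n, A n ⟶ D),
        (∀ n, z n ≫ f (n + 1) = f n) → ∃ g : C ⟶ D, ∀ n, c n ≫ g = f n) ∧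
      (∀ (D : ModuleCat.{u} S) (f : ∀ n, F.obj (A n) ⟶ D),
        (∀ n, F.map (z n) ≫ f (n + 1) = f n) →
          ∃ g : F.obj C ⟶ D, ∀ n, F.map (c n) ≫ g = f n) ∧
      ∀ x : F.obj C, ∃ (n : ℕ) (y : F.obj (A n)), F.map (c n) y = x := by
  have := φ.adj'.leftAdjoint_preservesColimits
  have := preservesFilteredColimitsOfSize_shrink.{0, u, 0, u} (forget (ModuleCat.{u} S))
  let X : ℕ ⥤ ModuleCat.{u} R := Functor.ofSequence z
  have hX (n) : X.map (homOfLE n.le_succ) = z n := Functor.ofSequence_map_homOfLE_succ _ n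
  have hF := isColimitOfPreserves F (colimit.isColimit X)
  refine ⟨colimit X, colimit.ι X, fun n ↦ ?_, fun D f hf ↦ ?_, fun D f hf ↦ ?_,
    fun x ↦ ?_⟩
  · rw [← hX]
    exact colimit.w X _
  · exact ⟨colimit.desc X ⟨D, NatTrans.ofSequence f fun n ↦ by
      rw [hX]; exact (hf n).trans (Category.comp_id _).symm⟩, fun n ↦ colimit.ι_desc _ _⟩
  · exact ⟨hF.desc ⟨D, NatTrans.ofSequence f fun n ↦ by
      rw [Functor.comp_map, hX]; exact (hf n).trans (Category.comp_id _).symm⟩,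
      fun n ↦ hF.fac _ _⟩
  · exact Concrete.isColimit_exists_rep _ hF x

variable {N : ModuleCat.{u} R} {K T : ModuleCat.{u} S} {k : K ⟶ T} {q : T ⟶ F.obj N}

theorem exists_step (hk : IsShortExact k.hom q.hom)
    (hq : IsGorensteinProjectivePrecover q.hom)
    (hK : ∀ Y : ModuleCat.{u} S, IsGorensteinProjectiveModule S Y → ExtOrthogonal S Y K)
    {Z : ModuleCat.{u} R} (hZ : IsGorensteinProjectiveModule S (F.obj Z)) (f : Z ⟶ N)
    (g : F.obj Z ⟶ T) (hg : g ≫ q = F.map f) :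
    ∃ (Z' : ModuleCat.{u} R) (f' : Z' ⟶ N) (g' : F.obj Z' ⟶ T) (z : Z ⟶ Z')
      (Q : ModuleCat.{u} S) (j : F.obj Z ⟶ Q) (b : T × Q →ₗ[S] F.obj Z'),
      IsGorensteinProjectiveModule S (F.obj Z') ∧ g' ≫ q = F.map f' ∧ z ≫ f' = f ∧
      F.map z ≫ g' = g ∧ Module.Projective S Q ∧
      (∀ P : ModuleCat.{u} S, Module.Projective S P → ∀ l : F.obj Z ⟶ P, ∃ l' : F.obj Z' ⟶ P,
        F.map z ≫ l' = l) ∧ (∀ x, b (g x, j x) = F.map z x) ∧ ∀ x, F.map f' (b x) = q x.1 := by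
  obtain ⟨Q, Y₀, j, π, hQ, hj, hY₀⟩ := hZ.exists_cosyzygy
  obtain ⟨u₀, v₀, huv₀⟩ := hj.prod_right_of_left g.hom
  have hY := IsGorensteinProjectiveModule.of_shortExact huv₀ hq.1 hY₀
  let V : ModuleCat.{u} S := .of S (T × Q)
  let a : F.obj Z ⟶ V := ModuleCat.ofHom (g.hom.prod j)
  have ha : Injective a.hom := fun x y hxy ↦ hj.injective congr(($hxy).2)
  let Y : ModuleCat.{u} S := .of S (V ⧸ LinearMap.range a.hom)
  let p : V ⟶ Y := ModuleCat.ofHom (Submodule.mkQ _)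
  have hap : IsShortExact a.hom p.hom := .of_injective ha
  have hGap := φ.map_left hap
  obtain ⟨Z', u, w, v, hcomm, huv, hdesc⟩ := hGap.exists_pushout (φ.adj.counit.app Z).hom
  let u' : Z ⟶ Z' := ModuleCat.ofHom u
  let w' : G.obj V ⟶ Z' := ModuleCat.ofHom w
  let v' : Z' ⟶ G.obj Y := ModuleCat.ofHom v
  have hcomm' : φ.adj.counit.app Z ≫ u' = G.map a ≫ w' := ModuleCat.hom_ext hcomm
  have huv' : IsShortExact u'.hom v'.hom := huv
  let h : V ⟶ F.obj N := ModuleCat.ofHom (q.hom ∘ₗ LinearMap.fst S T Q)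
  have hah : a ≫ h = F.map f := hg
  obtain ⟨f', hf'₁, hf'₂⟩ := hdesc N f.hom ((φ.adj.homEquiv _ _).symm h).hom (by
    have : φ.adj.counit.app Z ≫ f = G.map a ≫ (φ.adj.homEquiv _ _).symm h := by
      rw [← φ.adj.homEquiv_naturality_left_symm, hah, φ.adj.homEquiv_counit]
      exact (φ.adj.counit.naturality f).symm
    exact congr(($this).hom))
  let f'' : Z' ⟶ N := ModuleCat.ofHom f'
  have hf₁ : u' ≫ f'' = f := ModuleCat.hom_ext hf'₁
  have hf₂ : w' ≫ f'' = (φ.adj.homEquiv _ _).symm h := ModuleCat.hom_ext hf'₂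
  let b : V ⟶ F.obj Z' := φ.adj.homEquiv _ _ w'
  have hab : a ≫ b = F.map u' := by
    rw [← φ.adj.homEquiv_naturality_left, ← hcomm', φ.adj.homEquiv_unit, F.map_comp,
      φ.adj.right_triangle_components_assoc]
  have hbf : b ≫ F.map f'' = h := by
    rw [← φ.adj.homEquiv_naturality_right, hf₂, Equiv.apply_symm_apply]
  have hFuv := φ.map_right huv'
  have hFGY := φ.isGorensteinProjectiveModule_right
    (φ.isGorensteinProjectiveModule_left (M := Y) hY)
  have hZ' := IsGorensteinProjectiveModule.of_shortExact hFuv hZ hFGY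
  obtain ⟨g₀, hg₀⟩ := hq.2 (F.obj Z') hZ' (F.map f'').hom
  obtain ⟨c, hc⟩ := hk.exists_lift (g₀ ∘ₗ (F.map u').hom - g.hom) (by
    rw [LinearMap.comp_sub, ← LinearMap.comp_assoc, hg₀, sub_eq_zero, ← ModuleCat.hom_comp,
      ← ModuleCat.hom_comp, hg, ← F.map_comp, hf₁])
  obtain ⟨c', hc'⟩ := hK _ hFGY _ _ _ _ hFuv c
  refine ⟨Z', f'', ModuleCat.ofHom (g₀ - k.hom ∘ₗ c'), u', Q, ModuleCat.ofHom j, b.hom, hZ', ?_,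
    hf₁,
    ?_, hQ, fun P hP l ↦ ?_, fun x ↦ congr($hab x), fun x ↦ congr($hbf x)⟩
  · ext x
    have h1 : q (g₀ x) = F.map f'' x := congr($hg₀ x)
    have h2 : q (k (c' x)) = 0 := hk.apply_apply _
    simp [h1, h2]
  · ext x
    have h1 : k (c x) = g₀ (F.map u' x) - g x := congr($hc x)
    have h2 : c' (F.map u' x) = c x := congr($hc' x)
    simp [h1, h2]
  · obtain ⟨l', hl'⟩ := hFGY.extOrthogonal P _ _ _ _ hFuv l.hom
    exact ⟨ModuleCat.ofHom l', ModuleCat.hom_ext hl'⟩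

theorem exists_factorization (hk : IsShortExact k.hom q.hom)
    (hq : IsGorensteinProjectivePrecover q.hom)
    (hK : ∀ Y : ModuleCat.{u} S, IsGorensteinProjectiveModule S Y → ExtOrthogonal S Y K)
    {Z : ModuleCat.{u} R} (hZ : IsGorensteinProjectiveModule R Z) (f : Z ⟶ N) :
    ∃ (M : ModuleCat.{u} R) (c : Z ⟶ M) (h : M ⟶ N) (I : Type u) (i : F.obj M →ₗ[S] T × (I →₀ S))
      (r : T × (I →₀ S) →ₗ[S] F.obj M), c ≫ h = f ∧ r ∘ₗ i = .id := by
  let Stage := { t : (Z : ModuleCat.{u} R) × (Z ⟶ N) × (F.obj Z ⟶ T) //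
    IsGorensteinProjectiveModule S (F.obj t.1) ∧ t.2.2 ≫ q = F.map t.2.1 }
  have step (t : Stage) : ∃ (t' : Stage) (z : t.1.1 ⟶ t'.1.1) (Q : ModuleCat.{u} S)
      (j : F.obj t.1.1 ⟶ Q) (b : T × Q →ₗ[S] F.obj t'.1.1), z ≫ t'.1.2.1 = t.1.2.1 ∧
      F.map z ≫ t'.1.2.2 = t.1.2.2 ∧ Module.Projective S Q ∧
      (∀ P : ModuleCat.{u} S, Module.Projective S P → ∀ l : F.obj t.1.1 ⟶ P,
        ∃ l' : F.obj t'.1.1 ⟶ P, F.map z ≫ l' = l) ∧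
      (∀ x, b (t.1.2.2 x, j x) = F.map z x) ∧ ∀ x, F.map t'.1.2.1 (b x) = q x.1 := by
    obtain ⟨⟨Z, f, g⟩, h1, h2⟩ := t
    obtain ⟨Z', f', g', z, Q, j, b, h3, h4, h5⟩ := φ.exists_step hk hq hK h1 f g h2
    exact ⟨⟨⟨Z', f', g'⟩, h3, h4⟩, z, Q, j, b, h5⟩
  choose next z Q j b hzf hzg hQ hext hbj hbf using step
  have hFZ := φ.isGorensteinProjectiveModule_right hZ
  obtain ⟨g₀, hg₀⟩ := hq.2 (F.obj Z) hFZ (F.map f).hom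
  let t (n : ℕ) : Stage :=
    n.rec ⟨⟨Z, f, ModuleCat.ofHom g₀⟩, hFZ, ModuleCat.hom_ext hg₀⟩ fun _ ↦ next
  obtain ⟨M, c, hc, hdesc, hdescF, hrep⟩ :=
    φ.exists_colimit (fun n ↦ (t n).1.1) fun n ↦ z (t n)
  have hFc (n) : F.map (z (t n)) ≫ F.map (c (n + 1)) = F.map (c n) :=
    (F.map_comp _ _).symm.trans (congrArg F.map (hc n))
  obtain ⟨fM, hfM⟩ := hdesc N (fun n ↦ (t n).1.2.1) fun n ↦ hzf (t n)
  obtain ⟨gM, hgM⟩ := hdescF T (fun n ↦ (t n).1.2.2) fun n ↦ hzg (t n)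
  have hjM (m : ℕ) : ∃ jM : F.obj M ⟶ Q (t m), F.map (c m) ≫ jM = j (t m) := by
    obtain ⟨h, h1, h2⟩ := CategoryTheory.exists_extension_of_nat (fun n ↦ F.obj (t n).1.1)
      (fun n ↦ F.map (z (t n))) (Q (t m)) (fun n ↦ hext (t n) (Q (t m)) (hQ _)) m (j (t m))
    obtain ⟨jM, hjM⟩ := hdescF (Q (t m)) h h1
    exact ⟨jM, (hjM m).trans h2⟩
  choose jM hjM using hjM
  have hgq : gM ≫ q = F.map fM := by
    ext x
    obtain ⟨n, y, rfl⟩ := hrep x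
    have h1 : gM (F.map (c n) y) = (t n).1.2.2 y := congr($(hgM n) y)
    have h2 : q ((t n).1.2.2 y) = F.map (t n).1.2.1 y := congr($((t n).2.2) y)
    have h3 : F.map fM (F.map (c n) y) = F.map (t n).1.2.1 y := by
      have := (F.map_comp (c n) fM).symm.trans (congrArg F.map (hfM n))
      exact congr($this y)
    exact (congrArg q h1).trans (h2.trans h3.symm)
  let bM (n : ℕ) : T × Q (t n) →ₗ[S] F.obj M := (F.map (c (n + 1))).hom ∘ₗ b (t n)
  have hbM (n x) : F.map fM (bM n x) = q x.1 := by
    rw [← hbf (t n) x]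
    have := (F.map_comp (c (n + 1)) fM).symm.trans (congrArg F.map (hfM (n + 1)))
    exact congr($this (b (t n) x))
  obtain ⟨P, Y, jT, pT, hP, hjT, hY⟩ := hq.1.exists_cosyzygy
  obtain ⟨α, hα⟩ := hk.exists_lift (gM.hom ∘ₗ bM 0 ∘ₗ LinearMap.inl S _ _ - .id) (by
    refine LinearMap.ext fun x ↦ ?_
    have h1 : q (gM (bM 0 (x, 0))) = F.map fM (bM 0 (x, 0)) := congr($hgq _)
    have h2 : q (gM (bM 0 (x, 0))) = q x := h1.trans (hbM 0 (x, 0))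
    simp [h2])
  obtain ⟨β, hβ⟩ := hK Y hY _ _ _ _ hjT α
  have hQ' (n) : Module.Projective S (Q (t n)) := hQ _
  have hmono : Monotone fun n ↦ LinearMap.range (F.map (c n)).hom := by
    refine monotone_nat_of_le_succ fun n ↦ ?_
    rintro _ ⟨x, rfl⟩
    refine ⟨F.map (z (t n)) x, ?_⟩
    exact congr($(hFc n) x)
  have hstep (n) : ∀ x ∈ LinearMap.range (F.map (c n)).hom, bM n (gM x, jM n x) = x := by
    rintro _ ⟨x, rfl⟩
    have h1 : gM (F.map (c n) x) = (t n).1.2.2 x := congr($(hgM n) x)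
    have h2 : jM n (F.map (c n) x) = j (t n) x := congr($(hjM n) x)
    change F.map (c (n + 1)) (b (t n) (gM (F.map (c n) x), jM n (F.map (c n) x))) = F.map (c n) x
    rw [h1, h2, hbj]
    exact congr($(hFc n) x)
  obtain ⟨I, i, r, hri⟩ := exists_retract_prod_finsupp_of_chain hmono
    (fun x ↦ hrep x) gM.hom (fun n ↦ (jM n).hom) bM
    (fun n x ↦ ⟨b (t n) x, rfl⟩) hstep jT (k.hom ∘ₗ β) fun x ↦ by
      have h1 : k (α x) = gM (bM 0 (x, 0)) - x := congr($hα x)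
      have h2 : β (jT x) = α x := congr($hβ x)
      change gM (bM 0 (x, 0)) = x + k (β (jT x))
      rw [h2, h1, add_sub_cancel]
  exact ⟨M, c 0, fM, I, i, r, hfM 0, hri⟩

end FrobeniusPair

end

section

theorem CategoryTheory.IsGrothendieckAbelian.hasSmallObjectArgument_ofHoms {C : Type*}
    [Category C] [Abelian C] [IsGrothendieckAbelian.{u} C] {ι : Type u}
    {A B : ι → C} (f : ∀ i, A i ⟶ B i) [∀ i, Mono (f i)] :
    MorphismProperty.HasSmallObjectArgument.{u} (MorphismProperty.ofHoms f) := by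
  have hmono : MorphismProperty.ofHoms f ≤ MorphismProperty.monomorphisms C := by
    rintro _ _ _ ⟨i⟩
    exact inferInstanceAs (Mono (f i))
  obtain ⟨κ, hκ', hκ⟩ := HasCardinalLT.exists_regular_cardinal.{u} (Σ i, Subobject (A i))
  have : Fact κ.IsRegular := ⟨hκ'⟩
  have : Nonempty κ.ord.ToType := by simpa using hκ'.ne_zero
  have := WellFoundedLT.toOrderBot κ.ord.ToType
  refine ⟨κ, inferInstance, inferInstance, { preservesColimit := ?_ }⟩
  rintro _ _ X Y _ ⟨i⟩ g hg
  let hg' : (MorphismProperty.monomorphisms C).TransfiniteCompositionOfShape κ.ord.ToType g :=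
    { toTransfiniteCompositionOfShape := hg.toTransfiniteCompositionOfShape
      map_mem j hj := by
        have := (hg.attachCells j hj).pushouts_coproducts
        simp only [MorphismProperty.ofHoms_homFamily] at this
        refine (?_ : _ ≤ MorphismProperty.monomorphisms C) _ this
        simp only [MorphismProperty.pushouts_le_iff, MorphismProperty.coproducts_le_iff]
        exact hmono }
  have (j j' : κ.ord.ToType) (φ : j ⟶ j') : Mono (hg'.F.map φ) := hg'.mem_map φ
  exact preservesColimit_coyoneda_obj_of_mono (Y := hg'.F) (κ := κ)
    (hκ.of_injective (fun s ↦ (⟨i, s⟩ : Σ i, Subobject (A i)))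
      fun _ _ h ↦ eq_of_heq (Sigma.mk.inj h).2)

variable {R S : Type u} [Ring R] [Ring S]

/-- `f` has the left lifting property against surjections. -/
def LinearMap.LiftsSurjections {A B : Type u} [AddCommGroup A] [Module S A] [AddCommGroup B]
    [Module S B] (f : A →ₗ[S] B) : Prop :=
  ∀ (X Y : ModuleCat.{u} S) (p : X →ₗ[S] Y), Surjective p → ∀ (u : A →ₗ[S] X) (v : B →ₗ[S] Y),
    p ∘ₗ u = v ∘ₗ f → ∃ w : B →ₗ[S] X, w ∘ₗ f = u ∧ p ∘ₗ w = v

namespace LinearMap.LiftsSurjections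

variable {A B : Type u} [AddCommGroup A] [Module S A] [AddCommGroup B]
    [Module S B] {f : A →ₗ[S] B}

theorem exists_retraction (hf : f.LiftsSurjections) : ∃ r : B →ₗ[S] A, r ∘ₗ f = .id := by
  obtain ⟨r, hr, -⟩ := hf (.of S A) (.of S PUnit) 0 (fun _ ↦ ⟨0, rfl⟩) .id 0 rfl
  exact ⟨r, hr⟩

theorem injective (hf : f.LiftsSurjections) : Injective f := by
  obtain ⟨r, hr⟩ := hf.exists_retraction
  exact LeftInverse.injective fun x ↦ congr($hr x)

theorem isGorensteinProjectiveModule (hf : f.LiftsSurjections)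
    (hA : IsGorensteinProjectiveModule S A) : IsGorensteinProjectiveModule S B := by
  have hses := IsShortExact.of_injective hf.injective
  have : Module.Projective S (B ⧸ LinearMap.range f) :=
    .of_lifting_property'' fun p hp ↦ by
      obtain ⟨w, hw₁, hw₂⟩ := hf (.of S _) (.of S _) p hp 0 (Submodule.mkQ _) (by
        ext x; simpa using (hses.apply_apply x).symm)
      obtain ⟨g, hg⟩ := hses.exists_desc w hw₁
      refine ⟨g, LinearMap.ext fun x ↦ ?_⟩
      obtain ⟨x, rfl⟩ := hses.surjective x
      exact (congrArg p congr($hg x)).trans congr($hw₂ x)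
  exact .of_shortExact hses hA .of_projective

end LinearMap.LiftsSurjections

namespace FrobeniusPair

variable {F : ModuleCat.{u} R ⥤ ModuleCat.{u} S} {G : ModuleCat.{u} S ⥤ ModuleCat.{u} R}
  (φ : FrobeniusPair F G)

include φ

/-- Factorizations relative to a set of morphisms which lift against surjections after applying
`F`. -/
theorem exists_factorization_rlp {ι : Type u} {A B : ι → ModuleCat.{u} R} (f : ∀ i, A i ⟶ B i)
    (hf : ∀ i, (F.map (f i)).hom.LiftsSurjections) {X N : ModuleCat.{u} R} (p : X ⟶ N) :
    ∃ (Y : ModuleCat.{u} R) (c : X ⟶ Y) (p' : Y ⟶ N), c ≫ p' = p ∧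
      (F.map c).hom.LiftsSurjections ∧ ∀ i, HasLiftingProperty (f i) p' := by
  have hmono (i) : Mono (f i) := by
    have := φ.faithful
    have : Mono (F.map (f i)) := (ModuleCat.mono_iff_injective _).2 (hf i).injective
    exact F.mono_of_mono_map this
  have := IsGrothendieckAbelian.hasSmallObjectArgument_ofHoms f
  let d := (MorphismProperty.functorialFactorizationData (MorphismProperty.ofHoms f).rlp.llp
    (MorphismProperty.ofHoms f).rlp).factorizationData p
  refine ⟨d.Z, d.i, d.p, d.fac, fun U V s hs a b hab ↦ ?_, fun i ↦ d.hp _ ⟨i⟩⟩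
  let s' : U ⟶ V := ModuleCat.ofHom s
  have hs' : Epi s' := (ModuleCat.epi_iff_surjective s').2 hs
  have hlift : HasLiftingProperty d.i (G.map s') := by
    refine d.hi _ ?_
    rintro _ _ _ ⟨i⟩
    rw [← φ.adj'.hasLiftingProperty_iff]
    refine ⟨fun {u v} sq ↦ ?_⟩
    obtain ⟨w, hw₁, hw₂⟩ := hf i U V s hs u.hom v.hom congr(($sq.w).hom)
    exact ⟨⟨⟨ModuleCat.ofHom w, ModuleCat.hom_ext hw₁, ModuleCat.hom_ext hw₂⟩⟩⟩
  rw [← φ.adj'.hasLiftingProperty_iff] at hlift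
  have sq : CommSq (ModuleCat.ofHom a) (F.map d.i) s' (ModuleCat.ofHom b) :=
    ⟨ModuleCat.hom_ext hab⟩
  exact ⟨sq.lift.hom, congr(($sq.fac_left).hom), congr(($sq.fac_right).hom)⟩

end FrobeniusPair

end

section

variable {S : Type u} [Ring S] {A T I : Type*} [AddCommGroup A] [Module S A] [AddCommGroup T]
  [Module S T]

open Classical in
/-- The projection of `T × (I →₀ S)` onto `T × (J →₀ S)`. -/
noncomputable def prodFinsuppFilter (S T : Type*) {I : Type*} [Ring S] [AddCommGroup T]
    [Module S T] (J : Set I) : T × (I →₀ S) →ₗ[S] T × (I →₀ S) :=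
  LinearMap.prodMap .id ((Finsupp.supported S S J).subtype ∘ₗ Finsupp.restrictDom S S J)

section prodFinsuppFilter

@[simp] theorem prodFinsuppFilter_fst (J : Set I) (v : T × (I →₀ S)) :
    (prodFinsuppFilter S T J v).1 = v.1 := rfl

open Classical in
theorem prodFinsuppFilter_snd (J : Set I) (v : T × (I →₀ S)) (k : I) :
    (prodFinsuppFilter S T J v).2 k = if k ∈ J then v.2 k else 0 := by
  simp [prodFinsuppFilter, Finsupp.filter_apply]

theorem prodFinsuppFilter_filter (J J' : Set I) (v : T × (I →₀ S)) :
    prodFinsuppFilter S T J (prodFinsuppFilter S T J' v) = prodFinsuppFilter S T (J ∩ J') v := by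
  refine Prod.ext rfl (Finsupp.ext fun k ↦ ?_)
  simp only [prodFinsuppFilter_snd, Set.mem_inter_iff]
  split_ifs <;> simp_all

theorem prodFinsuppFilter_union (J J' : Set I) (v : T × (I →₀ S)) :
    prodFinsuppFilter S T (J ∪ J') v = prodFinsuppFilter S T J v +
      prodFinsuppFilter S T J' (v - prodFinsuppFilter S T J v) := by
  refine Prod.ext (by simp) (Finsupp.ext fun k ↦ ?_)
  simp only [prodFinsuppFilter_snd, Set.mem_union, Prod.snd_add, Finsupp.add_apply, Prod.snd_sub,
    Finsupp.sub_apply]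
  split_ifs <;> simp_all

end prodFinsuppFilter

/-- Given maps `i : A → T × (I →₀ S)` and `r` in the other direction, both restrict to maps
between `V` and `T × (J →₀ S)`. -/
structure IsSplitOn (i : A →ₗ[S] T × (I →₀ S)) (r : T × (I →₀ S) →ₗ[S] A) (V : Submodule S A)
    (J : Set I) : Prop where
  filter_apply : ∀ x ∈ V, prodFinsuppFilter S T J (i x) = i x
  apply_filter : ∀ v, r (prodFinsuppFilter S T J v) ∈ V

namespace IsSplitOn

variable {i : A →ₗ[S] T × (I →₀ S)} {r : T × (I →₀ S) →ₗ[S] A} {V V' : Submodule S A}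
  {J J' : Set I}

theorem filter_apply_of_subset (h : IsSplitOn i r V J) (hJ : J ⊆ J') {x : A} (hx : x ∈ V) :
    prodFinsuppFilter S T J' (i x) = i x := by
  rw [← h.filter_apply x hx, prodFinsuppFilter_filter, Set.inter_eq_self_of_subset_right hJ]

theorem inf (h : IsSplitOn i r V J) (h' : IsSplitOn i r V' J') :
    IsSplitOn i r (V ⊓ V') (J ∩ J') where
  filter_apply x hx := by
    rw [← prodFinsuppFilter_filter, h'.filter_apply x hx.2, h.filter_apply x hx.1]
  apply_filter v := by
    refine ⟨?_, ?_⟩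
    · rw [← prodFinsuppFilter_filter]
      exact h.apply_filter _
    · rw [Set.inter_comm, ← prodFinsuppFilter_filter]
      exact h'.apply_filter _

theorem sup (h : IsSplitOn i r V J) (h' : IsSplitOn i r V' J') :
    IsSplitOn i r (V ⊔ V') (J ∪ J') where
  filter_apply x hx := by
    obtain ⟨a, ha, b, hb, rfl⟩ := Submodule.mem_sup.1 hx
    rw [map_add, map_add, h.filter_apply_of_subset Set.subset_union_left ha,
      h'.filter_apply_of_subset Set.subset_union_right hb]
  apply_filter v := by
    rw [prodFinsuppFilter_union, map_add]
    exact add_mem (Submodule.mem_sup_left (h.apply_filter _))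
      (Submodule.mem_sup_right (h'.apply_filter _))

theorem of_directed {κ : Type*} [Nonempty κ] {V : κ → Submodule S A} {J : κ → Set I}
    (h : ∀ k, IsSplitOn i r (V k) (J k)) (hJ : Directed (· ⊆ ·) J) {V' : Submodule S A}
    (hV : ∀ k, V k ≤ V') (hV' : ∀ x ∈ V', ∃ k, x ∈ V k) : IsSplitOn i r V' (⋃ k, J k) where
  filter_apply x hx := by
    obtain ⟨k, hk⟩ := hV' x hx
    exact (h k).filter_apply_of_subset (Set.subset_iUnion J k) hk
  apply_filter v := by
    set w := prodFinsuppFilter S T (⋃ k, J k) v with hw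
    obtain ⟨k, hk⟩ := hJ.exists_mem_subset_of_finset_subset_biUnion (s := w.2.support) (by
      intro j hj
      by_contra hj'
      rw [Finset.mem_coe, Finsupp.mem_support_iff, hw, prodFinsuppFilter_snd, if_neg hj'] at hj
      exact hj rfl)
    have : prodFinsuppFilter S T (J k) w = w := by
      refine Prod.ext rfl (Finsupp.ext fun j ↦ ?_)
      rw [prodFinsuppFilter_snd]
      split_ifs with hj
      · rfl
      · by_contra hj'
        exact hj (hk (Finsupp.mem_support_iff.2 (Ne.symm hj')))
    rw [← this]
    exact hV k ((h k).apply_filter w)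

theorem of_closed (h : ∀ t, r (t, 0) ∈ V)
    (h' : ∀ x ∈ V, ∀ k ∈ (i x).2.support, r (0, Finsupp.single k 1) ∈ V) :
    IsSplitOn i r V {k | ∃ x ∈ V, k ∈ (i x).2.support} where
  filter_apply x hx := by
    refine Prod.ext rfl (Finsupp.ext fun k ↦ ?_)
    rw [prodFinsuppFilter_snd]
    split_ifs with hk
    · rfl
    · by_contra hk'
      exact hk ⟨x, hx, Finsupp.mem_support_iff.2 (Ne.symm hk')⟩
  apply_filter v := by
    set w := prodFinsuppFilter S T {k | ∃ x ∈ V, k ∈ (i x).2.support} v with hw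
    have hw' : w = (w.1, 0) +
        ∑ k ∈ w.2.support, w.2 k • ((0, Finsupp.single k 1) : T × (I →₀ S)) := by
      refine Prod.ext ?_ ?_
      · simp [Prod.fst_sum]
      · conv_lhs => rw [← Finsupp.sum_single w.2]
        simp [Prod.snd_sum, Finsupp.sum]
    rw [hw', map_add, map_sum]
    refine add_mem (h _) (sum_mem fun k hk ↦ ?_)
    rw [map_smul]
    have : k ∈ {k | ∃ x ∈ V, k ∈ (i x).2.support} := by
      by_contra hk'
      rw [Finsupp.mem_support_iff, hw, prodFinsuppFilter_snd, if_neg hk'] at hk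
      exact hk rfl
    obtain ⟨x, hx, hk⟩ := this
    exact V.smul_mem _ (h' x hx k hk)

/-- The retraction onto `V`. -/
noncomputable def retraction (h : IsSplitOn i r V J) : T × (I →₀ S) →ₗ[S] V :=
  (r ∘ₗ prodFinsuppFilter S T J).codRestrict V h.apply_filter

@[simp] theorem coe_retraction (h : IsSplitOn i r V J) (v : T × (I →₀ S)) :
    (h.retraction v : A) = r (prodFinsuppFilter S T J v) := rfl

theorem retraction_apply (h : IsSplitOn i r V J) (hri : r ∘ₗ i = .id) (x : V) :
    h.retraction (i x) = x :=
  Subtype.ext (by rw [coe_retraction, h.filter_apply x x.2]; exact congr($hri x))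

end IsSplitOn

section

variable {A T I : Type u} [AddCommGroup A] [Module S A] [AddCommGroup T] [Module S T]
  {i : A →ₗ[S] T × (I →₀ S)} {r : T × (I →₀ S) →ₗ[S] A} {V V' : Submodule S A}
  {J J' : Set I}

theorem IsSplitOn.isGorensteinProjectiveModule (h : IsSplitOn i r V J) (hri : r ∘ₗ i = .id)
    (hT : IsGorensteinProjectiveModule S T) : IsGorensteinProjectiveModule S V :=
  .of_retract (i := i ∘ₗ V.subtype) (r := h.retraction)
    (LinearMap.ext fun x ↦ h.retraction_apply hri x) (hT.prod .of_projective)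

theorem IsSplitOn.liftsSurjections (h : IsSplitOn i r V J) (h' : IsSplitOn i r V' J')
    (hri : r ∘ₗ i = .id) (hV : V ≤ V') (hJ : J ⊆ J') :
    (Submodule.inclusion hV).LiftsSurjections := by
  intro X Y p hp u v huv
  choose a ha using fun k ↦ hp (v (h'.retraction (0, Finsupp.single k 1)))
  let l : (I →₀ S) →ₗ[S] X := Finsupp.linearCombination S a
  have hl : p ∘ₗ l = v ∘ₗ h'.retraction ∘ₗ LinearMap.inr S T _ := by
    ext k
    simpa [l] using ha k
  refine ⟨(u ∘ₗ h.retraction + l ∘ₗ LinearMap.snd S T _ ∘ₗ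
    (LinearMap.id - prodFinsuppFilter S T J)) ∘ₗ i ∘ₗ V'.subtype, ?_, ?_⟩
  · ext x
    have h1 : h.retraction (i x) = x := h.retraction_apply hri x
    have h2 : prodFinsuppFilter S T J (i x) = i x := h.filter_apply x x.2
    simp [h1, h2]
  · ext x
    have h1 : p (l (i x - prodFinsuppFilter S T J (i x)).2) =
        v (h'.retraction (i x - prodFinsuppFilter S T J (i x))) :=
      (congr($hl _)).trans <| congrArg (fun z ↦ v (h'.retraction z)) (Prod.ext (by simp) rfl)
    have h2 : p (u (h.retraction (i x))) = v (Submodule.inclusion hV (h.retraction (i x))) :=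
      congr($huv _)
    have h3 : Submodule.inclusion hV (h.retraction (i x)) +
        h'.retraction (i x - prodFinsuppFilter S T J (i x)) = x := by
      refine Subtype.ext ?_
      have h4 : r (i x) = x := congr($hri x)
      have h5 := h'.filter_apply x x.2
      simp [prodFinsuppFilter_filter, Set.inter_eq_self_of_subset_right hJ, h5, h4]
    change p (u (h.retraction (i x)) + l (i x - prodFinsuppFilter S T J (i x)).2) = v x
    rw [map_add, h1, h2, ← map_add, h3]

end

end

section

section

open Cardinal

variable {R M : Type u} [Ring R] [AddCommGroup M] [Module R M] {κ : Cardinal.{u}}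

theorem Submodule.mk_span_le (hκ : ℵ₀ ≤ κ) (hR : #R ≤ κ) {s : Set M} (hs : #s ≤ κ) :
    #(span R s) ≤ κ := by
  rw [Finsupp.span_eq_range_linearCombination]
  refine mk_range_le.trans ?_
  refine (mk_le_of_injective (Finsupp.graph_injective s R)).trans ?_
  have hsR : #(s × R) ≤ κ := by
    rw [mk_prod, lift_id, lift_id]
    exact mul_le_of_le hκ hs hR
  cases finite_or_infinite (s × R)
  · exact (lt_aleph0_of_finite _).le.trans hκ
  · exact (mk_finset_of_infinite _).trans_le hsR

theorem exists_submodule_closed_mk_le (hκ : ℵ₀ ≤ κ) (hR : #R ≤ κ) {s : Set M} (hs : #s ≤ κ)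
    (f : M → Set M) (hf : ∀ x, #(f x) ≤ κ) :
    ∃ L : Submodule R M, s ⊆ L ∧ (∀ x ∈ L, f x ⊆ L) ∧ #L ≤ κ := by
  let step (L : Submodule R M) : Submodule R M := Submodule.span R (L ∪ ⋃ x ∈ L, f x)
  let L (n : ℕ) : Submodule R M := n.rec (Submodule.span R s) fun _ ↦ step
  have hL : Monotone L := monotone_nat_of_le_succ fun n x hx ↦
    Submodule.subset_span (Set.mem_union_left _ hx)
  have hfL (n) : ∀ x ∈ L n, f x ⊆ L (n + 1) := fun x hx y hy ↦
    Submodule.subset_span (Set.mem_union_right _ (Set.mem_biUnion hx hy))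
  have hmk (n : ℕ) : #↥(L n) ≤ κ := by
    induction n with
    | zero => exact Submodule.mk_span_le hκ hR hs
    | succ n ih =>
      refine Submodule.mk_span_le hκ hR ((mk_union_le _ _).trans (add_le_of_le hκ ih ?_))
      refine (mk_biUnion_le _ _).trans (mul_le_of_le hκ ih (ciSup_le' fun x ↦ hf _))
  have hmem {x} : x ∈ ⨆ n, L n ↔ ∃ n, x ∈ L n := Submodule.mem_iSup_of_directed _ hL.directed_le
  refine ⟨⨆ n, L n, fun x hx ↦ hmem.2 ⟨0, Submodule.subset_span hx⟩, fun x hx y hy ↦ ?_, ?_⟩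
  · obtain ⟨n, hn⟩ := hmem.1 hx
    exact hmem.2 ⟨n + 1, hfL n x hn hy⟩
  · have : ((⨆ n, L n : Submodule R M) : Set M) = ⋃ n : ULift.{u} ℕ, SetLike.coe (L n.down) := by
      ext x
      simp [hmem]
    change #((⨆ n, L n : Submodule R M) : Set M) ≤ κ
    rw [this]
    exact (mk_iUnion_le _).trans (mul_le_of_le hκ (by simpa using hκ) (ciSup_le' fun n ↦ hmk _))

end

/-- A local-to-global principle for lifting a linear map on a module which is filtered by
submodules `L`, equipped with additional data `J`. -/
theorem LinearMap.exists_lift_of_good {R M Y N I : Type u} [Ring R] [AddCommGroup M] [Module R M]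
    [AddCommGroup Y] [Module R Y] [AddCommGroup N] [Module R N] (p : Y →ₗ[R] N) (h : M →ₗ[R] N)
    {Good Small : Submodule R M → Set I → Prop}
    (hinf : ∀ {L J L' J'}, Good L J → Good L' J' → Good (L ⊓ L') (J ∩ J'))
    (hsup : ∀ {L J L' J'}, Good L J → Good L' J' → Good (L ⊔ L') (J ∪ J'))
    (hdir : ∀ {κ : Type u} [Nonempty κ] {L : κ → Submodule R M} {J : κ → Set I},
      (∀ k, Good (L k) (J k)) → Directed (· ⊆ ·) J → ∀ {L' : Submodule R M}, (∀ k, L k ≤ L') →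
      (∀ x ∈ L', ∃ k, x ∈ L k) → Good L' (⋃ k, J k))
    (hsmall : ∀ m, ∃ L J, Good L J ∧ Small L J ∧ m ∈ L)
    (hstart : ∀ {L J}, Good L J → Small L J → ∃ t : L →ₗ[R] Y, ∀ x, p (t x) = h x)
    (hext : ∀ {L J L' J'}, Good L J → Small L J → Good L' J' → L' ≤ L → J' ⊆ J →
      ∀ t : L' →ₗ[R] Y, (∀ x, p (t x) = h x) → ∃ t' : L →ₗ[R] Y,
        (∀ (x : L) (y : L'), (x : M) = y → t' x = t y) ∧ ∀ x, p (t' x) = h x) :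
    ∃ t : M →ₗ[R] Y, p ∘ₗ t = h := by
  let s : Set ((M →ₗ.[R] Y) × Set I) := {t | Good t.1.domain t.2 ∧ ∀ x, p (t.1 x) = h x}
  obtain ⟨L₀, J₀, hg₀, hs₀, -⟩ := hsmall 0
  obtain ⟨t₀, ht₀⟩ := hstart hg₀ hs₀
  have hchain : ∀ c ⊆ s, IsChain (· ≤ ·) c → ∀ y ∈ c, ∃ ub ∈ s, ∀ z ∈ c, z ≤ ub := by
    intro c hcs hc y hy
    have hdirc : DirectedOn (· ≤ ·) (Prod.fst '' c) :=
      (hc.image_of_map_rel _ _ _ fun _ _ h ↦ h.1).directedOn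
    have hle (k : c) : k.1.1 ≤ LinearPMap.sSup (Prod.fst '' c) hdirc :=
      LinearPMap.le_sSup hdirc (Set.mem_image_of_mem _ k.2)
    have hmem {x} (hx : x ∈ (LinearPMap.sSup (Prod.fst '' c) hdirc).domain) :
        ∃ k : c, x ∈ k.1.1.domain := by
      obtain ⟨_, ⟨k, hk, rfl⟩, hxk⟩ :=
        (LinearPMap.mem_domain_sSup_iff ⟨_, Set.mem_image_of_mem _ hy⟩ hdirc).1 hx
      exact ⟨⟨k, hk⟩, hxk⟩
    have : Nonempty c := ⟨⟨y, hy⟩⟩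
    refine ⟨(LinearPMap.sSup (Prod.fst '' c) hdirc, ⋃ k : c, k.1.2), ⟨?_, fun ⟨x, hx⟩ ↦ ?_⟩,
      fun z hz ↦ ⟨hle ⟨z, hz⟩, Set.subset_iUnion (fun k : c ↦ k.1.2) ⟨z, hz⟩⟩⟩
    · exact hdir (fun k : c ↦ (hcs k.2).1)
        ((directedOn_iff_directed.1 hc.directedOn).mono_comp _ (g := fun k ↦ k.2) fun _ _ h ↦ h.2)
        (fun k ↦ (hle k).1) fun x hx ↦ hmem hx
    · obtain ⟨k, hk⟩ := hmem hx
      rw [← (hle k).2 (x := ⟨x, hk⟩) (y := ⟨x, hx⟩) rfl]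
      exact (hcs k.2).2 ⟨x, hk⟩
  obtain ⟨⟨t, J⟩, -, ⟨hg, hpt⟩, hmax⟩ := zorn_le_nonempty₀ s hchain (⟨L₀, t₀⟩, J₀) ⟨hg₀, ht₀⟩
  have htop (m : M) : m ∈ t.domain := by
    obtain ⟨L, K, hL, hLs, hm⟩ := hsmall m
    obtain ⟨t', ht', hpt'⟩ := hext hL hLs (hinf hL hg) inf_le_left Set.inter_subset_left
      (t.toFun ∘ₗ Submodule.inclusion inf_le_right) fun x ↦ hpt _
    have hcompat : ∀ (x : t.domain) (y : (⟨L, t'⟩ : M →ₗ.[R] Y).domain), (x : M) = y →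
        t x = (⟨L, t'⟩ : M →ₗ.[R] Y) y := by
      rintro ⟨x, hx⟩ ⟨y, hy⟩ (rfl : x = y)
      exact (ht' ⟨x, hy⟩ ⟨x, hy, hx⟩ rfl).symm
    have hmem : (t.sup ⟨L, t'⟩ hcompat, J ∪ K) ∈ s := by
      refine ⟨hsup hg hL, ?_⟩
      rintro ⟨z, hz⟩
      obtain ⟨a, ha, b, hb, rfl⟩ := Submodule.mem_sup.1 hz
      have h1 := LinearPMap.sup_apply hcompat ⟨a, ha⟩ ⟨b, hb⟩ ⟨a + b, hz⟩ rfl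
      refine (congrArg p h1).trans ?_
      rw [map_add, map_add]
      exact congr($(hpt ⟨a, ha⟩) + $(hpt' ⟨b, hb⟩))
    have := hmax hmem ⟨LinearPMap.left_le_sup _ _ hcompat, Set.subset_union_left⟩
    exact this.1.1 (Submodule.mem_sup_right hm)
  refine ⟨t.toFun ∘ₗ LinearMap.codRestrict t.domain .id htop, LinearMap.ext fun x ↦ hpt _⟩

end

section

open Cardinal

theorem exists_quotient_equiv_of_mk_le {R A Λ : Type u} [Ring R] [AddCommGroup A] [Module R A]
    (h : #A ≤ #Λ) : ∃ K : Submodule R (Λ →₀ R), Nonempty (((Λ →₀ R) ⧸ K) ≃ₗ[R] A) := by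
  obtain ⟨e⟩ := h
  have hf : Surjective (Finsupp.linearCombination R (invFun e)) := fun a ↦ by
    obtain ⟨k, rfl⟩ := invFun_surjective e.injective a
    exact ⟨Finsupp.single k 1, by simp⟩
  exact ⟨_, ⟨LinearMap.quotKerEquivOfSurjective _ hf⟩⟩

namespace LinearMap.LiftsSurjections

variable {S A B C : Type u} [Ring S] [AddCommGroup A] [Module S A] [AddCommGroup B] [Module S B]
  [AddCommGroup C] [Module S C]

theorem of_equiv (e : A ≃ₗ[S] B) : (e : A →ₗ[S] B).LiftsSurjections := fun _ _ _ _ u v h ↦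
  ⟨u ∘ₗ e.symm, by ext; simp, by rw [← LinearMap.comp_assoc, h]; ext; simp⟩

theorem comp {f : A →ₗ[S] B} {g : B →ₗ[S] C} (hg : g.LiftsSurjections)
    (hf : f.LiftsSurjections) : (g ∘ₗ f).LiftsSurjections := fun X Y p hp u v h ↦ by
  obtain ⟨w, rfl, hw⟩ := hf X Y p hp u (v ∘ₗ g) h
  obtain ⟨w', rfl, hw'⟩ := hg X Y p hp w v hw
  exact ⟨w', rfl, hw'⟩

end LinearMap.LiftsSurjections

variable {R S : Type u} [Ring R] [Ring S]

theorem exists_isGorensteinProjectiveModule_forall_factor {J : Type u} {A : J → ModuleCat.{u} R}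
    (hA : ∀ j, IsGorensteinProjectiveModule R (A j)) {N : ModuleCat.{u} R} (f : ∀ j, A j ⟶ N) :
    ∃ (Y : ModuleCat.{u} R) (p : Y ⟶ N), IsGorensteinProjectiveModule R Y ∧
      ∀ j, ∃ g : A j ⟶ Y, g ≫ p = f j := by
  classical
  refine ⟨.of R (Π₀ j, A j), ModuleCat.ofHom (DFinsupp.lsum ℕ fun j ↦ (f j).hom), .dfinsupp hA,
    fun j ↦ ⟨ModuleCat.ofHom (DFinsupp.lsingle (R := R) (M := fun j ↦ A j) j), ?_⟩⟩
  ext x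
  simp

namespace FrobeniusPair

variable {F : ModuleCat.{u} R ⥤ ModuleCat.{u} S} {G : ModuleCat.{u} S ⥤ ModuleCat.{u} R}
  (φ : FrobeniusPair F G)

include φ

/-- Any module `N` is the target of a map from a Gorenstein projective module which is a
precover as far as modules of bounded cardinality can see. -/
theorem exists_precover_mk_le (Λ : Type u) (N : ModuleCat.{u} R) :
    ∃ (Y : ModuleCat.{u} R) (p : Y ⟶ N), IsGorensteinProjectiveModule R Y ∧
      (∀ {A B : ModuleCat.{u} R} (f : A ⟶ B), #A ≤ #Λ → #B ≤ #Λ →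
        (F.map f).hom.LiftsSurjections → HasLiftingProperty f p) ∧
      ∀ Z : ModuleCat.{u} R, #Z ≤ #Λ → IsGorensteinProjectiveModule R Z → ∀ f : Z ⟶ N,
        ∃ g : Z ⟶ Y, g ≫ p = f := by
  let Q (K : Submodule R (Λ →₀ R)) : ModuleCat.{u} R := .of R ((Λ →₀ R) ⧸ K)
  let I := {x : Σ K L : Submodule R (Λ →₀ R), Q K ⟶ Q L //
    (F.map x.2.2).hom.LiftsSurjections}
  let J := {x : Σ K : Submodule R (Λ →₀ R), Q K ⟶ N // IsGorensteinProjectiveModule R (Q x.1)}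
  obtain ⟨Y₀, p₀, hY₀, hp₀⟩ :=
    exists_isGorensteinProjectiveModule_forall_factor (fun j : J ↦ j.2) fun j ↦ j.1.2
  obtain ⟨Y, c, p, hcp, hc, hp⟩ := φ.exists_factorization_rlp (fun x : I ↦ x.1.2.2)
    (fun x ↦ x.2) p₀
  refine ⟨Y, p, φ.isGorensteinProjectiveModule_of_right
    (hc.isGorensteinProjectiveModule (φ.isGorensteinProjectiveModule_right hY₀)), ?_, ?_⟩
  · intro A B f hA hB hf
    obtain ⟨K, ⟨e⟩⟩ := exists_quotient_equiv_of_mk_le (R := R) hA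
    obtain ⟨L, ⟨e'⟩⟩ := exists_quotient_equiv_of_mk_le (R := R) hB
    let e : Q K ≅ A := e.toModuleIso
    let e' : Q L ≅ B := e'.toModuleIso
    have hf' : (F.map (e.hom ≫ f ≫ e'.inv)).hom.LiftsSurjections := by
      rw [F.map_comp, F.map_comp]
      exact ((LinearMap.LiftsSurjections.of_equiv (F.mapIso e'.symm).toLinearEquiv).comp hf).comp
        (.of_equiv (F.mapIso e).toLinearEquiv)
    have := hp ⟨⟨K, L, e.hom ≫ f ≫ e'.inv⟩, hf'⟩
    exact HasLiftingProperty.of_arrow_iso_left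
      (Arrow.isoMk e e' : Arrow.mk (e.hom ≫ f ≫ e'.inv) ≅ Arrow.mk f) p
  · intro Z hZ hZ' f
    obtain ⟨K, ⟨e⟩⟩ := exists_quotient_equiv_of_mk_le (R := R) hZ
    let j : J := ⟨⟨K, ModuleCat.ofHom (f.hom ∘ₗ e)⟩, hZ'.of_equiv e.symm⟩
    obtain ⟨g, hg⟩ := hp₀ j
    refine ⟨ModuleCat.ofHom e.symm.toLinearMap ≫ g ≫ c, ?_⟩
    rw [Category.assoc, Category.assoc, hcp, hg]
    ext x
    simp [j]

end FrobeniusPair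

variable (ι : S →+* R)

/-- An `R`-submodule of `M`, regarded as an `S`-submodule of the restriction of scalars of `M`
along `ι : S →+* R`. -/
def ModuleCat.restrictSubmodule {M : ModuleCat.{u} R} (L : Submodule R M) :
    Submodule S ((ModuleCat.restrictScalars ι).obj M) where
  carrier := (L : Set M)
  add_mem' := L.add_mem
  zero_mem' := L.zero_mem
  smul_mem' s _ hx := L.smul_mem (ι s) hx

variable {ι}

/-- The submodule underlying `ModuleCat.restrictSubmodule ι L` is the restriction of scalars of
`L`. -/
def ModuleCat.restrictSubmoduleEquiv {M : ModuleCat.{u} R} (L : Submodule R M) :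
    ModuleCat.restrictSubmodule ι L ≃ₗ[S] (ModuleCat.restrictScalars ι).obj (.of R L) where
  toFun x := (⟨x.1, x.2⟩ : L)
  invFun x := ⟨x.1, x.2⟩
  map_add' _ _ := rfl
  map_smul' _ _ := rfl
  left_inv _ := rfl
  right_inv _ := rfl

theorem ModuleCat.restrictSubmodule_sup {M : ModuleCat.{u} R} (L L' : Submodule R M) :
    restrictSubmodule ι (L ⊔ L') = restrictSubmodule ι L ⊔ restrictSubmodule ι L' := by
  ext x
  exact (Submodule.mem_sup (p := L) (p' := L')).trans
    (Submodule.mem_sup (p := restrictSubmodule ι L) (p' := restrictSubmodule ι L')).symm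

open ModuleCat

section

variable {T I : Type u} [AddCommGroup T] [Module S T] {M : ModuleCat.{u} R}
  {i : (restrictScalars ι).obj M →ₗ[S] T × (I →₀ S)}
  {r : T × (I →₀ S) →ₗ[S] (restrictScalars ι).obj M}

theorem exists_isSplitOn_mk_le {κ : Cardinal.{u}} (hκ : ℵ₀ ≤ κ) (hR : #R ≤ κ) (hT : #T ≤ κ)
    (m : M) : ∃ (L : Submodule R M) (J : Set I), IsSplitOn i r (restrictSubmodule ι L) J ∧
      #L ≤ κ ∧ m ∈ L := by
  let s : Set M := {m} ∪ Set.range fun t ↦ r (t, 0)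
  let f (x : M) : Set M := (fun k ↦ r (0, Finsupp.single k 1)) '' ((i x).2.support : Set I)
  have hs : #s ≤ κ := (mk_union_le _ _).trans
    (add_le_of_le hκ (by simpa using one_le_aleph0.trans hκ) (mk_range_le.trans hT))
  have hf (x) : #(f x) ≤ κ :=
    ((((i x).2.support.finite_toSet.image _).lt_aleph0).le).trans hκ
  obtain ⟨L, hsL, hfL, hL⟩ := exists_submodule_closed_mk_le hκ hR hs f hf
  refine ⟨L, _, .of_closed (fun t ↦ hsL (.inr ⟨t, rfl⟩)) fun x hx k hk ↦ ?_, hL, hsL (.inl rfl)⟩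
  exact hfL x hx ⟨k, hk, rfl⟩

theorem exists_lift_of_isSplitOn {G : ModuleCat.{u} S ⥤ ModuleCat.{u} R}
    (φ : FrobeniusPair (restrictScalars ι) G) (hri : r ∘ₗ i = .id)
    (hT : IsGorensteinProjectiveModule S T) {Λ : Type u} (hΛ : ℵ₀ ≤ #Λ) (hRΛ : #R ≤ #Λ)
    (hTΛ : #T ≤ #Λ) {Y N : ModuleCat.{u} R} (p : Y ⟶ N)
    (hp : ∀ {A B : ModuleCat.{u} R} (f : A ⟶ B), #A ≤ #Λ → #B ≤ #Λ →
      ((restrictScalars ι).map f).hom.LiftsSurjections → HasLiftingProperty f p)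
    (hp' : ∀ Z : ModuleCat.{u} R, #Z ≤ #Λ → IsGorensteinProjectiveModule R Z → ∀ f : Z ⟶ N,
        ∃ g : Z ⟶ Y, g ≫ p = f) (h : M ⟶ N) :
    ∃ t : M ⟶ Y, t ≫ p = h := by
  suffices ∃ t : M →ₗ[R] Y, p.hom ∘ₗ t = h.hom by
    obtain ⟨t, ht⟩ := this
    exact ⟨ModuleCat.ofHom t, ModuleCat.hom_ext ht⟩
  refine p.hom.exists_lift_of_good h.hom
    (Good := fun L (J : Set I) ↦ IsSplitOn i r (restrictSubmodule ι L) J)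
    (Small := fun L _ ↦ #L ≤ #Λ) (fun h h' ↦ h.inf h')
    (fun h h' ↦ by rw [restrictSubmodule_sup]; exact h.sup h')
    (fun h hJ _ hL hL' ↦ .of_directed h hJ hL hL')
    (exists_isSplitOn_mk_le hΛ hRΛ hTΛ) ?_ ?_
  · intro L J hL hLΛ
    obtain ⟨t, ht⟩ := hp' (.of R L) hLΛ (φ.isGorensteinProjectiveModule_of_right
      ((hL.isGorensteinProjectiveModule hri hT).of_equiv (restrictSubmoduleEquiv L)))
      (ModuleCat.ofHom (h.hom ∘ₗ L.subtype))
    exact ⟨t.hom, fun x ↦ congr(($ht).hom x)⟩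
  · intro L J L' J' hL hLΛ hL' hLL' hJ t ht
    have := hp (A := .of R L') (B := .of R L) (ModuleCat.ofHom (Submodule.inclusion hLL'))
      ((mk_le_mk_of_subset hLL').trans hLΛ) hLΛ
      (((LinearMap.LiftsSurjections.of_equiv (restrictSubmoduleEquiv (ι := ι) L)).comp
        (hL'.liftsSurjections hL hri hLL' hJ)).comp
        (.of_equiv (restrictSubmoduleEquiv (ι := ι) L').symm))
    have sq : CommSq (ModuleCat.ofHom t) (ModuleCat.ofHom (Submodule.inclusion hLL')) p
        (ModuleCat.ofHom (h.hom ∘ₗ L.subtype)) := ⟨ModuleCat.hom_ext (LinearMap.ext ht)⟩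
    refine ⟨sq.lift.hom, fun x y hxy ↦ ?_, fun x ↦ congr(($sq.fac_right).hom x)⟩
    obtain rfl : x = Submodule.inclusion hLL' y := Subtype.ext hxy
    exact congr(($sq.fac_left).hom y)

end

/-- If the restriction of scalars along `ι : S →+* R` and a functor `G` form a Frobenius pair, then
the existence of Gorenstein projective precovers ascends from `S` to `R`. -/
theorem exists_isGorensteinProjectivePrecover_of_frobeniusPair
    {G : ModuleCat.{u} S ⥤ ModuleCat.{u} R} (φ : FrobeniusPair (restrictScalars ι) G)
    (hS : ∀ N : ModuleCat.{u} S, ∃ (X : ModuleCat.{u} S) (p : X →ₗ[S] N),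
      IsGorensteinProjectivePrecover p) (N : ModuleCat.{u} R) :
    ∃ (Y : ModuleCat.{u} R) (p : Y ⟶ N), IsGorensteinProjectiveModule R Y ∧
      ∀ Z : ModuleCat.{u} R, IsGorensteinProjectiveModule R Z → ∀ f : Z ⟶ N,
        ∃ g : Z ⟶ Y, g ≫ p = f := by
  have special (N : ModuleCat.{u} S) : ∃ (K T : ModuleCat.{u} S) (k : K ⟶ T) (q : T ⟶ N),
      IsShortExact k.hom q.hom ∧ IsGorensteinProjectivePrecover q.hom ∧
      ∀ Y : ModuleCat.{u} S, IsGorensteinProjectiveModule S Y → ExtOrthogonal S Y K := by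
    obtain ⟨K, T, k, q, h⟩ := exists_special_precover hS N
    exact ⟨K, T, ModuleCat.ofHom k, ModuleCat.ofHom q, h⟩
  obtain ⟨K, T, k, q, hkq, hq, hK⟩ := special ((restrictScalars ι).obj N)
  let Λ : Type u := ℕ ⊕ R ⊕ T
  have hΛ : ℵ₀ ≤ #Λ := aleph0_le_mk_iff.2 inferInstance
  have hRΛ : #R ≤ #Λ := mk_le_of_injective (f := .inr ∘ .inl)
    (Sum.inr_injective.comp Sum.inl_injective)
  have hTΛ : #T ≤ #Λ := mk_le_of_injective (f := .inr ∘ .inr)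
    (Sum.inr_injective.comp Sum.inr_injective)
  obtain ⟨Y, p, hY, hp, hp'⟩ := φ.exists_precover_mk_le Λ N
  refine ⟨Y, p, hY, fun Z hZ f ↦ ?_⟩
  obtain ⟨M, c, h, I, i, r, rfl, hri⟩ := φ.exists_factorization hkq hq hK hZ f
  obtain ⟨t, rfl⟩ := exists_lift_of_isSplitOn φ hri hq.1 hΛ hRΛ hTΛ p hp hp' h
  exact ⟨c ≫ t, Category.assoc _ _ _⟩

end

end GorensteinProjective

/-- Let `S ⊆ R` be a separable Frobenius extension of rings, i.e. the restriction
functor `R-Mod ⥤ S-Mod` is a separable Frobenius functor (it has the induction functor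
as both a left and a right adjoint). If every left `S`-module has a Gorenstein
projective precover, then so does every left `R`-module. -/
theorem gp_precover_of_separable_frobenius_extension {S R : Type u} [Ring S] [Ring R]
    (ι : S →+* R) (hι : Function.Injective ι)
    (ind : ModuleCat.{u} S ⥤ ModuleCat.{u} R)
    (adj₁ : ind ⊣ ModuleCat.restrictScalars ι)
    (adj₂ : ModuleCat.restrictScalars ι ⊣ ind)
    (hsep : (ModuleCat.restrictScalars ι).Separable)
    (hS : ∀ M : ModuleCat.{u} S, ∃ (X : ModuleCat.{u} S) (φ : X ⟶ M),
      IsPrecover (IsGorensteinProjective (A := ModuleCat.{u} S)) φ) :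
    ∀ N : ModuleCat.{u} R, ∃ (Y : ModuleCat.{u} R) (φ : Y ⟶ N),
      IsPrecover (IsGorensteinProjective (A := ModuleCat.{u} R)) φ := by
  have hS' (M : ModuleCat.{u} S) : ∃ (X : ModuleCat.{u} S) (p : X →ₗ[S] M),
      IsGorensteinProjectivePrecover p := by
    obtain ⟨X, p, hp⟩ := hS M
    exact ⟨X, p.hom, hp.isGorensteinProjectivePrecover⟩
  exact exists_isGorensteinProjectivePrecover_of_frobeniusPair ⟨adj₁, adj₂, inferInstance⟩ hS'
end

section
/- Let S ⊆ R be a Frobenius extension of rings with R faithfully flat (or just the induction functor R ⊗_S − faithful). Then for every left S-module M, the Gorenstein projective dimension of M over S equals the Gorenstein projective dimension of R ⊗_S M over R. -/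
open CategoryTheory Limits

open CategoryTheory Limits in
/-- `gpdLE M n` says that the Gorenstein projective dimension of `M` is at most `n`. -/
def gpdLE {A : Type*} [Category A] [Abelian A] : A → ℕ → Prop
  | M, 0 => IsGorensteinProjective M
  | M, (n + 1) => ∃ (G : A) (f : G ⟶ M),
      Epi f ∧ IsGorensteinProjective G ∧ gpdLE (kernel f) n

section Relation

/-- A relation which can be continued in both directions admits a chain indexed by `ℤ`
through any given element. -/
lemma exists_int_chain {T : Type*} (r : T → T → Prop) (hr : ∀ x, ∃ y, r x y)
    (hl : ∀ x, ∃ y, r y x) (x : T) :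
    ∃ Z : ℤ → T, Z 0 = x ∧ ∀ n, r (Z n) (Z (n + 1)) := by
  choose next hnext using hr
  choose prev hprev using hl
  refine ⟨fun n => match n with
    | Int.ofNat k => next^[k] x
    | Int.negSucc k => prev^[k + 1] x, rfl, fun n => ?_⟩
  match n with
  | Int.ofNat k =>
    change r (next^[k] x) (next^[k + 1] x)
    rw [Function.iterate_succ_apply']
    exact hnext _
  | Int.negSucc 0 => exact hprev x
  | Int.negSucc (k + 1) =>
    change r (prev^[k + 1 + 1] x) (prev^[k + 1] x)
    rw [Function.iterate_succ_apply' prev (k + 1)]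
    exact hprev _

end Relation

section Extensions

variable {A : Type*} [Category* A] [Abelian A]

/-- `0 ⟶ X ⟶ Y ⟶ Z ⟶ 0` is a short exact sequence. -/
def IsSES {X Y Z : A} (i : X ⟶ Y) (p : Y ⟶ Z) : Prop :=
  ∃ w : i ≫ p = 0, (ShortComplex.mk i p w).ShortExact

/-- `Y` is an extension of `Z` by `X`. -/
def IsExtension (X Y Z : A) : Prop := ∃ (i : X ⟶ Y) (p : Y ⟶ Z), IsSES i p

namespace IsSES

lemma of_mono {X Y : A} (i : X ⟶ Y) [Mono i] : IsSES i (cokernel.π i) :=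
  ⟨by simp, .mk' (ShortComplex.exact_cokernel i) inferInstance inferInstance⟩

lemma of_epi {Y Z : A} (p : Y ⟶ Z) [Epi p] : IsSES (kernel.ι p) p :=
  ⟨by simp, .mk' (ShortComplex.exact_kernel p) inferInstance inferInstance⟩

variable {X Y Z : A} {i : X ⟶ Y} {p : Y ⟶ Z}

lemma mono (h : IsSES i p) : Mono i := h.2.mono_f

lemma epi (h : IsSES i p) : Epi p := h.2.epi_g

lemma zero (h : IsSES i p) : i ≫ p = 0 := h.1

lemma lift (h : IsSES i p) {W : A} (k : W ⟶ Y) (hk : k ≫ p = 0) : ∃ l, l ≫ i = k := by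
  have := h.mono
  exact ⟨h.2.exact.lift k hk, h.2.exact.lift_f k hk⟩

lemma desc (h : IsSES i p) {W : A} (k : Y ⟶ W) (hk : i ≫ k = 0) : ∃ l, p ≫ l = k := by
  have := h.epi
  exact ⟨h.2.exact.desc k hk, h.2.exact.g_desc k hk⟩

lemma congr {X' Y' Z' : A} {i' : X' ⟶ Y'} {p' : Y' ⟶ Z'} (h : IsSES i p) (e₁ : X ≅ X')
    (e₂ : Y ≅ Y') (e₃ : Z ≅ Z') (hi : e₁.hom ≫ i' = i ≫ e₂.hom)
    (hp : e₂.hom ≫ p' = p ≫ e₃.hom) : IsSES i' p' := by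
  have w : i' ≫ p' = 0 := by
    rw [← cancel_epi e₁.hom, reassoc_of% hi, hp, reassoc_of% h.zero]
    simp
  exact ⟨w, ShortComplex.shortExact_of_iso (ShortComplex.isoMk e₁ e₂ e₃ hi hp) h.2⟩

lemma isExtension (h : IsSES i p) : IsExtension X Y Z := ⟨i, p, h⟩

lemma nonempty_iso_kernel (h : IsSES i p) : Nonempty (X ≅ kernel p) :=
  have := h.mono
  ⟨h.2.fIsKernel.conePointUniqueUpToIso (limit.isLimit _)⟩

lemma nonempty_iso_cokernel (h : IsSES i p) : Nonempty (Z ≅ cokernel i) :=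
  have := h.epi
  ⟨h.2.gIsCokernel.coconePointUniqueUpToIso (colimit.isColimit _)⟩

end IsSES

namespace IsExtension

lemma congr {X Y Z X' Y' Z' : A} (h : IsExtension X Y Z) (e₁ : X ≅ X') (e₂ : Y ≅ Y')
    (e₃ : Z ≅ Z') : IsExtension X' Y' Z' := by
  obtain ⟨i, p, h⟩ := h
  exact ⟨e₁.inv ≫ i ≫ e₂.hom, e₂.inv ≫ p ≫ e₃.hom, h.congr e₁ e₂ e₃ (by simp) (by simp)⟩

lemma biprod (X Y : A) : IsExtension X (X ⊞ Y) Y :=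
  ⟨biprod.inl, biprod.snd, by simp,
    (ShortComplex.Splitting.ofHasBinaryBiproduct X Y).shortExact⟩

lemma biprod_right {X Y Z : A} (h : IsExtension X Y Z) (W : A) :
    IsExtension X (Y ⊞ W) (Z ⊞ W) := by
  obtain ⟨i, p, h⟩ := h
  have := h.mono
  have := h.epi
  have w : (i ≫ biprod.inl) ≫ biprod.map p (𝟙 W) = 0 := by simp [reassoc_of% h.zero]
  refine ⟨i ≫ biprod.inl, biprod.map p (𝟙 W), w, .mk' ?_ (mono_comp _ _) ?_⟩
  · refine ShortComplex.exact_of_f_is_kernel _ (KernelFork.IsLimit.ofι' _ _ fun k hk => ?_)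
    have h₁ : (k ≫ biprod.fst) ≫ p = 0 := by
      have := hk =≫ biprod.fst
      simpa using this
    have h₂ : k ≫ biprod.snd = 0 := by
      have := hk =≫ biprod.snd
      simpa using this
    have hl := h.lift _ h₁
    refine ⟨hl.choose, ?_⟩
    ext
    · simpa using hl.choose_spec
    · simp [h₂]
  · dsimp; infer_instance

lemma biprod_left {X Y Z : A} (h : IsExtension X Y Z) (W : A) :
    IsExtension (X ⊞ W) (Y ⊞ W) Z := by
  obtain ⟨i, p, h⟩ := h
  have := h.mono
  have := h.epi
  have w : biprod.map i (𝟙 W) ≫ biprod.fst ≫ p = 0 := by simp [h.zero]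
  refine ⟨biprod.map i (𝟙 W), biprod.fst ≫ p, w, .mk' ?_ ?_ (epi_comp _ _)⟩
  · refine ShortComplex.exact_of_g_is_cokernel _
      (CokernelCofork.IsColimit.ofπ' _ _ fun k hk => ?_)
    have h₁ : i ≫ biprod.inl ≫ k = 0 := by
      have := biprod.inl ≫= hk
      simpa using this
    have h₂ : biprod.inr ≫ k = 0 := by
      have := biprod.inr ≫= hk
      simpa using this
    have hl := h.desc _ h₁
    refine ⟨hl.choose, ?_⟩
    ext
    · simpa using hl.choose_spec
    · simp [h₂]
  · dsimp; infer_instance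

lemma nonempty_iso_biprod_of_projective {X Y Z : A} (h : IsExtension X Y Z) [Projective Z] :
    Nonempty (Y ≅ X ⊞ Z) := by
  obtain ⟨i, p, h⟩ := h
  have := h.mono
  have := h.epi
  exact ⟨(ShortComplex.Splitting.ofExactOfSection _ h.2.exact (Projective.factorThru (𝟙 Z) p)
    (by simp) h.2.mono_f).isoBinaryBiproduct⟩

lemma nonempty_iso_biprod_of_retraction {X Y Z : A} {i : X ⟶ Y} {p : Y ⟶ Z} (h : IsSES i p)
    (r : Y ⟶ X) (hr : i ≫ r = 𝟙 X) : Nonempty (Y ≅ X ⊞ Z) :=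
  ⟨(ShortComplex.Splitting.ofExactOfRetraction _ h.2.exact r hr h.2.epi_g).isoBinaryBiproduct⟩

lemma comp_mono {X Y Z B C : A} (h : IsExtension X Y B) (h' : IsExtension Y Z C) :
    ∃ D, IsExtension X Z D ∧ IsExtension B D C := by
  obtain ⟨i, p, h⟩ := h
  obtain ⟨j, q, h'⟩ := h'
  have := h.mono
  have := h'.mono
  obtain ⟨e⟩ := h.nonempty_iso_cokernel
  obtain ⟨e'⟩ := h'.nonempty_iso_cokernel
  have hex := kernelCokernelCompSequence_exact i j
  have hD : IsExtension (cokernel i) (cokernel (i ≫ j)) (cokernel j) := by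
    have hm := (hex.exact 2).mono_g
      ((isZero_kernel_of_mono j).eq_of_src _ _)
    have he : Epi ((kernelCokernelCompSequence i j).map' 4 5) := inferInstance
    exact ⟨_, _, _, .mk' (hex.exact 3) hm he⟩
  exact ⟨_, (IsSES.of_mono (i ≫ j)).isExtension, hD.congr e.symm (Iso.refl _) e'.symm⟩

lemma comp_epi {X Y Z B C : A} (h : IsExtension B X Y) (h' : IsExtension C Y Z) :
    ∃ D, IsExtension D X Z ∧ IsExtension B D C := by
  obtain ⟨i, p, h⟩ := h
  obtain ⟨j, q, h'⟩ := h'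
  have := h.epi
  have := h'.epi
  obtain ⟨e⟩ := h.nonempty_iso_kernel
  obtain ⟨e'⟩ := h'.nonempty_iso_kernel
  have hex := kernelCokernelCompSequence_exact p q
  have hD : IsExtension (kernel p) (kernel (p ≫ q)) (kernel q) := by
    have he := (hex.exact 1).epi_f
      ((isZero_cokernel_of_epi p).eq_of_tgt _ _)
    have hm : Mono ((kernelCokernelCompSequence p q).map' 0 1) := inferInstance
    exact ⟨_, _, _, .mk' (hex.exact 0) hm he⟩
  exact ⟨_, (IsSES.of_epi (p ≫ q)).isExtension, hD.congr e.symm (Iso.refl _) e'.symm⟩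

lemma pullback {K W G Y U : A} (h : IsExtension K W G) (h' : IsExtension Y U G) :
    ∃ V, IsExtension Y V W ∧ IsExtension K V U := by
  obtain ⟨i, p, h⟩ := h
  obtain ⟨j, q, h'⟩ := h'
  have := h.epi
  have := h'.epi
  obtain ⟨e⟩ := h.nonempty_iso_kernel
  obtain ⟨e'⟩ := h'.nonempty_iso_kernel
  have sq := IsPullback.of_hasPullback p q
  have := isIso_kernel_map_of_isPullback sq
  have := isIso_kernel_map_of_isPullback sq.flip
  refine ⟨_, (IsSES.of_epi (pullback.fst p q)).isExtension.congr ?_ (Iso.refl _) (Iso.refl _),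
    (IsSES.of_epi (pullback.snd p q)).isExtension.congr ?_ (Iso.refl _) (Iso.refl _)⟩
  · exact asIso (kernel.map _ _ _ _ sq.w) ≪≫ e'.symm
  · exact asIso (kernel.map _ _ _ _ sq.flip.w) ≪≫ e.symm

lemma pushout {X P Y P' Y' : A} (h : IsExtension X P Y) (h' : IsExtension X P' Y') :
    ∃ V, IsExtension P V Y' ∧ IsExtension P' V Y := by
  obtain ⟨i, p, h⟩ := h
  obtain ⟨j, q, h'⟩ := h'
  have := h.mono
  have := h'.mono
  obtain ⟨e⟩ := h.nonempty_iso_cokernel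
  obtain ⟨e'⟩ := h'.nonempty_iso_cokernel
  have sq := IsPushout.of_hasPushout i j
  have := isIso_cokernel_map_of_isPushout sq
  have := isIso_cokernel_map_of_isPushout sq.flip
  refine ⟨_, (IsSES.of_mono (pushout.inl i j)).isExtension.congr (Iso.refl _) (Iso.refl _) ?_,
    (IsSES.of_mono (pushout.inr i j)).isExtension.congr (Iso.refl _) (Iso.refl _) ?_⟩
  · exact (asIso (cokernel.map _ _ _ _ sq.flip.w)).symm ≪≫ e'.symm
  · exact (asIso (cokernel.map _ _ _ _ sq.w)).symm ≪≫ e.symm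

end IsExtension

end Extensions

section Gorenstein

open Abelian

universe v w

variable {A : Type w} [Category.{v} A] [Abelian A]

namespace IsGorensteinProjective

lemma congr {X Y : A} (h : IsGorensteinProjective X) (e : X ≅ Y) :
    IsGorensteinProjective Y := by
  obtain ⟨P, h₁, h₂, ⟨e'⟩, h₃⟩ := h
  exact ⟨P, h₁, h₂, ⟨e.symm ≪≫ e'⟩, h₃⟩

/-- Splicing short exact sequences with projective middle terms, which remain exact under
maps to projective objects, gives a Gorenstein projective object. -/
lemma of_int_chain (Z P : ℤ → A) (i : ∀ n, Z n ⟶ P n) (p : ∀ n, P n ⟶ Z (n + 1))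
    (h : ∀ n, IsSES (i n) (p n)) (hP : ∀ n, Projective (P n))
    (hi : ∀ n (Q : A), Projective Q → ∀ f : Z n ⟶ Q, ∃ g, i n ≫ g = f) :
    IsGorensteinProjective (Z 0) := by
  have hd : ∀ n, (p n ≫ i (n + 1)) ≫ p (n + 1) ≫ i (n + 1 + 1) = 0 := fun n => by
    simp [reassoc_of% (h (n + 1)).zero]
  let K : CochainComplex A ℤ := CochainComplex.of P (fun n => p n ≫ i (n + 1)) hd
  have hK : ∀ n, K.d n (n + 1) = p n ≫ i (n + 1) := fun n =>
    CochainComplex.of_d P (fun n => p n ≫ i (n + 1)) n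
  have hker : ∀ n, ∃ w, Nonempty (IsLimit (KernelFork.ofι (f := K.d n (n + 1)) (i n) w)) := by
    intro n
    have := (h n).mono
    have := (h (n + 1)).mono
    refine ⟨by rw [hK, reassoc_of% (h n).zero, zero_comp], ⟨KernelFork.IsLimit.ofι' _ _
      fun k hk => ?_⟩⟩
    have hl := (h n).lift k (zero_of_comp_mono (i (n + 1)) (by rwa [hK, ← Category.assoc] at hk))
    exact ⟨hl.choose, hl.choose_spec⟩
  refine ⟨K, hP, fun n => ?_, ?_, fun Q hQ n f hf => ?_⟩
  · obtain ⟨m, rfl⟩ : ∃ m, n = m + 1 := ⟨n - 1, by simp⟩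
    rw [K.exactAt_iff' m (m + 1) (m + 1 + 1) (by simp) (by simp)]
    have := (h m).epi
    obtain ⟨w, ⟨hw⟩⟩ := hker (m + 1)
    rw [ShortComplex.exact_iff_exact_up_to_refinements]
    intro T x hx
    obtain ⟨l, hl⟩ := KernelFork.IsLimit.lift' hw x hx
    obtain ⟨T', π, hπ, y, hy⟩ := surjective_up_to_refinements_of_epi (p m) l
    refine ⟨T', π, hπ, y, ?_⟩
    change π ≫ x = y ≫ K.d m (m + 1)
    rw [hK, ← hl, ← reassoc_of% hy]
    rfl
  · obtain ⟨w, ⟨hw⟩⟩ := hker 0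
    exact ⟨hw.conePointUniqueUpToIso (K.cyclesIsKernel 0 1 (by simp))⟩
  · obtain ⟨m, rfl⟩ : ∃ m, n = m + 1 := ⟨n - 1, by simp⟩
    have := (h m).epi
    have := (h (m + 1)).epi
    rw [show m + 1 - 1 = m by simp, hK, Category.assoc] at hf
    obtain ⟨l, hl⟩ := (h (m + 1)).desc f (zero_of_epi_comp _ hf)
    obtain ⟨g, hg⟩ := hi _ Q hQ l
    exact ⟨g, by rw [hK, Category.assoc, hg, hl]⟩

lemma exists_int_chain {X : A} (h : IsGorensteinProjective X) :
    ∃ (Z P : ℤ → A) (i : ∀ n, Z n ⟶ P n) (p : ∀ n, P n ⟶ Z (n + 1)),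
      (∀ n, IsSES (i n) (p n)) ∧ (∀ n, Projective (P n)) ∧
      (∀ n (Q : A), Projective Q → ∀ f : Z n ⟶ Q, ∃ g, i n ≫ g = f) ∧
      Nonempty (X ≅ Z 0) := by
  obtain ⟨K, h₁, h₂, h₃, h₄⟩ := h
  have hepi : ∀ n, Epi (K.toCycles n (n + 1)) := fun n =>
    Preadditive.epi_of_isZero_cokernel' _ (K.homologyIsCokernel n (n + 1) (by simp))
      (h₂ (n + 1)).isZero_homology
  refine ⟨fun n => K.cycles n, fun n => K.X n, fun n => K.iCycles n,
    fun n => K.toCycles n (n + 1), fun n => ?_, h₁, fun n Q hQ f => ?_, h₃⟩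
  · have w : K.iCycles n ≫ K.toCycles n (n + 1) = 0 := by
      rw [← cancel_mono (K.iCycles (n + 1))]; simp
    refine ⟨w, .mk' (ShortComplex.exact_of_f_is_kernel _
      (KernelFork.IsLimit.ofι' _ _ fun k hk => ⟨K.liftCycles k (n + 1) (by simp) ?_, ?_⟩))
      (inferInstanceAs (Mono (K.iCycles n))) (hepi n)⟩
    · rw [← K.toCycles_i, reassoc_of% hk, zero_comp]
    · simp
  · obtain ⟨m, rfl⟩ : ∃ m, n = m + 1 := ⟨n - 1, by simp⟩
    have := hepi m
    have := hepi (m - 1)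
    obtain ⟨g, hg⟩ := h₄ Q hQ m (K.toCycles m (m + 1) ≫ f) (by
      rw [← Category.assoc]
      convert zero_comp
      rw [← cancel_mono (K.iCycles (m + 1))]
      simp)
    refine ⟨g, ?_⟩
    rw [← cancel_epi (K.toCycles m (m + 1)), ← hg]
    simp

end IsGorensteinProjective

variable [HasExt.{v} A]

/-- `Ext¹(Y, Q)` vanishes for all projective objects `Q`. -/
def ExtProjectiveVanishing (Y : A) : Prop :=
  ∀ Q : A, Projective Q → ∀ e : Ext.{v} Y Q 1, e = 0

namespace ExtProjectiveVanishing

lemma of_projective (P : A) [Projective P] : ExtProjectiveVanishing P :=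
  fun _ _ e => Ext.eq_zero_of_projective e

lemma exists_extension {X Y Z Q : A} (hZ : ExtProjectiveVanishing Z) {i : X ⟶ Y} {p : Y ⟶ Z}
    (h : IsSES i p) (hQ : Projective Q) (f : X ⟶ Q) : ∃ g, i ≫ g = f := by
  obtain ⟨x, hx⟩ := Ext.contravariant_sequence_exact₁ h.2 Q (Ext.mk₀ f) (add_zero 1)
    (hZ Q hQ _)
  obtain ⟨g, rfl⟩ := (Ext.mk₀_bijective _ _).2 x
  refine ⟨g, (Ext.mk₀_bijective _ _).1 ?_⟩
  simpa using hx

lemma of_exists_extension {X P Y : A} [Projective P] {i : X ⟶ P} {p : P ⟶ Y} (h : IsSES i p)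
    (H : ∀ Q, Projective Q → ∀ f : X ⟶ Q, ∃ g, i ≫ g = f) : ExtProjectiveVanishing Y := by
  intro Q hQ e
  obtain ⟨x, rfl⟩ := Ext.contravariant_sequence_exact₃ h.2 Q e
    (of_projective P Q hQ _) (add_zero 1)
  obtain ⟨f, rfl⟩ := (Ext.mk₀_bijective _ _).2 x
  obtain ⟨g, rfl⟩ := H Q hQ f
  rw [← Ext.mk₀_comp_mk₀]
  exact h.2.extClass_comp_assoc _

lemma extension {X Y Z : A} (h : IsExtension X Y Z) (hX : ExtProjectiveVanishing X)
    (hZ : ExtProjectiveVanishing Z) : ExtProjectiveVanishing Y := by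
  obtain ⟨i, p, h⟩ := h
  intro Q hQ e
  obtain ⟨x, rfl⟩ := Ext.contravariant_sequence_exact₂ h.2 Q e (hX Q hQ _)
  rw [hZ Q hQ x, Ext.comp_zero]

lemma of_biprod {X Y : A} (h : ExtProjectiveVanishing (X ⊞ Y)) : ExtProjectiveVanishing X := by
  intro Q hQ e
  have h₀ := h Q hQ ((Ext.mk₀ (biprod.fst : X ⊞ Y ⟶ X)).comp e (zero_add 1))
  have h₁ := congrArg (fun t => (Ext.mk₀ (biprod.inl : X ⟶ X ⊞ Y)).comp t (zero_add 1)) h₀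
  simpa using h₁

lemma congr {X Y : A} (h : ExtProjectiveVanishing X) (e : X ≅ Y) :
    ExtProjectiveVanishing Y := by
  intro Q hQ x
  have h₀ := h Q hQ ((Ext.mk₀ e.hom).comp x (zero_add 1))
  have h₁ := congrArg (fun t => (Ext.mk₀ e.inv).comp t (zero_add 1)) h₀
  simpa using h₁

end ExtProjectiveVanishing

lemma IsExtension.nonempty_iso_biprod_of_vanishing {X Y Z : A} (h : IsExtension X Y Z)
    (hX : Projective X) (hZ : ExtProjectiveVanishing Z) : Nonempty (Y ≅ X ⊞ Z) := by
  obtain ⟨i, p, h⟩ := h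
  obtain ⟨r, hr⟩ := hZ.exists_extension h hX (𝟙 X)
  exact nonempty_iso_biprod_of_retraction h r hr

namespace IsGorensteinProjective

/-- A coinduction principle for Gorenstein projective objects. -/
lemma of_class (C : A → Prop) (hE : ∀ X, C X → ExtProjectiveVanishing X)
    (hr : ∀ X, C X → ∃ P Y, Projective P ∧ C Y ∧ IsExtension X P Y)
    (hl : ∀ X, C X → ∃ P Y, Projective P ∧ C Y ∧ IsExtension Y P X) {X : A} (hX : C X) :
    IsGorensteinProjective X := by
  obtain ⟨Z, hZ, h⟩ := _root_.exists_int_chain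
    (fun X Y : {X : A // C X} => ∃ P, Projective P ∧ IsExtension X.1 P Y.1)
    (fun X => by
      obtain ⟨P, Y, hP, hY, h⟩ := hr X.1 X.2
      exact ⟨⟨Y, hY⟩, P, hP, h⟩)
    (fun X => by
      obtain ⟨P, Y, hP, hY, h⟩ := hl X.1 X.2
      exact ⟨⟨Y, hY⟩, P, hP, h⟩) ⟨X, hX⟩
  choose P hP i p h using h
  have := of_int_chain (fun n => (Z n).1) P i p h hP
    (fun n Q hQ f => (hE _ (Z (n + 1)).2).exists_extension (h n) hQ f)
  simpa [hZ] using this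

lemma vanishing_and_exists {X : A} (h : IsGorensteinProjective X) :
    ExtProjectiveVanishing X ∧
    (∃ P Y, Projective P ∧ IsGorensteinProjective Y ∧ IsExtension X P Y) ∧
    (∃ P Y, Projective P ∧ IsGorensteinProjective Y ∧ IsExtension Y P X) := by
  obtain ⟨Z, P, i, p, h, hP, hi, ⟨e⟩⟩ := h.exists_int_chain
  have hE : ∀ n, ExtProjectiveVanishing (Z n) := fun n => by
    obtain ⟨m, rfl⟩ : ∃ m, n = m + 1 := ⟨n - 1, by simp⟩
    exact .of_exists_extension (h m) (hi m)
  have hGP : ∀ n, IsGorensteinProjective (Z n) := fun n => by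
    refine of_class (fun X => ∃ n, X = Z n) ?_ ?_ ?_ ⟨n, rfl⟩
    · rintro _ ⟨n, rfl⟩
      exact hE n
    · rintro _ ⟨n, rfl⟩
      exact ⟨P n, Z (n + 1), hP n, ⟨_, rfl⟩, (h n).isExtension⟩
    · rintro _ ⟨n, rfl⟩
      obtain ⟨m, rfl⟩ : ∃ m, n = m + 1 := ⟨n - 1, by simp⟩
      exact ⟨P m, Z m, hP m, ⟨_, rfl⟩, (h m).isExtension⟩
  refine ⟨(hE 0).congr e.symm, ⟨P 0, Z (0 + 1), hP 0, hGP _, ?_⟩,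
    ⟨P (-1), Z (-1), hP _, hGP _, ?_⟩⟩
  · exact (h 0).isExtension.congr e.symm (Iso.refl _) (Iso.refl _)
  · exact (h (-1)).isExtension.congr (Iso.refl _) (Iso.refl _) e.symm

lemma vanishing {X : A} (h : IsGorensteinProjective X) : ExtProjectiveVanishing X :=
  h.vanishing_and_exists.1

lemma of_projective (P : A) [hP : Projective P] : IsGorensteinProjective P := by
  refine of_class (fun X => Projective X) (fun X hX => .of_projective X) (fun X hX => ?_)
    (fun X hX => ?_) hP
  · exact ⟨X ⊞ X, X, inferInstance, hX, .biprod X X⟩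
  · exact ⟨X ⊞ X, X, inferInstance, hX, .biprod X X⟩

lemma extension {X Y Z : A} (h : IsExtension X Y Z) (hX : IsGorensteinProjective X)
    (hZ : IsGorensteinProjective Z) : IsGorensteinProjective Y := by
  refine of_class (fun V => ∃ X Z, IsExtension X V Z ∧ IsGorensteinProjective X ∧
    IsGorensteinProjective Z) ?_ ?_ ?_ ⟨X, Z, h, hX, hZ⟩
  · rintro V ⟨X, Z, h, hX, hZ⟩
    exact .extension h hX.vanishing hZ.vanishing
  · rintro V ⟨X, Z, h, hX, hZ⟩
    obtain ⟨-, ⟨P, X', hP, hX', h₁⟩, -⟩ := hX.vanishing_and_exists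
    obtain ⟨hE, ⟨P', Z', hP', hZ', h₂⟩, -⟩ := hZ.vanishing_and_exists
    obtain ⟨W, h₃, h₄⟩ := h₁.pushout h
    obtain ⟨e⟩ := h₃.nonempty_iso_biprod_of_vanishing hP hE
    obtain ⟨V', h₅, h₆⟩ := (h₄.congr (Iso.refl _) (e ≪≫ biprod.braiding _ _)
      (Iso.refl _)).comp_mono (h₂.biprod_left P)
    exact ⟨_, V', inferInstance, ⟨_, _, h₆, hX', hZ'⟩, h₅⟩
  · rintro V ⟨X, Z, h, hX, hZ⟩
    obtain ⟨-, -, P, X', hP, hX', h₁⟩ := hX.vanishing_and_exists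
    obtain ⟨-, -, P', Z', hP', hZ', h₂⟩ := hZ.vanishing_and_exists
    obtain ⟨W, h₃, h₄⟩ := h.pullback h₂
    obtain ⟨e⟩ := h₄.nonempty_iso_biprod_of_projective
    obtain ⟨V', h₅, h₆⟩ := (h₁.biprod_right P').comp_epi
      (h₃.congr (Iso.refl _) e (Iso.refl _))
    exact ⟨_, V', inferInstance, ⟨_, _, h₆, hX', hZ'⟩, h₅⟩

lemma biprod {X Y : A} (hX : IsGorensteinProjective X) (hY : IsGorensteinProjective Y) :
    IsGorensteinProjective (X ⊞ Y) :=
  extension (.biprod X Y) hX hY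

lemma of_biprod_projective {X P : A} [hP : Projective P]
    (h : IsGorensteinProjective (X ⊞ P)) : IsGorensteinProjective X := by
  have hC : ∀ X : A, IsGorensteinProjective X → ∃ P, Projective P ∧
      IsGorensteinProjective (X ⊞ P) := fun X hX => by
    obtain ⟨-, ⟨P, _, hP, -⟩, -⟩ := hX.vanishing_and_exists
    exact ⟨P, hP, hX.biprod (of_projective P)⟩
  refine of_class (fun X => ∃ P, Projective P ∧ IsGorensteinProjective (X ⊞ P)) ?_ ?_ ?_
    ⟨P, hP, h⟩
  · rintro X ⟨P, hP, h⟩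
    exact h.vanishing.of_biprod
  · rintro X ⟨P, hP, h⟩
    obtain ⟨-, ⟨P', Y, hP', hY, h₁⟩, -⟩ := h.vanishing_and_exists
    obtain ⟨D, h₂, h₃⟩ := (IsExtension.biprod X P).comp_mono h₁
    exact ⟨P', D, hP', hC _ (extension h₃ (of_projective P) hY), h₂⟩
  · rintro X ⟨P, hP, h⟩
    obtain ⟨-, -, P', Y, hP', hY, h₁⟩ := h.vanishing_and_exists
    obtain ⟨D, h₂, h₃⟩ := h₁.comp_epi
      ((IsExtension.biprod P X).congr (Iso.refl _) (biprod.braiding _ _) (Iso.refl _))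
    exact ⟨P', D, hP', hC _ (extension h₃ hY (of_projective P)), h₂⟩

lemma of_epi {K W G : A} (h : IsExtension K W G) (hW : IsGorensteinProjective W)
    (hG : IsGorensteinProjective G) : IsGorensteinProjective K := by
  obtain ⟨-, -, P, Y, hP, hY, h₁⟩ := hG.vanishing_and_exists
  obtain ⟨V, h₂, h₃⟩ := h.pullback h₁
  obtain ⟨e⟩ := h₃.nonempty_iso_biprod_of_projective
  exact of_biprod_projective ((extension h₂ hY hW).congr e)

lemma of_mono {X P Y : A} (h : IsExtension X P Y) (hP : Projective P)
    (hX : IsGorensteinProjective X) (hY : ExtProjectiveVanishing Y) :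
    IsGorensteinProjective Y := by
  obtain ⟨-, ⟨P', Y', hP', hY', h₁⟩, -⟩ := hX.vanishing_and_exists
  obtain ⟨V, h₂, h₃⟩ := h.pushout h₁
  obtain ⟨e⟩ := h₃.nonempty_iso_biprod_of_vanishing hP' hY
  exact of_biprod_projective
    ((extension h₂ (of_projective P) hY').congr (e ≪≫ biprod.braiding _ _))

end IsGorensteinProjective

end Gorenstein

section Frobenius

open Abelian

universe v w w'

variable {A : Type w} [Category.{v} A] {B : Type w'} [Category.{v} B]
  {F : A ⥤ B} {G : B ⥤ A}

lemma CategoryTheory.Adjunction.preserves_projective (adj₁ : F ⊣ G) (adj₂ : G ⊣ F) {P : A}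
    (hP : Projective P) : Projective (F.obj P) := by
  have := adj₂.leftAdjoint_preservesColimits
  exact adj₁.map_projective P hP

lemma exists_extension_along_map (adj₁ : F ⊣ G) (adj₂ : G ⊣ F) {X Y : A} (i : X ⟶ Y)
    (h : ∀ Q, Projective Q → ∀ f : X ⟶ Q, ∃ g, i ≫ g = f) (Q : B) (hQ : Projective Q)
    (f : F.obj X ⟶ Q) : ∃ g, F.map i ≫ g = f := by
  obtain ⟨g, hg⟩ := h _ (adj₂.preserves_projective adj₁ hQ) (adj₁.homEquiv _ _ f)
  refine ⟨(adj₁.homEquiv _ _).symm g, ?_⟩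
  rw [← Adjunction.homEquiv_naturality_left_symm, hg, Equiv.symm_apply_apply]

lemma exists_extension_of_map [F.Faithful] (adj₁ : F ⊣ G) (adj₂ : G ⊣ F) {X Y : A} (i : X ⟶ Y)
    (h : ∀ Q, Projective Q → ∀ f : F.obj X ⟶ Q, ∃ g, F.map i ≫ g = f) (Q : A)
    (hQ : Projective Q) (f : X ⟶ Q) : ∃ g, i ≫ g = f := by
  have := adj₂.counit_epi_of_R_faithful
  let s : Q ⟶ G.obj (F.obj Q) := Projective.factorThru (𝟙 Q) (adj₂.counit.app Q)
  have hs : s ≫ adj₂.counit.app Q = 𝟙 Q := Projective.factorThru_comp _ _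
  obtain ⟨t, ht⟩ := h _ (adj₁.preserves_projective adj₂ hQ) ((adj₁.homEquiv _ _).symm (f ≫ s))
  refine ⟨adj₁.homEquiv _ _ t ≫ adj₂.counit.app Q, ?_⟩
  rw [← Category.assoc, ← Adjunction.homEquiv_naturality_left, ht, Equiv.apply_symm_apply,
    Category.assoc, hs, Category.comp_id]

variable [Abelian A] [Abelian B]

lemma IsSES.map {X Y Z : A} {i : X ⟶ Y} {p : Y ⟶ Z} (h : IsSES i p) (adj₁ : F ⊣ G)
    (adj₂ : G ⊣ F) : IsSES (F.map i) (F.map p) := by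
  have := adj₁.leftAdjoint_preservesColimits
  have := adj₂.rightAdjoint_preservesLimits
  have := Functor.preservesZeroMorphisms_of_preserves_initial_object (F := F)
  exact ⟨by rw [← F.map_comp, h.zero, F.map_zero], h.2.map_of_exact F⟩

lemma IsExtension.map {X Y Z : A} (h : IsExtension X Y Z) (adj₁ : F ⊣ G)
    (adj₂ : G ⊣ F) : IsExtension (F.obj X) (F.obj Y) (F.obj Z) := by
  obtain ⟨i, p, h⟩ := h
  exact ⟨_, _, h.map adj₁ adj₂⟩

variable [HasExt.{v} A] [HasExt.{v} B]

lemma IsSES.vanishing_map {X P Y : A} [Projective P] {i : X ⟶ P} {p : P ⟶ Y} (h : IsSES i p)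
    (hY : ExtProjectiveVanishing Y) (adj₁ : F ⊣ G) (adj₂ : G ⊣ F) :
    ExtProjectiveVanishing (F.obj Y) := by
  have := adj₁.preserves_projective adj₂ ‹Projective P›
  exact .of_exists_extension (h.map adj₁ adj₂)
    (exists_extension_along_map adj₁ adj₂ _ fun Q hQ f => hY.exists_extension h hQ f)

lemma IsGorensteinProjective.map (adj₁ : F ⊣ G) (adj₂ : G ⊣ F) {X : A}
    (hX : IsGorensteinProjective X) : IsGorensteinProjective (F.obj X) := by
  refine of_class (fun Y => ∃ X, IsGorensteinProjective X ∧ Y = F.obj X) ?_ ?_ ?_ ⟨X, hX, rfl⟩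
  · rintro _ ⟨X, hX, rfl⟩
    obtain ⟨hE, -, P, Y, hP, -, i, p, h⟩ := hX.vanishing_and_exists
    exact h.vanishing_map hE adj₁ adj₂
  · rintro _ ⟨X, hX, rfl⟩
    obtain ⟨-, ⟨P, Y, hP, hY, h⟩, -⟩ := hX.vanishing_and_exists
    exact ⟨_, _, adj₁.preserves_projective adj₂ hP, ⟨Y, hY, rfl⟩, h.map adj₁ adj₂⟩
  · rintro _ ⟨X, hX, rfl⟩
    obtain ⟨-, -, P, Y, hP, hY, h⟩ := hX.vanishing_and_exists
    exact ⟨_, _, adj₁.preserves_projective adj₂ hP, ⟨Y, hY, rfl⟩, h.map adj₁ adj₂⟩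

variable [EnoughProjectives A]

lemma ExtProjectiveVanishing.of_map [F.Faithful] (adj₁ : F ⊣ G) (adj₂ : G ⊣ F) {X : A}
    (hX : ExtProjectiveVanishing (F.obj X)) : ExtProjectiveVanishing X := by
  have h := IsSES.of_epi (Projective.π X)
  exact of_exists_extension h (exists_extension_of_map adj₁ adj₂ _
    fun Q hQ f => hX.exists_extension (h.map adj₁ adj₂) hQ f)

lemma IsGorensteinProjective.of_map [F.Faithful] (adj₁ : F ⊣ G) (adj₂ : G ⊣ F) {X : A}
    (hX : IsGorensteinProjective (F.obj X)) : IsGorensteinProjective X := by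
  refine of_class (fun X => IsGorensteinProjective (F.obj X)) ?_ ?_ ?_ hX
  · intro X hX
    exact hX.vanishing.of_map adj₁ adj₂
  · intro X hX
    obtain ⟨-, ⟨P, Y, hP, hY, u, p, h⟩, -⟩ := hX.vanishing_and_exists
    let j : X ⟶ G.obj P := adj₁.homEquiv _ _ u
    have hj : F.map j ≫ adj₁.counit.app P = u :=
      (adj₁.homEquiv_counit _ _ _).symm.trans (Equiv.symm_apply_apply _ _)
    have hu := h.mono
    have : Mono (F.map j) := mono_of_mono_fac hj
    have : Mono j := F.mono_of_mono_map this
    have hGP := adj₂.preserves_projective adj₁ hP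
    have hses := IsSES.of_mono j
    have hC : ExtProjectiveVanishing (cokernel j) := .of_exists_extension hses
      (exists_extension_of_map adj₁ adj₂ j fun Q hQ f => by
        obtain ⟨g, hg⟩ := hY.vanishing.exists_extension h hQ f
        exact ⟨adj₁.counit.app P ≫ g, by rw [reassoc_of% hj, hg]⟩)
    exact ⟨G.obj P, cokernel j, hGP,
      of_mono (hses.map adj₁ adj₂).isExtension (adj₁.preserves_projective adj₂ hGP) hX
        (hses.vanishing_map hC adj₁ adj₂), hses.isExtension⟩
  · intro X hX
    have h := IsSES.of_epi (Projective.π X)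
    have hP := Projective.projective_over X
    have := adj₁.preserves_projective adj₂ hP
    exact ⟨_, _, hP, of_epi (h.map adj₁ adj₂).isExtension (of_projective _) hX, h.isExtension⟩

end Frobenius

section Dimension

open Abelian

universe v w w'

variable {A : Type w} [Category.{v} A] [Abelian A]

lemma gpdLE.congr {X Y : A} {n : ℕ} (h : gpdLE X n) (e : X ≅ Y) : gpdLE Y n := by
  induction n generalizing X Y with
  | zero => exact IsGorensteinProjective.congr h e
  | succ n ih =>
    obtain ⟨G, f, hf, hG, h⟩ := h
    exact ⟨G, f ≫ e.hom, epi_comp _ _, hG, ih h (kernelCompMono f e.hom).symm⟩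

lemma gpdLE_succ_iff {X : A} {n : ℕ} : gpdLE X (n + 1) ↔
    ∃ K G, IsExtension K G X ∧ IsGorensteinProjective G ∧ gpdLE K n := by
  constructor
  · rintro ⟨G, f, hf, hG, h⟩
    exact ⟨_, G, (IsSES.of_epi f).isExtension, hG, h⟩
  · rintro ⟨K, G, ⟨i, p, h⟩, hG, hK⟩
    obtain ⟨e⟩ := h.nonempty_iso_kernel
    exact ⟨G, p, h.epi, hG, hK.congr e⟩

variable [HasExt.{v} A]

namespace gpdLE

lemma biprod_projective {X P : A} [Projective P] {n : ℕ} (h : gpdLE X n) :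
    gpdLE (X ⊞ P) n := by
  cases n with
  | zero => exact IsGorensteinProjective.biprod h (.of_projective P)
  | succ n =>
    rw [gpdLE_succ_iff] at h ⊢
    obtain ⟨K, G, h, hG, hK⟩ := h
    exact ⟨K, G ⊞ P, h.biprod_right P, hG.biprod (.of_projective P), hK⟩

lemma of_epi {K W G : A} (h : IsExtension K W G) (hG : IsGorensteinProjective G) {n : ℕ}
    (hW : gpdLE W n) : gpdLE K n := by
  cases n with
  | zero => exact IsGorensteinProjective.of_epi h hW hG
  | succ n =>
    rw [gpdLE_succ_iff] at hW ⊢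
    obtain ⟨L, G', h', hG', hL⟩ := hW
    obtain ⟨D, h₁, h₂⟩ := h'.comp_epi h
    exact ⟨L, D, h₂, .of_epi h₁ hG' hG, hL⟩

lemma succ_iff_of_projective {K P X : A} [Projective P] (h : IsExtension K P X) {n : ℕ} :
    gpdLE X (n + 1) ↔ gpdLE K n := by
  rw [gpdLE_succ_iff]
  refine ⟨?_, fun hK => ⟨K, P, h, .of_projective P, hK⟩⟩
  rintro ⟨H, G, h', hG, hH⟩
  obtain ⟨V, h₁, h₂⟩ := h.pullback h'
  obtain ⟨e⟩ := h₁.nonempty_iso_biprod_of_projective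
  exact of_epi h₂ hG ((biprod_projective hH).congr e.symm)

end gpdLE

/-- A faithful functor which is part of a Frobenius pair preserves and reflects the
Gorenstein projective dimension. -/
lemma gpdLE_iff_map [EnoughProjectives A] {B : Type w'} [Category.{v} B] [Abelian B]
    [HasExt.{v} B] {F : A ⥤ B} {G : B ⥤ A} [F.Faithful] (adj₁ : F ⊣ G) (adj₂ : G ⊣ F)
    (X : A) (n : ℕ) : gpdLE X n ↔ gpdLE (F.obj X) n := by
  induction n generalizing X with
  | zero => exact ⟨.map adj₁ adj₂, .of_map adj₁ adj₂⟩
  | succ n ih =>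
    have h := (IsSES.of_epi (Projective.π X)).isExtension
    have hP := Projective.projective_over X
    have := adj₁.preserves_projective adj₂ hP
    rw [gpdLE.succ_iff_of_projective h, gpdLE.succ_iff_of_projective (h.map adj₁ adj₂), ih]

end Dimension

/-- Let `S ⊆ R` be a Frobenius extension of rings, so that the induction functor
`F = R ⊗_S −` and the restriction functor form a Frobenius pair, and assume `F` is
faithful. Then for every left `S`-module `M`, the Gorenstein projective dimension of
`M` over `S` equals that of `R ⊗_S M` over `R`. -/
theorem frobenius_extension_gpd_eq {S R : Type u} [Ring S] [Ring R]
    (ι : S →+* R) (hι : Function.Injective ι)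
    (F : ModuleCat.{u} S ⥤ ModuleCat.{u} R)
    (adj₁ : F ⊣ ModuleCat.restrictScalars ι)
    (adj₂ : ModuleCat.restrictScalars ι ⊣ F)
    [F.Faithful] (M : ModuleCat.{u} S) :
    ∀ n : ℕ, gpdLE M n ↔ gpdLE (F.obj M) n := by
  exact gpdLE_iff_map adj₁ adj₂ M
end

section
/- Let S be a commutative ring, G a finite group with |G| invertible in S, and R = S * G the skew group ring. If the class of Gorenstein projective S-modules is precovering in S-Mod, then the class of Gorenstein projective R-modules is precovering in R-Mod. -/
open CategoryTheory Limits

universe u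

section AmbidextrousAdjunction

variable {A B : Type*} [Category A] [Category B] [Abelian A] [Abelian B]

/-- A functor with a two-sided adjoint preserves Gorenstein projective objects. -/
theorem IsGorensteinProjective.map_of_ambidextrous {F : A ⥤ B} {H : B ⥤ A}
    (adj₁ : F ⊣ H) (adj₂ : H ⊣ F) {M : A} (hM : IsGorensteinProjective M) :
    IsGorensteinProjective (F.obj M) := by
  obtain ⟨P, hP, hex, ⟨e⟩, hlift⟩ := hM
  have := adj₁.leftAdjoint_preservesColimits
  have := adj₂.rightAdjoint_preservesLimits
  have := adj₁.rightAdjoint_preservesLimits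
  have := adj₂.leftAdjoint_preservesColimits
  have : F.Additive := Functor.additive_of_preserves_binary_products F
  have : F.PreservesHomology := inferInstance
  refine ⟨(F.mapHomologicalComplex _).obj P, fun n => adj₁.map_projective _ (hP n),
    fun n => (hex n).map F, ⟨F.mapIso e ≪≫ ((P.sc 0).mapCyclesIso F).symm⟩, ?_⟩
  intro Q hQ n (f : F.obj (P.X n) ⟶ Q) (hf : F.map (P.d (n - 1) n) ≫ f = 0)
  change ∃ g : F.obj (P.X (n + 1)) ⟶ Q, F.map (P.d n (n + 1)) ≫ g = f
  have hf' : P.d (n - 1) n ≫ adj₁.homEquiv _ _ f = 0 := by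
    rw [← adj₁.homEquiv_naturality_left, hf]
    simp [Adjunction.homEquiv_unit]
  obtain ⟨g, hg⟩ := hlift _ (adj₂.map_projective _ hQ) n _ hf'
  refine ⟨(adj₁.homEquiv _ _).symm g, ?_⟩
  rw [← adj₁.homEquiv_naturality_left_symm, hg, Equiv.symm_apply_apply]

/-- If `F` is both left and right adjoint to `H`, and the counit of `F ⊣ H` splits at every
object, then the existence of Gorenstein projective precovers passes from the source of `F`
to its target. -/
theorem exists_gorensteinProjective_precover_of_ambidextrous {F : A ⥤ B} {H : B ⥤ A}
    (adj₁ : F ⊣ H) (adj₂ : H ⊣ F) (hsplit : ∀ Y : B, IsSplitEpi (adj₁.counit.app Y))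
    (hA : ∀ M : A, ∃ (X : A) (φ : X ⟶ M), IsPrecover IsGorensteinProjective φ) (N : B) :
    ∃ (Y : B) (φ : Y ⟶ N), IsPrecover IsGorensteinProjective φ := by
  obtain ⟨X, φ, hX, hφ⟩ := hA (H.obj N)
  refine ⟨F.obj X, (adj₁.homEquiv _ _).symm φ, hX.map_of_ambidextrous adj₁ adj₂, ?_⟩
  intro Y hY f
  obtain ⟨g, hg⟩ := hφ _ (hY.map_of_ambidextrous adj₂ adj₁) (H.map f)
  have := hsplit Y
  refine ⟨section_ (adj₁.counit.app Y) ≫ F.map g, ?_⟩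
  rw [Category.assoc, ← adj₁.homEquiv_naturality_left_symm, hg, Adjunction.homEquiv_counit,
    adj₁.counit_naturality, IsSplitEpi.id_assoc]

end AmbidextrousAdjunction

section SkewGroupRing

open ModuleCat

variable {S R : Type u} [CommRing S] [Ring R] {G : Type u} [Group G]

/-- A property of elements of a skew group ring that is stable under addition and multiplication
holds everywhere if it holds for all `ι s` and all `u g`. -/
theorem skewGroupRing_induction (ι : S →+* R) (u : G →* Rˣ)
    (hbasis : ∀ r : R, ∃! c : G →₀ S, r = c.sum fun g s => ι s * (u g : R))
    {p : R → Prop} (hι : ∀ s, p (ι s)) (hu : ∀ g, p (u g : R))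
    (hadd : ∀ x y, p x → p y → p (x + y)) (hmul : ∀ x y, p x → p y → p (x * y)) (r : R) :
    p r := by
  obtain ⟨c, rfl, -⟩ := hbasis r
  exact Finset.sum_induction _ p hadd (by simpa using hι 0) fun g _ => hmul _ _ (hι _) (hu g)

theorem coextendScalars_apply_map_mul (ι : S →+* R) {X : ModuleCat.{u} S}
    (f : (coextendScalars ι).obj X) (s : S) (r : R) : f (ι s * r : R) = s • f r :=
  (CoextendScalars.equiv ι X f).map_smul s (show (restrictScalars ι).obj (of R R) from r)

theorem coextendScalars_apply_add (ι : S →+* R) {X : ModuleCat.{u} S}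
    (f : (coextendScalars ι).obj X) (r r' : R) : f (r + r' : R) = f r + f r' :=
  (CoextendScalars.equiv ι X f).map_add (show (restrictScalars ι).obj (of R R) from r) r'

variable [Fintype G] [MulSemiringAction G S]

/-- The coefficient at `1` is an `S`-bilinear form on a skew group ring, with respect to which
the bases `u g` and `u g⁻¹` are dual. -/
theorem exists_skewGroupRing_trace (ι : S →+* R) (u : G →* Rˣ)
    (hcomm : ∀ (g : G) (s : S), (u g : R) * ι s = ι (g • s) * (u g : R))
    (hbasis : ∀ r : R, ∃! c : G →₀ S, r = c.sum fun g s => ι s * (u g : R)) :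
    ∃ t : R →+ S, (∀ s r, t (ι s * r) = s * t r) ∧ (∀ r s, t (r * ι s) = t r * s) ∧ t 1 = 1 ∧
      (∀ g, g ≠ 1 → t (u g) = 0) ∧
      ∀ r, ∑ g, ι (t (r * u g)) * (u g⁻¹ : Rˣ) = r := by
  classical
  let e (r : R) : G →₀ S := (hbasis r).choose
  have he (r : R) : r = (e r).sum fun g s => ι s * (u g : R) := (hbasis r).choose_spec.1
  have hu (r : R) (c : G →₀ S) (h : r = c.sum fun g s => ι s * (u g : R)) : e r = c :=
    ((hbasis r).choose_spec.2 c h).symm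
  have hsum (c : G →₀ S) : (c.sum fun g s => ι s * (u g : R)) = ∑ g, ι (c g) * u g :=
    Finsupp.sum_fintype _ _ (by simp)
  simp only [hsum] at he hu
  have hadd (x y : R) : e (x + y) = e x + e y := hu _ _ (by
    conv_lhs => rw [he x, he y]
    simp [add_mul, Finset.sum_add_distrib])
  have hsmul (s : S) (r : R) : e (ι s * r) = s • e r := hu _ _ (by
    conv_lhs => rw [he r]
    simp [Finset.mul_sum, mul_assoc])
  have hone (g : G) : e (u g) = Finsupp.single g 1 := hu _ _ (by
    simp [Finsupp.single_apply, apply_ite ι, ite_mul])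
  let t : R →+ S := AddMonoidHom.mk' (fun r => e r 1) (fun x y => by simp [hadd])
  have hts (s : S) (r : R) : t (ι s * r) = s * t r := by simp [t, hsmul]
  have htu (g : G) : t (u g) = if g = 1 then 1 else 0 := by
    simp [t, hone, Finsupp.single_apply]
  have htr (r : R) (s : S) : t (r * ι s) = t r * s := by
    rw [he r]
    simp only [Finset.sum_mul, map_sum, mul_assoc, hcomm, hts, htu]
    simp
  refine ⟨t, hts, htr, by simpa using htu 1, fun g hg => by simp [htu, hg], fun r => ?_⟩
  have ht (g : G) : t (r * u g) = e r g⁻¹ := by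
    conv_lhs => rw [he r]
    simp only [Finset.sum_mul, mul_assoc, map_sum, hts, ← Units.val_mul, ← map_mul, htu,
      mul_eq_one_iff_eq_inv]
    simp
  simp only [ht]
  conv_rhs => rw [he r]
  exact Equiv.sum_comp (Equiv.inv G) fun g => ι (e r g) * (u g : R)

/-- The map `Hom_S(R, X) → N` induced by an `S`-linear map `h : X → N`, where `R` is a skew
group ring: it sends `f` to `∑ g, u g • h (f (u g⁻¹))`. -/
noncomputable def skewGroupRingExtend (ι : S →+* R) (u : G →* Rˣ)
    (hcomm : ∀ (g : G) (s : S), (u g : R) * ι s = ι (g • s) * (u g : R))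
    (hbasis : ∀ r : R, ∃! c : G →₀ S, r = c.sum fun g s => ι s * (u g : R))
    {X : ModuleCat.{u} S} {N : ModuleCat.{u} R} (h : X ⟶ (restrictScalars ι).obj N) :
    (coextendScalars ι).obj X ⟶ N :=
  let φ : (coextendScalars ι).obj X →+ N :=
    AddMonoidHom.mk' (fun f => ∑ g, (u g : R) • (show N from h (f ((u g⁻¹ : Rˣ) : R))))
      fun f f' => by
        rw [← Finset.sum_add_distrib]
        refine Finset.sum_congr rfl fun g _ => ?_
        rw [← smul_add]
        exact congrArg _ (h.hom.map_add _ _)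
  ofHom
  { φ with
    map_smul' r f := by
      change φ (r • f) = r • φ f
      revert f
      refine skewGroupRing_induction ι u hbasis (p := fun r => ∀ f, φ (r • f) = r • φ f)
        (fun s f => ?_) (fun k f => ?_)
        (fun x y hx hy f => ?_) (fun x y hx hy f => ?_) r
      · refine .trans ?_ Finset.smul_sum.symm
        refine Finset.sum_congr rfl fun g _ => ?_
        have h₁ : ((u g⁻¹ : Rˣ) : R) * ι s = ι (g⁻¹ • s) * ((u g⁻¹ : Rˣ) : R) := hcomm _ _
        rw [CoextendScalars.smul_apply, h₁, coextendScalars_apply_map_mul]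
        have h₂ (x : X) : (show N from h ((g⁻¹ • s) • x)) = ι (g⁻¹ • s) • (show N from h x) :=
          h.hom.map_smul _ _
        refine (congrArg _ (h₂ _)).trans ?_
        rw [smul_smul, hcomm, smul_inv_smul, mul_smul]
      · refine .trans ?_ Finset.smul_sum.symm
        refine (Equiv.sum_comp (Equiv.mulLeft k) _).symm.trans ?_
        refine Finset.sum_congr rfl fun g _ => ?_
        rw [CoextendScalars.smul_apply, smul_smul, ← Units.val_mul, ← Units.val_mul, ← map_mul,
          ← map_mul]
        simp
      · rw [add_smul, map_add, hx, hy, add_smul]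
      · rw [mul_smul, hx, hy, mul_smul] }

/-- For a skew group ring `R`, coinduction from `S` to `R` is left adjoint to restriction. -/
noncomputable def skewGroupRingCoextendRestrictAdj (ι : S →+* R) (u : G →* Rˣ)
    (hcomm : ∀ (g : G) (s : S), (u g : R) * ι s = ι (g • s) * (u g : R))
    (hbasis : ∀ r : R, ∃! c : G →₀ S, r = c.sum fun g s => ι s * (u g : R))
    (t : R →+ S) (ht : ∀ s r, t (ι s * r) = s * t r)
    (ht' : ∀ r s, t (r * ι s) = t r * s) (ht₁ : t 1 = 1)
    (htu : ∀ g, g ≠ 1 → t (u g) = 0) (hdual : ∀ r, ∑ g, ι (t (r * u g)) * (u g⁻¹ : Rˣ) = r) :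
    coextendScalars.{u, u, u} ι ⊣ restrictScalars.{u} ι :=
  Adjunction.mkOfUnitCounit
  { unit :=
    { app X := ofHom (Y := (restrictScalars ι).obj ((coextendScalars ι).obj X))
        { toFun x := (CoextendScalars.equiv ι X).symm
            { toFun := fun r : R => t r • x
              map_add' r r' := (congrArg (· • x) (t.map_add r r')).trans (add_smul _ _ _)
              map_smul' s r := (congrArg (· • x) (ht s r)).trans (mul_smul _ _ _) }
          map_add' x y := CoextendScalars.ext <| LinearMap.ext fun r : R => smul_add (t r) x y
          map_smul' s x := CoextendScalars.ext <| LinearMap.ext fun r : R => by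
            change t r • s • x = t (r * ι s) • x
            rw [ht', mul_smul] }
      naturality X Y f := by
        ext x
        refine CoextendScalars.ext <| LinearMap.ext fun r : R => ?_
        exact (f.hom.map_smul _ _).symm }
    counit :=
    { app N := skewGroupRingExtend ι u hcomm hbasis (𝟙 _)
      naturality N N' f := by
        ext k
        refine .trans ?_ (map_sum f.hom _ _).symm
        refine Finset.sum_congr rfl fun g _ => ?_
        exact (f.hom.map_smul _ _).symm }
    left_triangle := by
      ext X (f : (coextendScalars ι).obj X)
      refine CoextendScalars.ext <| LinearMap.ext fun r : R => ?_
      let ev : (coextendScalars ι).obj X →+ X := AddMonoidHom.mk' (fun k => k r) fun _ _ => rfl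
      let fr : R →+ X := AddMonoidHom.mk' (fun r => f r) (coextendScalars_apply_add ι f)
      refine (map_sum ev _ _).trans ?_
      change ∑ g, t (r * u g) • f ((u g⁻¹ : Rˣ) : R) = f r
      calc _ = ∑ g, fr (ι (t (r * u g)) * (u g⁻¹ : Rˣ)) :=
            Finset.sum_congr rfl fun g _ => (coextendScalars_apply_map_mul ι f _ _).symm
        _ = fr r := by rw [← map_sum, hdual]
    right_triangle := by
      ext N (n : N)
      change ∑ g, (u g : R) • (ι (t ((u g⁻¹ : Rˣ) : R)) • n) = n
      rw [Finset.sum_eq_single 1]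
      · simp [ht₁]
      · intro g _ hg
        rw [htu _ (inv_ne_one.mpr hg), map_zero, zero_smul, smul_zero]
      · simp }

/-- The counit of the adjunction between coinduction and restriction has a section at every
module when `|G|` is invertible: `n ↦ (r ↦ r • |G|⁻¹ • n)`. -/
theorem isSplitEpi_skewGroupRing_counit (hinv : IsUnit ((Fintype.card G : ℕ) : S)) (ι : S →+* R)
    (u : G →* Rˣ)
    (hcomm : ∀ (g : G) (s : S), (u g : R) * ι s = ι (g • s) * (u g : R))
    (hbasis : ∀ r : R, ∃! c : G →₀ S, r = c.sum fun g s => ι s * (u g : R))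
    (N : ModuleCat.{u} R) :
    IsSplitEpi (skewGroupRingExtend ι u hcomm hbasis (𝟙 ((restrictScalars ι).obj N))) := by
  obtain ⟨v, hv⟩ : IsUnit ((Fintype.card G : ℕ) : R) := by simpa using hinv.map ι
  have hvc (r : R) : Commute r (v⁻¹ : Rˣ) := by
    refine Commute.units_inv_right ?_
    rw [hv]
    exact Nat.commute_cast _ _
  refine ⟨⟨⟨(restrictCoextendScalarsAdj ι).unit.app N ≫ (coextendScalars ι).map
    (ofHom (X := (restrictScalars ι).obj N) (Y := (restrictScalars ι).obj N)
      { toFun n := ((v⁻¹ : Rˣ) : R) • (show N from n)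
        map_add' x y := smul_add ((v⁻¹ : Rˣ) : R) (show N from x) y
        map_smul' s x := by
          change ((v⁻¹ : Rˣ) : R) • ι s • (show N from x) =
            ι s • ((v⁻¹ : Rˣ) : R) • (show N from x)
          rw [smul_smul, smul_smul, (hvc _).eq] }), ?_⟩⟩⟩
  ext n
  change ∑ g, (u g : R) • ((v⁻¹ : Rˣ) : R) • ((u g⁻¹ : Rˣ) : R) • n = n
  have h (g : G) :
      (u g : R) • ((v⁻¹ : Rˣ) : R) • ((u g⁻¹ : Rˣ) : R) • n = ((v⁻¹ : Rˣ) : R) • n := by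
    rw [smul_smul, smul_smul, (hvc _).eq, mul_assoc, ← Units.val_mul, ← map_mul]
    simp
  rw [Finset.sum_congr rfl fun g _ => h g, Finset.sum_const, Finset.card_univ,
    ← Nat.cast_smul_eq_nsmul R, ← hv, smul_smul, Units.mul_inv, one_smul]

end SkewGroupRing

/-- Let `S` be a commutative ring, `G` a finite group acting on `S` by ring
automorphisms with `|G|` invertible in `S`, and let `R = S * G` be the skew group
ring: `R` contains `S` via `ι`, the units `u g` satisfy `u g * ι s = ι (g • s) * u g`,
`u` is multiplicative, and `{u g}` is a basis of `R` as a left `S`-module. If the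
Gorenstein projective `S`-modules are precovering, then so are the Gorenstein
projective `R`-modules. -/
theorem skew_group_ring_gp_precovering {S R : Type u} [CommRing S] [Ring R]
    (G : Type u) [Group G] [Fintype G] [MulSemiringAction G S]
    (hinv : IsUnit ((Fintype.card G : ℕ) : S))
    (ι : S →+* R) (hι : Function.Injective ι)
    (u : G →* Rˣ)
    (hcomm : ∀ (g : G) (s : S), (u g : R) * ι s = ι (g • s) * (u g : R))
    (hbasis : ∀ r : R, ∃! c : G →₀ S, r = c.sum fun g s => ι s * (u g : R))
    (hS : ∀ M : ModuleCat.{u} S, ∃ (X : ModuleCat.{u} S) (φ : X ⟶ M),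
      IsPrecover (IsGorensteinProjective (A := ModuleCat.{u} S)) φ) :
    ∀ N : ModuleCat.{u} R, ∃ (Y : ModuleCat.{u} R) (φ : Y ⟶ N),
      IsPrecover (IsGorensteinProjective (A := ModuleCat.{u} R)) φ := by
  obtain ⟨t, ht, ht', ht₁, htu, hdual⟩ := exists_skewGroupRing_trace ι u hcomm hbasis
  exact exists_gorensteinProjective_precover_of_ambidextrous
    (skewGroupRingCoextendRestrictAdj ι u hcomm hbasis t ht ht' ht₁ htu hdual)
    (ModuleCat.restrictCoextendScalarsAdj.{u, u, u} ι)
    (isSplitEpi_skewGroupRing_counit hinv ι u hcomm hbasis) hS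
end
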